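/- arXiv:1110.0939 — 2 statements merged into one kernel-verified Lean document; each statement's English description precedes it below -/
import Mathlib

section
/- There exists a constant C > 0 such that for all integers n ≥ 2, |Σ_{2 < p ≤ 2n, p prime} (−1/p)·log p/(p−1) − Σ_{p odd prime} (−1/p)·log p/(p−1)| ≤ C/(log n), where the second sum is the (convergent) sum over all odd primes. -/
/-- The nontrivial Dirichlet character modulo `4` with complex values. -/
noncomputable def chiFour : DirichletCharacter ℂ 4 := ZMod.χ₄.ringHomComp (Int.castRingHom ℂ)

lemma chiFour_apply (n : ℕ) : chiFour n = ((ZMod.χ₄ n : ℤ) : ℂ) := rfl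

lemma chiFour_ne_one : chiFour ≠ 1 := by
  intro h
  have h3 : chiFour ((3 : ℕ) : ZMod 4) = (1 : DirichletCharacter ℂ 4) ((3 : ℕ) : ZMod 4) := by rw [h]
  rw [chiFour_apply, MulChar.one_apply (by decide)] at h3
  have : ZMod.χ₄ ((3 : ℕ) : ZMod 4) = -1 := by decide
  rw [this] at h3
  norm_num at h3

lemma chiFour_sq : chiFour ^ 2 = 1 := by
  ext a
  have h : ∀ a : (ZMod 4)ˣ, ZMod.χ₄ a ^ 2 = 1 := by decide
  rw [MulChar.pow_apply_coe, MulChar.one_apply_coe]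
  change ((ZMod.χ₄ a : ℤ) : ℂ) ^ 2 = 1
  exact_mod_cast h a

lemma norm_cpow_neg_sub_cpow_neg_le {a b : ℝ} (ha : 0 < a) (hab : a ≤ b) {s : ℂ}
    (hs : 0 ≤ s.re) :
    ‖(a : ℂ) ^ (-s) - (b : ℂ) ^ (-s)‖ ≤ ‖s‖ * a ^ (-s.re - 1) * (b - a) := by
  rw [norm_sub_rev]
  refine norm_image_sub_le_of_norm_deriv_le_segment' (f := fun u : ℝ ↦ (u : ℂ) ^ (-s))
    (f' := fun u : ℝ ↦ -s * (u : ℂ) ^ (-s - 1)) ?_ ?_ b ⟨hab, le_rfl⟩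
  · intro x hx
    have hx0 : 0 < x := ha.trans_le hx.1
    have h1 : HasDerivAt (fun u : ℂ ↦ u ^ (-s)) (-s * (x : ℂ) ^ (-s - 1)) (x : ℂ) := by
      have := (hasDerivAt_id (x : ℂ)).cpow_const (c := -s) (Or.inl (by simpa using hx0))
      simpa using this
    exact h1.comp_ofReal.hasDerivWithinAt
  · intro x hx
    have hx0 : 0 < x := ha.trans_le hx.1
    rw [norm_mul, norm_neg, Complex.norm_cpow_eq_rpow_re_of_pos hx0]
    gcongr
    simp only [Complex.sub_re, Complex.neg_re, Complex.one_re]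
    exact Real.rpow_le_rpow_of_nonpos ha hx.1 (by linarith)

lemma norm_cpow_neg_sub_cpow_neg_le_rpow {a b : ℝ} (ha : 0 < a) (hab : a ≤ b) (hb : b ≤ a + 2)
    {s : ℂ} (hs : 0 ≤ s.re) {θ : ℝ} (h0 : 0 ≤ θ) (h1 : θ ≤ 1) :
    ‖(a : ℂ) ^ (-s) - (b : ℂ) ^ (-s)‖ ≤ 2 * ‖s‖ ^ θ * a ^ (-s.re - θ) := by
  have hA : ‖(a : ℂ) ^ (-s) - (b : ℂ) ^ (-s)‖ ≤ 2 * a ^ (-s.re) := by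
    refine (norm_sub_le _ _).trans ?_
    rw [Complex.norm_cpow_eq_rpow_re_of_pos ha,
      Complex.norm_cpow_eq_rpow_re_of_pos (ha.trans_le hab), Complex.neg_re]
    have := Real.rpow_le_rpow_of_nonpos ha hab (z := -s.re) (by linarith)
    linarith
  have hB : ‖(a : ℂ) ^ (-s) - (b : ℂ) ^ (-s)‖ ≤ 2 * (‖s‖ * a ^ (-s.re - 1)) := by
    refine (norm_cpow_neg_sub_cpow_neg_le ha hab hs).trans ?_
    rw [mul_comm 2]
    gcongr
    linarith
  set D := ‖(a : ℂ) ^ (-s) - (b : ℂ) ^ (-s)‖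
  have hD : 0 ≤ D := norm_nonneg _
  calc D = D ^ (1 - θ) * D ^ θ := by
        rw [← Real.rpow_add' hD (by simp)]; simp
    _ ≤ (2 * a ^ (-s.re)) ^ (1 - θ) * (2 * (‖s‖ * a ^ (-s.re - 1))) ^ θ := by
        gcongr
    _ = 2 * ‖s‖ ^ θ * a ^ (-s.re - θ) := by
        rw [Real.mul_rpow (by norm_num) (by positivity), Real.mul_rpow (by norm_num) (by positivity),
          Real.mul_rpow (by positivity) (by positivity), ← Real.rpow_mul ha.le, ← Real.rpow_mul ha.le]
        have e1 : (2 : ℝ) ^ (1 - θ) * 2 ^ θ = 2 := by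
          rw [← Real.rpow_add (by norm_num)]; simp
        have e2 : a ^ (-s.re * (1 - θ)) * a ^ ((-s.re - 1) * θ) = a ^ (-s.re - θ) := by
          rw [← Real.rpow_add ha]; congr 1; ring
        rw [← e2]
        linear_combination ‖s‖ ^ θ * (a ^ (-s.re * (1 - θ)) * a ^ ((-s.re - 1) * θ)) * e1

lemma summable_succ_rpow {r : ℝ} (hr : r < -1) : Summable fun m : ℕ ↦ ((m : ℝ) + 1) ^ r := by
  have := (summable_nat_add_iff 1).2 (Real.summable_nat_rpow.2 hr)
  simpa using this

/-- The Dirichlet series of `chiFour` with consecutive terms grouped in pairs. -/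
lemma LFunction_chiFour_eq_tsum_of_one_lt {s : ℂ} (hs : 1 < s.re) :
    chiFour.LFunction s =
      ∑' m : ℕ, (((4 * m + 1 : ℝ) : ℂ) ^ (-s) - ((4 * m + 3 : ℝ) : ℂ) ^ (-s)) := by
  rw [DirichletCharacter.LFunction_eq_LSeries _ hs]
  have hsum := chiFour.LSeriesSummable_of_one_lt_re hs
  have h := hsum.hasSum
  rw [LSeries]
  unfold LSeriesSummable at hsum
  set f := LSeries.term (fun n : ℕ ↦ chiFour n) s with hf
  have hval : ∀ n : ℕ, f n = chiFour n * (n : ℂ) ^ (-s) := by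
    intro n
    rcases eq_or_ne n 0 with rfl | hn
    · have h0 : chiFour 0 = 0 := by simpa using chiFour_apply 0
      simp [hf, h0]
    · rw [hf, LSeries.term_of_ne_zero hn, Complex.cpow_neg, div_eq_mul_inv]
  have key := (Nat.sumByResidueClasses hsum 4)
  rw [key]
  have hres : ∀ j : ZMod 4, (∑' m : ℕ, f (j.val + 4 * m)) =
      ∑' m : ℕ, (ZMod.χ₄ j : ℂ) * ((j.val + 4 * m : ℕ) : ℂ) ^ (-s) := by
    intro j
    congr 1; ext m
    rw [hval, chiFour_apply]
    simp [show (4 : ZMod 4) = 0 by decide]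
  have hu : (Finset.univ : Finset (ZMod 4)) = {0, 1, 2, 3} := by decide
  have hsj : ∀ j : ℕ, Summable fun m : ℕ ↦ f (j + 4 * m) := by
    intro j
    exact hsum.comp_injective (fun a b h ↦ by simpa using h)
  rw [hu, Finset.sum_insert (by decide), Finset.sum_insert (by decide), Finset.sum_insert (by decide),
    Finset.sum_singleton, hres 0, hres 2]
  rw [show ZMod.χ₄ 0 = 0 by decide, show ZMod.χ₄ 2 = 0 by decide]
  simp only [Int.cast_zero, zero_mul, tsum_zero, zero_add]
  rw [← Summable.tsum_add (hsj _) (hsj _)]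
  congr 1; ext m
  rw [hval, hval, chiFour_apply, chiFour_apply]
  rw [show (1 : ZMod 4).val = 1 from rfl, show (3 : ZMod 4).val = 3 from rfl]
  push_cast
  rw [show (4 : ZMod 4) = 0 by decide]
  simp only [zero_mul, add_zero]
  rw [show ZMod.χ₄ 1 = 1 by decide, show ZMod.χ₄ 3 = -1 by decide]
  push_cast
  rw [add_comm (1 : ℂ), add_comm (3 : ℂ)]
  ring

lemma norm_chiFour_pair_le {s : ℂ} {θ : ℝ} (h0 : 0 < θ) (h1 : θ ≤ 1) (hs : 1 - θ / 2 ≤ s.re)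
    (m : ℕ) :
    ‖((4 * m + 1 : ℝ) : ℂ) ^ (-s) - ((4 * m + 3 : ℝ) : ℂ) ^ (-s)‖ ≤
      2 * ‖s‖ ^ θ * ((m : ℝ) + 1) ^ (-1 - θ / 2) := by
  refine (norm_cpow_neg_sub_cpow_neg_le_rpow (by positivity) (by linarith) (by linarith)
    (by linarith) h0.le h1).trans ?_
  gcongr
  have hm : (0 : ℝ) ≤ m := m.cast_nonneg
  calc (4 * (m : ℝ) + 1) ^ (-s.re - θ) ≤ ((m : ℝ) + 1) ^ (-s.re - θ) :=
        Real.rpow_le_rpow_of_nonpos (by positivity) (by linarith) (by linarith)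
    _ ≤ _ := Real.rpow_le_rpow_of_exponent_le (by linarith) (by linarith)

lemma LFunction_chiFour_eq_tsum {s : ℂ} (hs : 1 / 2 < s.re) :
    chiFour.LFunction s =
      ∑' m : ℕ, (((4 * m + 1 : ℝ) : ℂ) ^ (-s) - ((4 * m + 3 : ℝ) : ℂ) ^ (-s)) := by
  set R := ‖s‖ + 3
  set U : Set ℂ := {z | 1 / 2 < z.re} ∩ Metric.ball 0 R with hU
  have hUo : IsOpen U := (isOpen_lt continuous_const Complex.continuous_re).inter Metric.isOpen_ball
  have hUc : Convex ℝ U := (convex_halfSpace_re_gt _).inter (convex_ball _ _)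
  have hd : DifferentiableOn ℂ (fun z : ℂ ↦
      ∑' m : ℕ, (((4 * m + 1 : ℝ) : ℂ) ^ (-z) - ((4 * m + 3 : ℝ) : ℂ) ^ (-z))) U := by
    refine Complex.differentiableOn_tsum_of_summable_norm
      (u := fun m : ℕ ↦ 2 * R ^ (1 : ℝ) * ((m : ℝ) + 1) ^ (-1 - (1 : ℝ) / 2))
      ((summable_succ_rpow (by norm_num)).mul_left _) ?_ hUo ?_
    · intro m
      have e : ∀ c : ℝ, 0 < c → Differentiable ℂ fun z : ℂ ↦ (c : ℂ) ^ (-z) := fun c hc ↦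
        differentiable_neg.const_cpow (Or.inl (by exact_mod_cast hc.ne'))
      exact ((e _ (by positivity)).sub (e _ (by positivity))).differentiableOn
    · intro m z hz
      refine (norm_chiFour_pair_le one_pos le_rfl (by have := hz.1.out; linarith) m).trans ?_
      have hz2 : ‖z‖ ≤ R := by simpa using (mem_ball_zero_iff.1 hz.2).le
      gcongr
  have h2 : (2 : ℂ) ∈ U := by
    refine ⟨by norm_num, ?_⟩
    simp only [mem_ball_zero_iff, R]
    have := norm_nonneg s
    norm_num; linarith
  refine AnalyticOnNhd.eqOn_of_preconnected_of_eventuallyEq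
    ((DirichletCharacter.differentiable_LFunction chiFour_ne_one).differentiableOn.analyticOnNhd hUo)
    (hd.analyticOnNhd hUo) hUc.isPreconnected h2 ?_ (⟨hs, by simp [R]⟩ : s ∈ U)
  have : {z : ℂ | 1 < z.re} ∈ nhds (2 : ℂ) :=
    (isOpen_lt continuous_const Complex.continuous_re).mem_nhds (by norm_num)
  filter_upwards [this] with z hz using LFunction_chiFour_eq_tsum_of_one_lt hz

lemma exists_norm_LFunction_chiFour_le {θ : ℝ} (h0 : 0 < θ) (h1 : θ < 1) :
    ∃ C > 0, ∀ s : ℂ, 1 - θ / 2 ≤ s.re → s.re ≤ 4 →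
      ‖chiFour.LFunction s‖ ≤ C * (2 + |s.im|) ^ θ := by
  have hS := summable_succ_rpow (r := -1 - θ / 2) (by linarith)
  refine ⟨2 * 2 ^ θ * ∑' m : ℕ, ((m : ℝ) + 1) ^ (-1 - θ / 2), ?_, fun s hs hs4 ↦ ?_⟩
  · have := hS.tsum_pos (fun m ↦ by positivity) 0 (by norm_num)
    positivity
  rw [LFunction_chiFour_eq_tsum (by linarith)]
  refine (tsum_of_norm_bounded ((hS.mul_left (2 * ‖s‖ ^ θ)).hasSum)
    (norm_chiFour_pair_le h0 h1.le hs)).trans ?_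
  rw [tsum_mul_left]
  have hns : ‖s‖ ≤ 2 * (2 + |s.im|) := by
    have := Complex.norm_le_abs_re_add_abs_im s
    rw [abs_of_nonneg (by linarith : 0 ≤ s.re)] at this
    have := abs_nonneg s.im
    linarith
  have h3 : ‖s‖ ^ θ ≤ 2 ^ θ * (2 + |s.im|) ^ θ := by
    rw [← Real.mul_rpow (by norm_num) (by positivity)]
    gcongr
  have h4 : 0 ≤ ∑' m : ℕ, ((m : ℝ) + 1) ^ (-1 - θ / 2) := tsum_nonneg fun m ↦ by positivity
  calc _ ≤ 2 * (2 ^ θ * (2 + |s.im|) ^ θ) * ∑' m : ℕ, ((m : ℝ) + 1) ^ (-1 - θ / 2) := by gcongr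
    _ = _ := by ring

lemma exists_norm_riemannZeta_sub_le {θ : ℝ} (h0 : 0 < θ) (h1 : θ ≤ 1) :
    ∃ C > 0, ∀ s : ℂ, 1 < s.re → ‖riemannZeta s - 1 / (s - 1)‖ ≤ C * ‖s‖ ^ θ := by
  have hS := summable_succ_rpow (r := -1 - θ) (by linarith)
  refine ⟨2 * ∑' m : ℕ, ((m : ℝ) + 1) ^ (-1 - θ), ?_, fun s hs ↦ ?_⟩
  · have := hS.tsum_pos (fun m ↦ by positivity) 0 (by norm_num)
    positivity
  have hs1 : s - 1 ≠ 0 := by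
    intro h
    have := congrArg Complex.re h
    simp at this; linarith
  set G : ℝ → ℂ := fun u ↦ (u : ℂ) ^ (1 - s) / (s - 1) with hG
  set d : ℕ → ℂ := fun m ↦ ((m + 1 : ℝ) : ℂ) ^ (-s) + (G (m + 1 + 1) - G (m + 1)) with hd
  have hd_le : ∀ m, ‖d m‖ ≤ 2 * ‖s‖ ^ θ * ((m : ℝ) + 1) ^ (-1 - θ) := by
    intro m
    set a : ℝ := m + 1 with ha
    have ha0 : 0 < a := by positivity
    have ha1 : 1 ≤ a := by simp [ha]
    have key := norm_image_sub_le_of_norm_deriv_le_segment' (f := fun u : ℝ ↦ G u + u * (a : ℂ) ^ (-s))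
      (f' := fun u : ℝ ↦ (a : ℂ) ^ (-s) - (u : ℂ) ^ (-s)) (a := a) (b := a + 1)
      (C := 2 * ‖s‖ ^ θ * a ^ (-1 - θ)) ?_ ?_ (a + 1) ⟨by linarith, le_rfl⟩
    · rw [add_sub_cancel_left, mul_one] at key
      have e : d m = G (a + 1) + (a + 1 : ℝ) * (a : ℂ) ^ (-s) - (G a + a * (a : ℂ) ^ (-s)) := by
        have e : d m = (a : ℂ) ^ (-s) + (G (a + 1) - G a) := rfl
        rw [e]; push_cast; ring
      rw [e]; exact key
    · intro x hx
      have hx0 : 0 < x := ha0.trans_le hx.1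
      have h1 : HasDerivAt (fun u : ℂ ↦ u ^ (1 - s) / (s - 1) + u * (a : ℂ) ^ (-s))
          ((a : ℂ) ^ (-s) - (x : ℂ) ^ (-s)) (x : ℂ) := by
        have := (((hasDerivAt_id (x : ℂ)).cpow_const (c := 1 - s)
          (Or.inl (by simpa using hx0))).div_const (s - 1)).add
            ((hasDerivAt_id (x : ℂ)).mul_const ((a : ℂ) ^ (-s)))
        refine this.congr_deriv ?_
        simp only [id_eq, mul_one, one_mul]
        rw [show 1 - s - 1 = -s by ring]
        field_simp
        ring
      exact h1.comp_ofReal.hasDerivWithinAt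
    · intro x hx
      refine (norm_cpow_neg_sub_cpow_neg_le_rpow ha0 hx.1 (by linarith [hx.2]) (by linarith)
        h0.le h1).trans ?_
      gcongr
  have hsum : Summable d := Summable.of_norm_bounded (hS.mul_left _) hd_le
  have hlim : Filter.Tendsto (fun N ↦ ∑ m ∈ Finset.range N, d m) Filter.atTop
      (nhds (riemannZeta s - 1 / (s - 1))) := by
    have e : ∀ N : ℕ, ∑ m ∈ Finset.range N, d m =
        ∑ m ∈ Finset.range N, 1 / ((m : ℂ) + 1) ^ s + (G (N + 1) - G (0 + 1)) := by
      intro N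
      have ht := Finset.sum_range_sub (fun m : ℕ ↦ G ((m : ℝ) + 1)) N
      simp only [Nat.cast_add, Nat.cast_one, Nat.cast_zero] at ht
      rw [← ht, ← Finset.sum_add_distrib]
      refine Finset.sum_congr rfl fun m _ ↦ ?_
      simp only [hd]
      rw [Complex.cpow_neg]
      push_cast
      simp
    simp_rw [e]
    rw [zeta_eq_tsum_one_div_nat_add_one_cpow hs, sub_eq_add_neg]
    have hz : Summable fun m : ℕ ↦ 1 / ((m : ℂ) + 1) ^ s := by
      have := (summable_nat_add_iff 1).2 (Complex.summable_one_div_nat_cpow.2 hs)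
      simpa using this
    refine hz.hasSum.tendsto_sum_nat.add ?_
    have hG0 : Filter.Tendsto G Filter.atTop (nhds 0) := by
      rw [tendsto_zero_iff_norm_tendsto_zero]
      have h1 : Filter.Tendsto (fun u : ℝ ↦ u ^ (-(s.re - 1)) / ‖s - 1‖) Filter.atTop
          (nhds (0 / ‖s - 1‖)) := (tendsto_rpow_neg_atTop (by linarith)).div_const _
      rw [zero_div] at h1
      refine h1.congr' ?_
      filter_upwards [Filter.eventually_gt_atTop 0] with u hu
      simp only [hG]
      rw [norm_div, Complex.norm_cpow_eq_rpow_re_of_pos hu]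
      simp
    have h2 := (hG0.comp (Filter.tendsto_atTop_add_const_right _ (1 : ℝ)
      tendsto_natCast_atTop_atTop)).sub_const (G (0 + 1))
    have e : -(1 / (s - 1)) = 0 - G (0 + 1) := by
      change _ = 0 - ((0 + 1 : ℝ) : ℂ) ^ (1 - s) / (s - 1)
      simp
    rw [e]
    exact h2
  rw [← tendsto_nhds_unique hsum.hasSum.tendsto_sum_nat hlim]
  refine (tsum_of_norm_bounded ((hS.mul_left (2 * ‖s‖ ^ θ)).hasSum) hd_le).trans ?_
  rw [tsum_mul_left]
  apply le_of_eq; ring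

lemma norm_LFunction_one_le {s : ℂ} (hs : 1 < s.re) :
    ‖(1 : DirichletCharacter ℂ 4).LFunction s‖ ≤ 2 * ‖riemannZeta s‖ := by
  have hs1 : s ≠ 1 := by rintro rfl; simp at hs
  have h := DirichletCharacter.LFunctionTrivChar_eq_mul_riemannZeta (N := 4) hs1
  have h4 : Nat.primeFactors 4 = {2} := by
    rw [show 4 = 2 ^ 2 by norm_num, Nat.primeFactors_prime_pow (by norm_num) Nat.prime_two]
  rw [DirichletCharacter.LFunctionTrivChar, h4, Finset.prod_singleton] at h
  rw [h, norm_mul]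
  gcongr
  refine (norm_sub_le _ _).trans ?_
  have : ‖((2 : ℕ) : ℂ) ^ (-s)‖ ≤ 1 := by
    rw [Complex.norm_natCast_cpow_of_pos (by norm_num)]
    exact Real.rpow_le_one_of_one_le_of_nonpos (by norm_num) (by simp; linarith)
  rw [norm_one]; linarith

lemma exists_le_norm_LFunction_chiFour_pow_four {θ : ℝ} (h0 : 0 < θ) (h1 : θ ≤ 1) :
    ∃ c > 0, ∀ x t : ℝ, 0 < x → x ≤ 1 → 1 ≤ |t| →
      c * x ^ 3 * (2 + |t|) ^ (-θ) ≤ ‖chiFour.LFunction (1 + x + Complex.I * t)‖ ^ 4 := by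
  obtain ⟨C, hC, hz⟩ := exists_norm_riemannZeta_sub_le h0 h1
  have hz' : ∀ s : ℂ, 1 < s.re → ‖(1 : DirichletCharacter ℂ 4).LFunction s‖ ≤
      2 * (1 / ‖s - 1‖ + C * ‖s‖ ^ θ) := by
    intro s hs
    refine (norm_LFunction_one_le hs).trans ?_
    gcongr
    have := norm_le_norm_sub_add (riemannZeta s) (1 / (s - 1))
    rw [norm_div, norm_one] at this
    linarith [hz s hs]
  set C₁ := 2 * (1 + C * 2 ^ θ)
  set C₂ := 2 * (1 + C * 2 ^ θ)
  have hC₁ : 0 < C₁ := by positivity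
  have hC₂ : 0 < C₂ := by positivity
  refine ⟨1 / (C₁ ^ 3 * C₂), by positivity, fun x t hx hx1 ht ↦ ?_⟩
  have hprod := DirichletCharacter.norm_LFunction_product_ge_one chiFour hx t
  rw [chiFour_sq, norm_mul, norm_mul, norm_pow, norm_pow, DirichletCharacter.LFunctionTrivChar]
    at hprod
  have hA : ‖(1 : DirichletCharacter ℂ 4).LFunction (1 + x)‖ ≤ C₁ / x := by
    refine (hz' _ (by simpa using hx)).trans ?_
    rw [add_sub_cancel_left, Complex.norm_real, Real.norm_of_nonneg hx.le]
    have : ‖(1 + x : ℂ)‖ ≤ 2 := by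
      refine (norm_add_le _ _).trans ?_
      rw [Complex.norm_real, Real.norm_of_nonneg hx.le, norm_one]; linarith
    have h3 : C * ‖(1 + x : ℂ)‖ ^ θ ≤ C * 2 ^ θ / x := by
      rw [le_div_iff₀ hx]
      have : C * ‖(1 + x : ℂ)‖ ^ θ ≤ C * 2 ^ θ := by gcongr
      exact (mul_le_of_le_one_right (by positivity) hx1).trans this
    calc _ ≤ 2 * (1 / x + C * 2 ^ θ / x) := by gcongr
      _ = _ := by simp only [C₁]; ring
  have hτ : 1 ≤ (2 + |t|) ^ θ := Real.one_le_rpow (by linarith [abs_nonneg t]) h0.le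
  have hB : ‖(1 : DirichletCharacter ℂ 4).LFunction (1 + x + 2 * Complex.I * t)‖ ≤
      C₂ * (2 + |t|) ^ θ := by
    refine (hz' _ (by simpa using hx)).trans ?_
    have n1 : 1 ≤ ‖(1 + x + 2 * Complex.I * t : ℂ) - 1‖ := by
      have := Complex.abs_im_le_norm ((1 + x + 2 * Complex.I * t : ℂ) - 1)
      simp [abs_mul] at this
      have h9 : (1 + x + 2 * Complex.I * t : ℂ) - 1 = x + 2 * Complex.I * t := by ring
      rw [h9] at this ⊢
      linarith
    have n2 : ‖(1 + x + 2 * Complex.I * t : ℂ)‖ ≤ 2 * (2 + |t|) := by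
      refine (Complex.norm_le_abs_re_add_abs_im _).trans ?_
      simp [abs_mul]
      rw [abs_of_nonneg (by linarith)]
      linarith
    have n3 : ‖(1 + x + 2 * Complex.I * t : ℂ)‖ ^ θ ≤ 2 ^ θ * (2 + |t|) ^ θ := by
      rw [← Real.mul_rpow (by norm_num) (by positivity)]
      gcongr
    have n4 : 1 / ‖(1 + x + 2 * Complex.I * t : ℂ) - 1‖ ≤ (2 + |t|) ^ θ :=
      ((div_le_one (by linarith)).2 n1).trans hτ
    calc _ ≤ 2 * ((2 + |t|) ^ θ + C * (2 ^ θ * (2 + |t|) ^ θ)) := by gcongr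
      _ = _ := by simp only [C₂]; ring
  set Lam := ‖chiFour.LFunction (1 + x + Complex.I * t)‖
  have h5 : 1 ≤ (C₁ / x) ^ 3 * Lam ^ 4 * (C₂ * (2 + |t|) ^ θ) := by
    refine hprod.le.trans ?_
    gcongr
  rw [Real.rpow_neg (by positivity)]
  have : (2 + |t|) ^ θ > 0 := by positivity
  rw [← div_eq_mul_inv, div_le_iff₀ this, one_div, inv_mul_le_iff₀ (by positivity)]
  rw [div_pow] at h5
  have hx3 : 0 < x ^ 3 := by positivity
  calc x ^ 3 = x ^ 3 * 1 := by ring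
    _ ≤ x ^ 3 * (C₁ ^ 3 / x ^ 3 * Lam ^ 4 * (C₂ * (2 + |t|) ^ θ)) := by gcongr
    _ = _ := by field_simp

lemma exists_norm_LFunction_chiFour_sub_le {θ : ℝ} (h0 : 0 < θ) (h1 : θ < 1) :
    ∃ C > 0, ∀ s w : ℂ, 1 ≤ s.re → s.re ≤ 2 → ‖w‖ ≤ θ / 4 →
      ‖chiFour.LFunction (s + w) - chiFour.LFunction s‖ ≤ C * (2 + |s.im|) ^ θ * ‖w‖ := by
  obtain ⟨C, hC, hL⟩ := exists_norm_LFunction_chiFour_le h0 h1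
  have hdiff := DirichletCharacter.differentiable_LFunction chiFour_ne_one
  refine ⟨C * 2 ^ θ / (θ / 4), by positivity, fun s w hs hs2 hw ↦ ?_⟩
  have hbound : ∀ z ∈ Metric.closedBall s (θ / 4),
      ‖deriv chiFour.LFunction z‖ ≤ C * 2 ^ θ / (θ / 4) * (2 + |s.im|) ^ θ := by
    intro z hz
    have := Complex.norm_deriv_le_of_forall_mem_sphere_norm_le (c := z) (R := θ / 4)
      (C := C * (2 * (2 + |s.im|)) ^ θ) (f := chiFour.LFunction) (by positivity)
      hdiff.diffContOnCl ?_
    · refine this.trans (le_of_eq ?_)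
      rw [Real.mul_rpow (by norm_num) (by positivity)]
      ring
    · intro y hy
      rw [mem_closedBall_iff_norm] at hz
      rw [mem_sphere_iff_norm] at hy
      have hys : ‖y - s‖ ≤ θ / 2 := by
        have := norm_add_le (y - z) (z - s)
        rw [sub_add_sub_cancel] at this
        linarith
      have hre := abs_le.1 ((Complex.abs_re_le_norm (y - s)).trans hys)
      have him := (Complex.abs_im_le_norm (y - s)).trans hys
      rw [Complex.sub_re] at hre
      rw [Complex.sub_im] at him
      refine (hL y (by linarith [hre.1]) (by linarith [hre.2])).trans ?_
      gcongr
      have := abs_sub_abs_le_abs_sub y.im s.im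
      linarith [abs_nonneg s.im]
  have := (convex_closedBall s (θ / 4)).norm_image_sub_le_of_norm_deriv_le
    (fun z _ ↦ hdiff z) hbound (x := s) (y := s + w) (by simp; positivity) (by simpa using hw)
  simpa using this

lemma exists_le_norm_LFunction_chiFour {θ : ℝ} (h0 : 0 < θ) (h1 : θ < 1) :
    ∃ c > 0, ∀ s : ℂ, 1 < s.re → s.re ≤ 2 →
      c * (2 + |s.im|) ^ (-(7 * θ)) ≤ ‖chiFour.LFunction s‖ := by
  have hdiff := DirichletCharacter.differentiable_LFunction chiFour_ne_one
  obtain ⟨C, hC, hLip⟩ := exists_norm_LFunction_chiFour_sub_le h0 h1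
  obtain ⟨c, hc, hlow⟩ := exists_le_norm_LFunction_chiFour_pow_four h0 h1.le
  obtain ⟨c', hc', hcomp⟩ : ∃ c' > 0, ∀ s : ℂ, 1 ≤ s.re → s.re ≤ 2 → |s.im| ≤ 1 →
      c' ≤ ‖chiFour.LFunction s‖ := by
    have hK : IsCompact (Set.Icc (1 : ℝ) 2 ×ℂ Set.Icc (-1 : ℝ) 1) :=
      isCompact_Icc.reProdIm isCompact_Icc
    obtain ⟨z, hz, hmin⟩ := hK.exists_isMinOn ⟨1, by simp [Complex.mem_reProdIm]⟩
      hdiff.continuous.norm.continuousOn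
    rw [Complex.mem_reProdIm] at hz
    refine ⟨_, norm_pos_iff.2 (DirichletCharacter.LFunction_ne_zero_of_one_le_re chiFour
      (Or.inl chiFour_ne_one) hz.1.1), fun s a b d ↦ hmin ?_⟩
    rw [Complex.mem_reProdIm]
    exact ⟨⟨a, b⟩, abs_le.1 d⟩
  set δ := min (θ / 4) (c / (16 * C ^ 4)) with hδ
  have hδ0 : 0 < δ := by positivity
  have hδ1 : δ ≤ θ / 4 := min_le_left _ _
  have hδ2 : 16 * C ^ 4 * δ ≤ c := by
    have : δ ≤ c / (16 * C ^ 4) := min_le_right _ _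
    rwa [le_div_iff₀ (by positivity), mul_comm] at this
  refine ⟨min c' (C * δ), by positivity, fun s hs hs2 ↦ ?_⟩
  set τ := 2 + |s.im| with hτdef
  have hτ : 1 ≤ τ := by have := abs_nonneg s.im; linarith
  have hτ0 : 0 < τ := by linarith
  have hτle : ∀ r : ℝ, 0 ≤ r → τ ^ (-r) ≤ 1 := fun r hr ↦
    Real.rpow_le_one_of_one_le_of_nonpos hτ (by linarith)
  rcases le_total |s.im| 1 with ht | ht
  · refine le_trans ?_ (hcomp s hs.le hs2 ht)
    refine (mul_le_of_le_one_right (by positivity) (hτle _ (by positivity))).trans (min_le_left _ _)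
  suffices h : C * δ * τ ^ (-(7 * θ)) ≤ ‖chiFour.LFunction s‖ by
    refine le_trans ?_ h
    gcongr
    exact min_le_right _ _
  set x₀ := δ * τ ^ (-(8 * θ)) with hx₀
  have hx₀0 : 0 < x₀ := by positivity
  have hx₀1 : x₀ ≤ δ := mul_le_of_le_one_right hδ0.le (hτle _ (by positivity))
  have hbig : ∀ x : ℝ, x₀ ≤ x → x ≤ 1 →
      2 * (C * δ * τ ^ (-(7 * θ))) ≤ ‖chiFour.LFunction (1 + x + Complex.I * s.im)‖ := by
    intro x hx hx1
    refine le_of_pow_le_pow_left₀ (n := 4) (by norm_num) (norm_nonneg _) ?_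
    refine le_trans ?_ (hlow x s.im (hx₀0.trans_le hx) hx1 ht)
    calc (2 * (C * δ * τ ^ (-(7 * θ)))) ^ 4
        = (16 * C ^ 4 * δ) * δ ^ 3 * (τ ^ (-(7 * θ))) ^ 4 := by ring
      _ ≤ c * δ ^ 3 * (τ ^ (-(25 * θ))) := by
          gcongr
          rw [← Real.rpow_natCast, ← Real.rpow_mul hτ0.le]
          exact Real.rpow_le_rpow_of_exponent_le hτ (by push_cast; nlinarith)
      _ = c * x₀ ^ 3 * τ ^ (-θ) := by
          rw [hx₀, mul_pow, ← Real.rpow_natCast (τ ^ _), ← Real.rpow_mul hτ0.le, mul_assoc, mul_assoc,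
            mul_assoc, ← Real.rpow_add hτ0]
          congr 3
          push_cast; ring
      _ ≤ c * x ^ 3 * τ ^ (-θ) := by gcongr
  rcases le_total x₀ (s.re - 1) with hx | hx
  · have := hbig (s.re - 1) hx (by linarith)
    have e : (1 + (s.re - 1 : ℝ) + Complex.I * s.im : ℂ) = s := by
      apply Complex.ext <;> simp
    rw [e] at this
    have : 0 < C * δ * τ ^ (-(7 * θ)) := by positivity
    linarith
  · have h2 := hbig x₀ le_rfl (by linarith)
    have hw : ‖((1 + x₀ - s.re : ℝ) : ℂ)‖ ≤ x₀ := by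
      rw [Complex.norm_real, Real.norm_of_nonneg (by linarith)]
      linarith
    have h3 := hLip s ((1 + x₀ - s.re : ℝ) : ℂ) hs.le hs2 (by linarith)
    have e : s + ((1 + x₀ - s.re : ℝ) : ℂ) = (1 + x₀ + Complex.I * s.im : ℂ) := by
      apply Complex.ext <;> simp
    rw [e] at h3
    have h4 : C * τ ^ θ * ‖((1 + x₀ - s.re : ℝ) : ℂ)‖ ≤ C * δ * τ ^ (-(7 * θ)) := by
      calc _ ≤ C * τ ^ θ * x₀ := by gcongr
        _ = C * δ * (τ ^ θ * τ ^ (-(8 * θ))) := by rw [hx₀]; ring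
        _ = _ := by rw [← Real.rpow_add hτ0]; congr 2; ring
    have h5 := norm_sub_norm_le (chiFour.LFunction (1 + x₀ + Complex.I * s.im)) (chiFour.LFunction s)
    linarith

lemma exists_norm_iteratedDeriv_inv_LFunction_chiFour_le (k : ℕ) :
    ∃ C > 0, ∀ s : ℂ, 1 < s.re → s.re ≤ 2 →
      ‖iteratedDeriv k (fun z ↦ (chiFour.LFunction z)⁻¹) s‖ ≤ C * (2 + |s.im|) ^ (1 / 2 : ℝ) := by
  have hdiff := DirichletCharacter.differentiable_LFunction chiFour_ne_one
  set θ : ℝ := 1 / (2 * (8 * k + 7)) with hθ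
  have h0 : 0 < θ := by positivity
  have h1 : θ < 1 := by
    rw [hθ, div_lt_one (by positivity)]
    have : (0 : ℝ) ≤ k := k.cast_nonneg
    linarith
  have hθk : (8 * k + 7) * θ = 1 / 2 := by rw [hθ]; field_simp
  obtain ⟨C, hC, hLip⟩ := exists_norm_LFunction_chiFour_sub_le h0 h1
  obtain ⟨c, hc, hlow⟩ := exists_le_norm_LFunction_chiFour h0 h1
  set ρ := min (θ / 4) (c / (2 * C))
  have hρ0 : 0 < ρ := by positivity
  have hρ1 : ρ ≤ θ / 4 := min_le_left _ _
  have hρ2 : C * ρ ≤ c / 2 := by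
    have : ρ ≤ c / (2 * C) := min_le_right _ _
    rw [le_div_iff₀ (by positivity)] at this
    linarith
  refine ⟨k.factorial * (2 / c) / ρ ^ k, by positivity, fun s hs hs2 ↦ ?_⟩
  set τ := 2 + |s.im| with hτdef
  have hτ : 1 ≤ τ := by have := abs_nonneg s.im; linarith
  have hτ0 : 0 < τ := by linarith
  set r := ρ * τ ^ (-(8 * θ)) with hr
  have hr0 : 0 < r := by positivity
  have hr1 : r ≤ ρ := mul_le_of_le_one_right hρ0.le
    (Real.rpow_le_one_of_one_le_of_nonpos hτ (by linarith))
  have hlow2 : ∀ z ∈ Metric.closedBall s r, c / 2 * τ ^ (-(7 * θ)) ≤ ‖chiFour.LFunction z‖ := by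
    intro z hz
    rw [mem_closedBall_iff_norm] at hz
    have h3 := hLip s (z - s) hs.le hs2 (by linarith)
    rw [add_sub_cancel, norm_sub_rev] at h3
    have h4 : C * τ ^ θ * ‖z - s‖ ≤ c / 2 * τ ^ (-(7 * θ)) := by
      calc _ ≤ C * τ ^ θ * r := by gcongr
        _ = C * ρ * (τ ^ θ * τ ^ (-(8 * θ))) := by rw [hr]; ring
        _ = C * ρ * τ ^ (-(7 * θ)) := by rw [← Real.rpow_add hτ0]; congr 2; ring
        _ ≤ _ := by gcongr
    have h5 := norm_sub_norm_le (chiFour.LFunction s) (chiFour.LFunction z)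
    have h6 := hlow s hs hs2
    linarith
  have hpos : 0 < c / 2 * τ ^ (-(7 * θ)) := by positivity
  refine (Complex.norm_iteratedDeriv_le_of_forall_mem_sphere_norm_le (R := r)
    (C := 2 / c * τ ^ (7 * θ)) k hr0 ?_ ?_).trans ?_
  · apply DifferentiableOn.diffContOnCl
    rw [closure_ball _ hr0.ne']
    intro z hz
    exact ((hdiff z).inv (norm_pos_iff.1 (hpos.trans_le (hlow2 z hz)))).differentiableWithinAt
  · intro z hz
    rw [norm_inv]
    refine (inv_anti₀ hpos (hlow2 z (Metric.sphere_subset_closedBall hz))).trans (le_of_eq ?_)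
    rw [Real.rpow_neg hτ0.le]
    field_simp
  · apply le_of_eq
    have e : τ ^ (1 / 2 : ℝ) = τ ^ (7 * θ) * (τ ^ (8 * θ)) ^ k := by
      rw [← Real.rpow_natCast, ← Real.rpow_mul hτ0.le, ← Real.rpow_add hτ0, ← hθk]
      congr 1; ring
    rw [e, hr, mul_pow, Real.rpow_neg hτ0.le, inv_pow]
    field_simp

section

open Complex MeasureTheory

/-- The truncation `t ↦ max (1 - t) 0`, written so that its Mellin transform is immediate. -/
noncomputable def rieszKernel : ℝ → ℂ := fun t ↦
  Set.indicator (Set.Ioc 0 1) (fun _ ↦ (1 : ℂ)) t -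
    Set.indicator (Set.Ioc 0 1) (fun t : ℝ ↦ (t : ℂ) ^ (1 : ℂ)) t

lemma rieszKernel_apply {t : ℝ} (ht : 0 < t) : rieszKernel t = (max (1 - t) 0 : ℝ) := by
  by_cases h : t ≤ 1
  · have : t ∈ Set.Ioc (0 : ℝ) 1 := ⟨ht, h⟩
    rw [rieszKernel, Set.indicator_of_mem this, Set.indicator_of_mem this, max_eq_left (by linarith)]
    simp
  · have : t ∉ Set.Ioc (0 : ℝ) 1 := fun h' ↦ h h'.2
    rw [rieszKernel, Set.indicator_of_notMem this, Set.indicator_of_notMem this,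
      max_eq_right (by linarith)]
    simp

lemma hasMellin_rieszKernel {s : ℂ} (hs : 0 < s.re) :
    HasMellin rieszKernel s (1 / s - 1 / (s + 1)) := by
  have h1 := hasMellin_one_Ioc hs
  have h2 := hasMellin_cpow_Ioc 1 (s := s) (by simp; linarith)
  have := hasMellin_sub h1.1 h2.1
  rw [h1.2, h2.2] at this
  exact this

lemma norm_one_div_sub_one_div_add_one_le {σ : ℝ} (hσ : 1 ≤ σ) (y : ℝ) :
    ‖1 / (σ + y * I : ℂ) - 1 / (σ + y * I + 1 : ℂ)‖ ≤ (1 + y ^ 2)⁻¹ := by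
  set s : ℂ := σ + y * I with hs
  have hre : s.re = σ := by simp [hs]
  have him : s.im = y := by simp [hs]
  have h0 : s ≠ 0 := fun h ↦ by rw [h] at hre; simp at hre; linarith
  have h1 : s + 1 ≠ 0 := fun h ↦ by
    have := congrArg re h
    simp [hre] at this; linarith
  have key : ∀ a : ℝ, 1 ≤ a → √(1 + y ^ 2) ≤ ‖(a + y * I : ℂ)‖ := by
    intro a ha
    rw [Complex.norm_add_mul_I]
    apply Real.sqrt_le_sqrt
    nlinarith
  have k1 := key σ hσ
  have k2 := key (σ + 1) (by linarith)
  have e : 1 / s - 1 / (s + 1) = (s * (s + 1))⁻¹ := by field_simp; ring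
  rw [e, norm_inv, norm_mul]
  apply inv_anti₀ (by positivity)
  calc 1 + y ^ 2 = √(1 + y ^ 2) * √(1 + y ^ 2) := (Real.mul_self_sqrt (by positivity)).symm
    _ ≤ ‖s‖ * ‖s + 1‖ := by
      gcongr
      have e2 : (((σ + 1 : ℝ) : ℂ) + y * I) = s + 1 := by simp [hs]; ring
      rwa [e2] at k2

lemma continuous_one_div_sub_one_div_add_one {σ : ℝ} (hσ : 1 ≤ σ) :
    Continuous fun y : ℝ ↦ 1 / (σ + y * I : ℂ) - 1 / (σ + y * I + 1 : ℂ) := by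
  have : ∀ a : ℝ, 1 ≤ a → ∀ y : ℝ, (a + y * I : ℂ) ≠ 0 := fun a ha y h ↦ by
    have := congrArg re h
    simp at this; linarith
  refine (continuous_const.div (by fun_prop) (this σ hσ)).sub
    (continuous_const.div (by fun_prop) fun y ↦ ?_)
  have := this (σ + 1) (by linarith) y
  push_cast at this
  convert this using 1; ring

lemma integrable_one_div_sub_one_div_add_one {σ : ℝ} (hσ : 1 ≤ σ) :
    Integrable fun y : ℝ ↦ 1 / (σ + y * I : ℂ) - 1 / (σ + y * I + 1 : ℂ) :=
  integrable_inv_one_add_sq.mono' (continuous_one_div_sub_one_div_add_one hσ).aestronglyMeasurable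
    (.of_forall (norm_one_div_sub_one_div_add_one_le hσ))

lemma integral_cpow_mul_eq_rieszKernel {σ : ℝ} (hσ : 1 ≤ σ) {x : ℝ} (hx : 0 < x) :
    ∫ y : ℝ, (x : ℂ) ^ (-(σ + y * I)) * (1 / (σ + y * I : ℂ) - 1 / (σ + y * I + 1 : ℂ)) =
      2 * Real.pi * (max (1 - x) 0 : ℝ) := by
  have hm : ∀ y : ℝ, mellin rieszKernel (σ + y * I) =
      1 / (σ + y * I : ℂ) - 1 / (σ + y * I + 1 : ℂ) := fun y ↦
    (hasMellin_rieszKernel (by simp; linarith)).2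
  have hc : ContinuousAt rieszKernel x := by
    have : ContinuousAt (fun t : ℝ ↦ ((max (1 - t) 0 : ℝ) : ℂ)) x := by fun_prop
    refine this.congr ?_
    filter_upwards [lt_mem_nhds hx] with t ht using (rieszKernel_apply ht).symm
  have hinv := mellinInv_mellin_eq σ rieszKernel hx (hasMellin_rieszKernel (by simp; linarith)).1
    (by
      have := integrable_one_div_sub_one_div_add_one hσ
      simp_rw [← hm] at this
      exact this) hc
  rw [mellinInv, rieszKernel_apply hx] at hinv
  simp_rw [hm, smul_eq_mul] at hinv
  rw [← hinv, Complex.real_smul]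
  push_cast
  have : (Real.pi : ℂ) ≠ 0 := by exact_mod_cast Real.pi_ne_zero
  rw [← mul_assoc, show (2 * Real.pi : ℂ) * (1 / (2 * Real.pi)) = 1 by field_simp, one_mul]

lemma integrable_one_add_sq_rpow : Integrable fun y : ℝ ↦ 2 * (1 + y ^ 2) ^ (-(3 / 4) : ℝ) := by
  have := integrable_rpow_neg_one_add_norm_sq (E := ℝ) (μ := volume) (r := 3 / 2) (by norm_num)
  refine (this.const_mul 2).congr (.of_forall fun y ↦ ?_)
  simp only [Real.norm_eq_abs, sq_abs]
  norm_num

lemma two_add_abs_rpow_div_le (y : ℝ) :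
    (2 + |y|) ^ (1 / 2 : ℝ) * (1 + y ^ 2)⁻¹ ≤ 2 * (1 + y ^ 2) ^ (-(3 / 4) : ℝ) := by
  have h : (2 + |y|) ^ (1 / 2 : ℝ) ≤ 2 * (1 + y ^ 2) ^ (1 / 4 : ℝ) := by
    have e : (2 + |y|) ^ (1 / 2 : ℝ) = ((2 + |y|) ^ 2) ^ (1 / 4 : ℝ) := by
      rw [← Real.rpow_natCast, ← Real.rpow_mul (by positivity)]; norm_num
    have e2 : (2 : ℝ) = 16 ^ (1 / 4 : ℝ) := by
      rw [show (16 : ℝ) = 2 ^ (4 : ℝ) by norm_num, ← Real.rpow_mul (by norm_num)]; norm_num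
    rw [e]
    nth_rw 2 [e2]
    rw [← Real.mul_rpow (by norm_num) (by positivity)]
    gcongr
    have := sq_abs y
    nlinarith [sq_nonneg (|y| - 2), abs_nonneg y]
  have hp : (0 : ℝ) < 1 + y ^ 2 := by positivity
  calc _ ≤ 2 * (1 + y ^ 2) ^ (1 / 4 : ℝ) * (1 + y ^ 2) ^ (-1 : ℝ) := by
        rw [Real.rpow_neg_one]; gcongr
    _ = _ := by rw [mul_assoc, ← Real.rpow_add hp]; norm_num

lemma norm_sum_mul_one_sub_le {g : ℕ → ℂ} {σ K : ℝ} (hσ : 1 ≤ σ) (hg : LSeriesSummable g σ)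
    (hK : ∀ y : ℝ, ‖LSeries g (σ + y * I)‖ ≤ K * (2 + |y|) ^ (1 / 2 : ℝ)) {N : ℕ} (hN : 0 < N) :
    ‖∑ n ∈ Finset.Icc 1 N, g n * (1 - n / N : ℝ)‖ ≤
      K * (∫ y : ℝ, 2 * (1 + y ^ 2) ^ (-(3 / 4) : ℝ)) * (N : ℝ) ^ σ := by
  have hN0 : (0 : ℝ) < N := by exact_mod_cast hN
  have hK0 : 0 ≤ K := by
    have := (norm_nonneg _).trans (hK 0)
    exact nonneg_of_mul_nonneg_left this (by positivity)
  set w : ℝ → ℂ := fun y ↦ 1 / (σ + y * I : ℂ) - 1 / (σ + y * I + 1 : ℂ) with hw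
  set F : ℕ → ℝ → ℂ := fun n y ↦ LSeries.term g (σ + y * I) n * ((N : ℂ) ^ (σ + y * I : ℂ) * w y)
    with hF
  have hterm : ∀ (n : ℕ) (y : ℝ), ‖LSeries.term g (σ + y * I) n‖ = ‖LSeries.term g σ n‖ := by
    intro n y
    rw [LSeries.norm_term_eq, LSeries.norm_term_eq]; simp
  have hNn : ∀ y : ℝ, ‖(N : ℂ) ^ (σ + y * I : ℂ)‖ = (N : ℝ) ^ σ := by
    intro y
    rw [Complex.norm_natCast_cpow_of_pos hN]; simp
  have hFn : ∀ n y, ‖F n y‖ = ‖LSeries.term g σ n‖ * ((N : ℝ) ^ σ * ‖w y‖) := by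
    intro n y
    rw [hF, norm_mul, norm_mul, hterm, hNn]
  have hwi : Integrable w := integrable_one_div_sub_one_div_add_one hσ
  have hFc : ∀ n, Continuous (F n) := by
    intro n
    have hl : Continuous fun y : ℝ ↦ (σ + y * I : ℂ) := by fun_prop
    refine Continuous.mul ?_ (((hl.const_cpow
      (Or.inl (by exact_mod_cast hN0.ne'))).mul (continuous_one_div_sub_one_div_add_one hσ)))
    rcases eq_or_ne n 0 with rfl | hn
    · simp only [LSeries.term_zero]; exact continuous_const
    · simp only [LSeries.term_of_ne_zero hn]
      refine continuous_const.div (hl.const_cpow (Or.inl (by exact_mod_cast hn))) fun y ↦ ?_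
      rw [Ne, Complex.cpow_eq_zero_iff]
      simp [hn]
  have hFi : ∀ n, Integrable (F n) := by
    intro n
    refine ((hwi.norm.const_mul ((N : ℝ) ^ σ)).const_mul ‖LSeries.term g σ n‖).mono'
      (hFc n).aestronglyMeasurable (.of_forall fun y ↦ (hFn n y).le)
  have hsum : Summable fun n ↦ ∫ y, ‖F n y‖ := by
    simp_rw [hFn, integral_const_mul]
    exact hg.norm.mul_right _
  have hmain := hasSum_integral_of_summable_integral_norm hFi hsum
  have hval : ∀ n : ℕ, n ≠ 0 →
      ∫ y, F n y = g n * (2 * Real.pi * (max (1 - n / N) 0 : ℝ)) := by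
    intro n hn
    have hn0 : (0 : ℝ) < n := by exact_mod_cast Nat.pos_of_ne_zero hn
    rw [← integral_cpow_mul_eq_rieszKernel hσ (div_pos hn0 hN0), ← integral_const_mul]
    congr 1; ext y
    simp only [hF, hw, LSeries.term_of_ne_zero hn]
    rw [Complex.cpow_neg, Complex.ofReal_div, Complex.div_cpow_ofReal_nonneg hn0.le hN0.le]
    · simp; try ring
  have hfin : HasSum (fun n ↦ ∫ y, F n y)
      (∑ n ∈ Finset.Icc 1 N, g n * (2 * Real.pi * (1 - n / N : ℝ))) := by
    have e : ∑ n ∈ Finset.Icc 1 N, g n * (2 * Real.pi * (1 - n / N : ℝ)) =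
        ∑ n ∈ Finset.Icc 1 N, ∫ y, F n y := by
      refine Finset.sum_congr rfl fun n hn ↦ ?_
      rw [Finset.mem_Icc] at hn
      have : (n : ℝ) / N ≤ 1 := (div_le_one hN0).2 (by exact_mod_cast hn.2)
      rw [hval n (by omega), max_eq_left (by linarith)]
    rw [e]
    refine hasSum_sum_of_ne_finset_zero fun n hn ↦ ?_
    rcases eq_or_ne n 0 with rfl | hn0
    · simp [hF]
    · have hNn : N < n := by
        by_contra h
        exact hn (Finset.mem_Icc.2 ⟨by omega, by omega⟩)
      have : 1 ≤ (n : ℝ) / N := (one_le_div hN0).2 (by exact_mod_cast hNn.le)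
      rw [hval n hn0, max_eq_right (by linarith)]
      simp
  have heq := hfin.unique hmain
  have hnorm : ‖∑ n ∈ Finset.Icc 1 N, g n * (2 * Real.pi * (1 - n / N : ℝ))‖ ≤
      K * (∫ y : ℝ, 2 * (1 + y ^ 2) ^ (-(3 / 4) : ℝ)) * (N : ℝ) ^ σ := by
    rw [heq]
    have hb : K * (∫ y : ℝ, 2 * (1 + y ^ 2) ^ (-(3 / 4) : ℝ)) * (N : ℝ) ^ σ =
        ∫ y : ℝ, (K * (N : ℝ) ^ σ) * (2 * (1 + y ^ 2) ^ (-(3 / 4) : ℝ)) := by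
      rw [integral_const_mul (K * (N : ℝ) ^ σ)]; ring
    rw [hb]
    refine norm_integral_le_of_norm_le (integrable_one_add_sq_rpow.const_mul _)
      (.of_forall fun y ↦ ?_)
    simp only [hF]
    rw [tsum_mul_right, norm_mul, norm_mul, hNn]
    change ‖LSeries g (σ + y * I)‖ * _ ≤ _
    calc _ ≤ (K * (2 + |y|) ^ (1 / 2 : ℝ)) * ((N : ℝ) ^ σ * (1 + y ^ 2)⁻¹) := by
          gcongr
          · exact hK y
          · exact norm_one_div_sub_one_div_add_one_le hσ y
      _ = (K * (N : ℝ) ^ σ) * ((2 + |y|) ^ (1 / 2 : ℝ) * (1 + y ^ 2)⁻¹) := by ring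
      _ ≤ _ := by
          exact mul_le_mul_of_nonneg_left (two_add_abs_rpow_div_le y) (by positivity)
  refine le_trans ?_ hnorm
  have e : ∑ n ∈ Finset.Icc 1 N, g n * (2 * Real.pi * (1 - n / N : ℝ)) =
      (2 * Real.pi) * ∑ n ∈ Finset.Icc 1 N, g n * (1 - n / N : ℝ) := by
    rw [Finset.mul_sum]
    exact Finset.sum_congr rfl fun n _ ↦ by ring
  rw [e, norm_mul]
  refine le_mul_of_one_le_left (norm_nonneg _) ?_
  rw [norm_mul, Complex.norm_real, Real.norm_of_nonneg Real.pi_pos.le, Complex.norm_ofNat]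
  linarith [Real.pi_gt_three]

/-- The nontrivial Dirichlet character modulo `4` as a real-valued function on `ℕ`. -/
noncomputable def chiReal (n : ℕ) : ℝ := ((ZMod.χ₄ n : ℤ) : ℝ)

lemma chiReal_mul (m n : ℕ) : chiReal (m * n) = chiReal m * chiReal n := by
  simp only [chiReal, Nat.cast_mul, map_mul, Int.cast_mul]

lemma abs_chiReal_le_one (n : ℕ) : |chiReal n| ≤ 1 := by
  have : ∀ a : ZMod 4, |ZMod.χ₄ a| ≤ 1 := by decide
  rw [chiReal]
  exact_mod_cast this n

lemma logMul_iterate_apply (f : ℕ → ℂ) (k n : ℕ) :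
    (LSeries.logMul^[k] f) n = (Real.log n : ℂ) ^ k * f n := by
  induction k with
  | zero => simp
  | succ k ih =>
    rw [Function.iterate_succ_apply', LSeries.logMul, ih, pow_succ, Complex.natCast_log]
    ring

lemma LSeriesSummable_chiFour_mul_moebius {s : ℂ} (hs : 1 < s.re) :
    LSeriesSummable (fun n : ℕ ↦ chiFour n * (ArithmeticFunction.moebius n : ℂ)) s :=
  DirichletCharacter.LSeriesSummable_mul chiFour
    (ArithmeticFunction.LSeriesSummable_moebius_iff.mpr hs)

lemma abscissaOfAbsConv_chiFour_mul_moebius_le :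
    LSeries.abscissaOfAbsConv (fun n : ℕ ↦ chiFour n * (ArithmeticFunction.moebius n : ℂ)) ≤ 1 :=
  LSeries.abscissaOfAbsConv_le_of_forall_lt_LSeriesSummable fun y hy ↦
    LSeriesSummable_chiFour_mul_moebius (by simpa using hy)

lemma norm_LSeries_logMul_iterate_eq (k : ℕ) {s : ℂ} (hs : 1 < s.re) :
    ‖LSeries (LSeries.logMul^[k]
      (fun n : ℕ ↦ chiFour n * (ArithmeticFunction.moebius n : ℂ))) s‖ =
      ‖iteratedDeriv k (fun z ↦ (chiFour.LFunction z)⁻¹) s‖ := by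
  have h : (fun z ↦ (chiFour.LFunction z)⁻¹) =ᶠ[nhds s]
      LSeries (fun n : ℕ ↦ chiFour n * (ArithmeticFunction.moebius n : ℂ)) := by
    filter_upwards [(isOpen_lt continuous_const continuous_re).mem_nhds hs] with z hz
    rw [DirichletCharacter.LFunction_eq_LSeries _ hz]
    exact inv_eq_of_mul_eq_one_right (DirichletCharacter.LSeries.mul_mu_eq_one chiFour hz)
  rw [h.iteratedDeriv_eq, LSeries_iteratedDeriv k
    (abscissaOfAbsConv_chiFour_mul_moebius_le.trans_lt (by exact_mod_cast hs))]
  simp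

/-- Riesz means of `χ μ log ^ k` are `O(N)`. -/
lemma exists_abs_sum_mul_one_sub_le (k : ℕ) : ∃ C > 0, ∀ N : ℕ, 0 < N →
    |∑ n ∈ Finset.Icc 1 N, chiReal n * (ArithmeticFunction.moebius n : ℝ) * Real.log n ^ k *
      (1 - n / N)| ≤ C * N := by
  obtain ⟨C, hC, hb⟩ := exists_norm_iteratedDeriv_inv_LFunction_chiFour_le k
  set f : ℕ → ℂ := fun n : ℕ ↦ chiFour n * (ArithmeticFunction.moebius n : ℂ) with hf
  set J := ∫ y : ℝ, 2 * (1 + y ^ 2) ^ (-(3 / 4) : ℝ)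
  have hJ : 0 ≤ J := integral_nonneg fun y ↦ by positivity
  refine ⟨C * J + 1, by positivity, fun N hN ↦ ?_⟩
  have hN0 : (0 : ℝ) < N := by exact_mod_cast hN
  set T := ∑ n ∈ Finset.Icc 1 N, chiReal n * (ArithmeticFunction.moebius n : ℝ) *
    Real.log n ^ k * (1 - n / N)
  have key : ∀ σ : ℝ, 1 < σ → σ ≤ 2 → |T| ≤ C * J * (N : ℝ) ^ σ := by
    intro σ h1 h2
    have := norm_sum_mul_one_sub_le (g := LSeries.logMul^[k] f) (σ := σ) (K := C) h1.le ?_ ?_ hN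
    · refine le_trans (le_of_eq ?_) this
      rw [← Real.norm_eq_abs, ← Complex.norm_real]
      congr 1
      simp only [T]
      push_cast
      refine Finset.sum_congr rfl fun n _ ↦ ?_
      simp only [logMul_iterate_apply, hf, chiReal, chiFour_apply]
      push_cast
      ring
    · apply LSeriesSummable_of_abscissaOfAbsConv_lt_re
      rw [LSeries.absicssaOfAbsConv_logPowMul]
      exact abscissaOfAbsConv_chiFour_mul_moebius_le.trans_lt (by exact_mod_cast h1)
    · intro y
      rw [norm_LSeries_logMul_iterate_eq k (by simpa using h1)]
      simpa using hb (σ + y * I) (by simpa using h1) (by simpa using h2)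
  have hlim : Filter.Tendsto (fun σ : ℝ ↦ C * J * (N : ℝ) ^ σ) (nhdsWithin 1 (Set.Ioi 1))
      (nhds (C * J * (N : ℝ) ^ (1 : ℝ))) := by
    refine Filter.Tendsto.mono_left ?_ nhdsWithin_le_nhds
    exact ((Real.continuous_const_rpow hN0.ne').tendsto 1).const_mul _
  have := ge_of_tendsto hlim (b := |T|) (by
    filter_upwards [Ioc_mem_nhdsGT (show (1 : ℝ) < 2 by norm_num)] with σ hσ
      using key σ hσ.1 hσ.2)
  rw [Real.rpow_one] at this
  nlinarith

end

lemma sum_Ioc_mul_eq_sum_Ioc_mul_sub (c w : ℕ → ℝ) {N M : ℕ} (h : N ≤ M) :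
    ∑ n ∈ Finset.Ioc N M, c n * w n =
      (∑ n ∈ Finset.Ioc 0 M, c n) * w (M + 1) - (∑ n ∈ Finset.Ioc 0 N, c n) * w (N + 1) +
        ∑ n ∈ Finset.Ioc N M, (∑ j ∈ Finset.Ioc 0 n, c j) * (w n - w (n + 1)) := by
  induction M, h using Nat.le_induction with
  | base => simp
  | succ M hM ih =>
    rw [Finset.sum_Ioc_succ_top hM, ih, Finset.sum_Ioc_succ_top hM,
      Finset.sum_Ioc_succ_top (Nat.zero_le M)]
    ring

lemma log_natCast_ge_half {n : ℕ} (hn : 2 ≤ n) : 1 / 2 ≤ Real.log n := by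
  have := Real.log_le_log (by norm_num) (show (2 : ℝ) ≤ n by exact_mod_cast hn)
  linarith [Real.log_two_gt_d9]

lemma one_le_log_succ {n : ℕ} (hn : 2 ≤ n) : 1 ≤ Real.log (n + 1 : ℕ) := by
  rw [Real.le_log_iff_exp_le (by positivity)]
  have : (3 : ℝ) ≤ (n + 1 : ℕ) := by exact_mod_cast Nat.succ_le_succ hn
  linarith [Real.exp_one_lt_d9]

lemma log_succ_sub_log_le {n : ℕ} (hn : 2 ≤ n) : Real.log (n + 1 : ℕ) - Real.log n ≤ 1 / n := by
  have h0 : (0 : ℝ) < n := by exact_mod_cast (by omega : 0 < n)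
  have := Real.log_le_sub_one_of_pos (x := ((n + 1 : ℕ) : ℝ) / n) (by positivity)
  rw [Real.log_div (by positivity) h0.ne'] at this
  refine this.trans (le_of_eq ?_)
  push_cast; field_simp; ring

lemma one_div_succ_le_log_succ_sub_log {n : ℕ} (hn : 2 ≤ n) :
    1 / ((n : ℝ) + 1) ≤ Real.log (n + 1 : ℕ) - Real.log n := by
  have h0 : (0 : ℝ) < n := by exact_mod_cast (by omega : 0 < n)
  have := Real.log_le_sub_one_of_pos (x := (n : ℝ) / ((n + 1 : ℕ) : ℝ)) (by positivity)
  rw [Real.log_div h0.ne' (by positivity)] at this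
  have e : (n : ℝ) / ((n + 1 : ℕ) : ℝ) - 1 = -(1 / ((n : ℝ) + 1)) := by
    push_cast; field_simp; ring
  linarith

lemma log_succ_le_two_mul_log {n : ℕ} (hn : 2 ≤ n) : Real.log (n + 1 : ℕ) ≤ 2 * Real.log n := by
  have h0 : (2 : ℝ) ≤ n := by exact_mod_cast hn
  rw [show 2 * Real.log n = Real.log ((n : ℝ) ^ 2) by simp]
  apply Real.log_le_log (by positivity)
  push_cast
  nlinarith

/-- `1 / (n log ^ 4 n)` is dominated by a telescoping difference. -/
lemma one_div_mul_log_pow_four_le {n : ℕ} (hn : 2 ≤ n) :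
    1 / (n * Real.log n ^ 4) ≤ 6 * (1 / Real.log n ^ 3 - 1 / Real.log (n + 1 : ℕ) ^ 3) := by
  have h0 : (2 : ℝ) ≤ n := by exact_mod_cast hn
  have h1 := log_natCast_ge_half hn
  have h2 := one_le_log_succ hn
  have h3 := one_div_succ_le_log_succ_sub_log hn
  have h4 := log_succ_le_two_mul_log hn
  set x := Real.log n
  set y := Real.log (n + 1 : ℕ)
  have hxy : x ≤ y := by
    have : 0 ≤ 1 / ((n : ℝ) + 1) := by positivity
    linarith
  have hy : y ^ 3 ≤ 8 * x ^ 3 := by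
    calc y ^ 3 ≤ (2 * x) ^ 3 := by gcongr
      _ = _ := by ring
  have hd : 3 * x ^ 2 * (1 / ((n : ℝ) + 1)) ≤ y ^ 3 - x ^ 3 := by
    have : 3 * x ^ 2 * (y - x) ≤ y ^ 3 - x ^ 3 := by nlinarith [sq_nonneg (y - x)]
    refine le_trans ?_ this
    gcongr
  have hyx : 0 ≤ y ^ 3 - x ^ 3 := le_trans (by positivity) hd
  have e : 1 / x ^ 3 - 1 / y ^ 3 = (y ^ 3 - x ^ 3) / (x ^ 3 * y ^ 3) := by field_simp
  rw [e]
  calc 1 / (n * x ^ 4) ≤ 6 * ((3 * x ^ 2 * (1 / ((n : ℝ) + 1))) / (x ^ 3 * (8 * x ^ 3))) := by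
        rw [show 6 * ((3 * x ^ 2 * (1 / ((n : ℝ) + 1))) / (x ^ 3 * (8 * x ^ 3))) =
          1 / (n * x ^ 4) * (9 / 4 * n / (n + 1)) by field_simp; ring]
        refine le_mul_of_one_le_right (by positivity) ?_
        rw [le_div_iff₀ (by positivity)]
        linarith
    _ ≤ _ := by gcongr

lemma sum_one_div_mul_log_pow_four_le {N : ℕ} (hN : 2 ≤ N) (M : ℕ) :
    ∑ n ∈ Finset.Ioc N M, 1 / (n * Real.log n ^ 4) ≤ 6 / Real.log N ^ 3 := by
  rcases le_or_gt M N with h | h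
  · rw [Finset.Ioc_eq_empty_of_le h, Finset.sum_empty]
    have := log_natCast_ge_half hN
    positivity
  have key : ∑ n ∈ Finset.Ioc N M, 1 / (n * Real.log n ^ 4) ≤
      6 * (1 / Real.log (N + 1 : ℕ) ^ 3 - 1 / Real.log (M + 1 : ℕ) ^ 3) := by
    have := h.le
    clear h
    induction M, this using Nat.le_induction with
    | base => simp
    | succ M hM ih =>
      rw [Finset.sum_Ioc_succ_top hM]
      have := one_div_mul_log_pow_four_le (n := M + 1) (by omega)
      linarith
  have h1 := log_natCast_ge_half hN
  have h2 : 1 / Real.log (N + 1 : ℕ) ^ 3 ≤ 1 / Real.log N ^ 3 := by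
    have := log_succ_le_two_mul_log hN
    have : Real.log N ≤ Real.log (N + 1 : ℕ) :=
      Real.log_le_log (by exact_mod_cast (by omega : 0 < N)) (by push_cast; linarith)
    gcongr
  have h3 : 0 ≤ 1 / Real.log (M + 1 : ℕ) ^ 3 := by
    have := one_le_log_succ (n := M) (by omega)
    positivity
  have : 6 / Real.log N ^ 3 = 6 * (1 / Real.log N ^ 3) := by ring
  linarith

lemma exists_abs_sub_le_of_cauchy {m e : ℕ → ℝ} {N₀ : ℕ}
    (h : ∀ N M, N₀ ≤ N → N ≤ M → |m M - m N| ≤ e N)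
    (he : Filter.Tendsto e Filter.atTop (nhds 0)) :
    ∃ l, ∀ N, N₀ ≤ N → |m N - l| ≤ e N := by
  have hc : CauchySeq m := by
    rw [Metric.cauchySeq_iff']
    intro ε hε
    obtain ⟨N, hN, hN'⟩ := ((he.eventually (gt_mem_nhds hε)).and
      (Filter.eventually_ge_atTop N₀)).exists
    exact ⟨N, fun n hn ↦ by rw [Real.dist_eq]; exact (h N n hN' hn).trans_lt hN⟩
  obtain ⟨l, hl⟩ := cauchySeq_tendsto_of_complete hc
  refine ⟨l, fun N hN ↦ ?_⟩
  have := ((hl.sub_const (m N)).abs)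
  rw [abs_sub_comm]
  refine le_of_tendsto this ?_
  filter_upwards [Filter.eventually_ge_atTop N] with M hM using h N M hN hM

lemma tendsto_const_div_log_pow (C : ℝ) {k : ℕ} (hk : k ≠ 0) :
    Filter.Tendsto (fun N : ℕ ↦ C / Real.log N ^ k) Filter.atTop (nhds 0) := by
  refine Filter.Tendsto.const_div_atTop ?_ C
  exact (Filter.tendsto_pow_atTop hk).comp (Real.tendsto_log_atTop.comp tendsto_natCast_atTop_atTop)

lemma one_div_mul_log_pow_eight_sub_le {n : ℕ} (hn : 2 ≤ n) :
    1 / (n * Real.log n ^ 8) - 1 / ((n + 1 : ℕ) * Real.log (n + 1 : ℕ) ^ 8) ≤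
      9 / (n ^ 2 * Real.log n ^ 8) := by
  have h0 : (2 : ℝ) ≤ n := by exact_mod_cast hn
  have h1 := log_natCast_ge_half hn
  have h2 := one_le_log_succ hn
  have h3 := one_div_succ_le_log_succ_sub_log hn
  have h4 := log_succ_sub_log_le hn
  set x := Real.log n
  set y := Real.log (n + 1 : ℕ)
  have hxy : x ≤ y := by
    have : 0 ≤ 1 / ((n : ℝ) + 1) := by positivity
    linarith
  have hd : y ^ 8 - x ^ 8 ≤ 8 * y ^ 7 * (y - x) := by
    have hx0 : 0 ≤ x := by linarith
    have hk : ∀ k : ℕ, x ^ k ≤ y ^ k := fun k ↦ by gcongr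
    have e : y ^ 8 - x ^ 8 = (y ^ 7 + y ^ 6 * x + y ^ 5 * x ^ 2 + y ^ 4 * x ^ 3 + y ^ 3 * x ^ 4 +
      y ^ 2 * x ^ 5 + y * x ^ 6 + x ^ 7) * (y - x) := by ring
    rw [e]
    refine mul_le_mul_of_nonneg_right ?_ (by linarith)
    have hy0 : 0 ≤ y := by linarith
    have a1 := mul_le_mul_of_nonneg_left (hk 1) (by positivity : 0 ≤ y ^ 6)
    have a2 := mul_le_mul_of_nonneg_left (hk 2) (by positivity : 0 ≤ y ^ 5)
    have a3 := mul_le_mul_of_nonneg_left (hk 3) (by positivity : 0 ≤ y ^ 4)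
    have a4 := mul_le_mul_of_nonneg_left (hk 4) (by positivity : 0 ≤ y ^ 3)
    have a5 := mul_le_mul_of_nonneg_left (hk 5) (by positivity : 0 ≤ y ^ 2)
    have a6 := mul_le_mul_of_nonneg_left (hk 6) (by positivity : 0 ≤ y)
    have a7 := hk 7
    nlinarith
  have hd2 : n * (y ^ 8 - x ^ 8) ≤ 8 * y ^ 8 := by
    calc n * (y ^ 8 - x ^ 8) ≤ n * (8 * y ^ 7 * (1 / n)) := by
          gcongr
          exact hd.trans (by gcongr)
      _ = 8 * y ^ 7 := by field_simp
      _ ≤ 8 * y ^ 8 := by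
        rw [pow_succ y 7]
        have : 0 ≤ y ^ 7 := by positivity
        nlinarith
  have e : 1 / (n * x ^ 8) - 1 / ((n + 1 : ℕ) * y ^ 8) =
      (y ^ 8 + n * (y ^ 8 - x ^ 8)) / (n * (n + 1) * (x ^ 8 * y ^ 8)) := by
    push_cast; field_simp; ring
  rw [e]
  calc _ ≤ (y ^ 8 + 8 * y ^ 8) / (n * n * (x ^ 8 * y ^ 8)) := by
        gcongr
        linarith
    _ = _ := by field_simp; ring

lemma log_pow_le_mul_rpow {x : ℝ} (hx : 1 ≤ x) {k : ℕ} (hk : k ≠ 0) {r : ℝ} (hr : 0 < r) :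
    Real.log x ^ k ≤ (k / r) ^ k * x ^ r := by
  have hk0 : (0 : ℝ) < k := by exact_mod_cast Nat.pos_of_ne_zero hk
  have h := Real.log_le_rpow_div (x := x) (by linarith) (div_pos hr hk0)
  have h1 := Real.log_nonneg hx
  calc Real.log x ^ k ≤ (x ^ (r / k) / (r / k)) ^ k := by gcongr
    _ = (k / r) ^ k * (x ^ (r / k)) ^ k := by rw [← mul_pow]; congr 1; field_simp
    _ = (k / r) ^ k * x ^ r := by
      rw [← Real.rpow_natCast (x ^ (r / k)), ← Real.rpow_mul (by linarith),
        div_mul_cancel₀ _ hk0.ne']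

lemma log_pow_le_mul_self {x : ℝ} (hx : 1 ≤ x) {k : ℕ} (hk : k ≠ 0) :
    Real.log x ^ k ≤ (k : ℝ) ^ k * x := by
  simpa using log_pow_le_mul_rpow hx hk one_pos

lemma abs_mul_sum_le_of_riesz {a : ℕ → ℝ} {C L : ℝ} (hC : 0 ≤ C) {N h : ℕ} (hN : 0 < N)
    (hh : h ≤ N) (ha : ∀ n, 0 < n → n ≤ 2 * N → |a n| ≤ L)
    (hU : ∀ N : ℕ, 0 < N → |∑ n ∈ Finset.Icc 1 N, a n * (1 - n / N)| ≤ C * N) :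
    h * |∑ n ∈ Finset.Ioc 0 N, a n| ≤ 5 * C * N ^ 2 + h ^ 2 * L := by
  have hN0 : (0 : ℝ) < N := by exact_mod_cast hN
  have hhN : (h : ℝ) ≤ N := by exact_mod_cast hh
  set U : ℕ → ℝ := fun M ↦ ∑ n ∈ Finset.Ioc 0 M, a n * (M - n) with hUdef
  have hUb : ∀ M : ℕ, 0 < M → |U M| ≤ C * M ^ 2 := by
    intro M hM
    have hM0 : (0 : ℝ) < M := by exact_mod_cast hM
    have e : U M = M * ∑ n ∈ Finset.Icc 1 M, a n * (1 - n / M) := by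
      rw [hUdef, Finset.mul_sum]
      refine Finset.sum_congr rfl fun n _ ↦ ?_
      field_simp
    rw [e, abs_mul, abs_of_pos hM0]
    nlinarith [hU M hM]
  have hsplit : U (N + h) = U N + h * ∑ n ∈ Finset.Ioc 0 N, a n +
      ∑ n ∈ Finset.Ioc N (N + h), a n * ((N + h : ℕ) - n) := by
    simp only [hUdef]
    rw [← Finset.sum_Ioc_consecutive _ (Nat.zero_le N) (Nat.le_add_right N h), Finset.mul_sum,
      ← Finset.sum_add_distrib]
    congr 1
    refine Finset.sum_congr rfl fun n _ ↦ ?_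
    push_cast; ring
  have hrest : |∑ n ∈ Finset.Ioc N (N + h), a n * ((N + h : ℕ) - n)| ≤ h ^ 2 * L := by
    calc _ ≤ ∑ n ∈ Finset.Ioc N (N + h), L * h := by
          refine (Finset.abs_sum_le_sum_abs _ _).trans (Finset.sum_le_sum fun n hn ↦ ?_)
          rw [Finset.mem_Ioc] at hn
          have h1 : (N : ℝ) < n := by exact_mod_cast hn.1
          have h2 : (n : ℝ) ≤ (N + h : ℕ) := by exact_mod_cast hn.2
          rw [abs_mul, abs_of_nonneg (sub_nonneg.2 h2)]
          have h3 := ha n (by omega) (by omega)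
          have h4 := (abs_nonneg _).trans h3
          gcongr
          push_cast
          linarith
      _ = _ := by simp; ring
  have h1 := hUb N hN
  have h2 := hUb (N + h) (by omega)
  have h3 : C * ((N + h : ℕ) : ℝ) ^ 2 ≤ C * (4 * N ^ 2) := by
    gcongr
    push_cast
    nlinarith [(Nat.cast_nonneg h : (0 : ℝ) ≤ h)]
  have e : (h : ℝ) * ∑ n ∈ Finset.Ioc 0 N, a n = U (N + h) - U N -
      ∑ n ∈ Finset.Ioc N (N + h), a n * ((N + h : ℕ) - n) := by rw [hsplit]; ring
  calc h * |∑ n ∈ Finset.Ioc 0 N, a n| = |(h : ℝ) * ∑ n ∈ Finset.Ioc 0 N, a n| := by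
        rw [abs_mul, Nat.abs_cast]
    _ ≤ |U (N + h)| + |U N| + |∑ n ∈ Finset.Ioc N (N + h), a n * ((N + h : ℕ) - n)| := by
        rw [e]
        exact (abs_sub _ _).trans (add_le_add_left (abs_sub _ _) _)
    _ ≤ _ := by linarith

lemma exists_abs_sum_le_mul_log_pow_four {a : ℕ → ℝ} {C : ℝ} (hC : 0 ≤ C)
    (ha : ∀ n, |a n| ≤ Real.log n ^ 8)
    (hU : ∀ N : ℕ, 0 < N → |∑ n ∈ Finset.Icc 1 N, a n * (1 - n / N)| ≤ C * N) :
    ∃ D > 0, ∀ N, 2 ≤ N → |∑ n ∈ Finset.Ioc 0 N, a n| ≤ D * (N * Real.log N ^ 4) := by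
  refine ⟨16 * (5 * C + 1 + 512), by positivity, fun N hN ↦ ?_⟩
  have hN2 : (2 : ℝ) ≤ N := by exact_mod_cast hN
  have hlog : 1 ≤ Real.log (2 * N : ℕ) :=
    (one_le_log_succ (le_refl 2)).trans
      (Real.log_le_log (by positivity) (by exact_mod_cast (by omega : 2 + 1 ≤ 2 * N)))
  have hlog2 : Real.log (2 * N : ℕ) ≤ 2 * Real.log N := by
    rw [show 2 * Real.log N = Real.log ((N : ℝ) ^ 2) by simp]
    apply Real.log_le_log (by positivity)
    push_cast
    nlinarith
  have h4 := log_pow_le_mul_self (x := (2 * N : ℕ)) (k := 4) (by push_cast; linarith) (by norm_num)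
  have hL : ∀ n, 0 < n → n ≤ 2 * N → |a n| ≤ Real.log (2 * N : ℕ) ^ 8 := by
    intro n h0 hn
    refine (ha n).trans ?_
    have : Real.log n ≤ Real.log (2 * N : ℕ) :=
      Real.log_le_log (by exact_mod_cast h0) (by exact_mod_cast hn)
    have : 0 ≤ Real.log n := Real.log_natCast_nonneg n
    gcongr
  set L := Real.log (2 * N : ℕ)
  set S := |∑ n ∈ Finset.Ioc 0 N, a n|
  set h := ⌈(N : ℝ) / L ^ 4⌉₊ with hh
  have hL4 : 1 ≤ L ^ 4 := one_le_pow₀ hlog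
  have hhN : h ≤ N := Nat.ceil_le.2 (div_le_self (by linarith) hL4)
  have hh1 : (N : ℝ) / L ^ 4 ≤ h := Nat.le_ceil _
  have hh2 : (h : ℝ) ≤ N / L ^ 4 + 1 := (Nat.ceil_lt_add_one (by positivity)).le
  have hh0 : (0 : ℝ) < h := lt_of_lt_of_le (by positivity) hh1
  have hm := abs_mul_sum_le_of_riesz hC (by omega) hhN hL hU
  have hN' : (N : ℝ) ≤ h * L ^ 4 := by rwa [div_le_iff₀ (by positivity)] at hh1
  have hh3 : h * L ^ 4 ≤ N + L ^ 4 := by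
    calc h * L ^ 4 ≤ (N / L ^ 4 + 1) * L ^ 4 := by gcongr
      _ = _ := by field_simp
  have key : S ≤ 5 * C * N * L ^ 4 + h * L ^ 8 := by
    refine le_of_mul_le_mul_left (hm.trans ?_) hh0
    have : 5 * C * N * N ≤ 5 * C * N * (h * L ^ 4) := by gcongr
    nlinarith
  have h5 : h * L ^ 8 ≤ 513 * N * L ^ 4 := by
    have : h * L ^ 4 ≤ 513 * N := by push_cast at h4; norm_num at h4; linarith
    calc h * L ^ 8 = (h * L ^ 4) * L ^ 4 := by ring
      _ ≤ _ := by gcongr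
  calc S ≤ (5 * C + 1 + 512) * N * L ^ 4 := by linarith
    _ ≤ (5 * C + 1 + 512) * N * (2 * Real.log N) ^ 4 := by gcongr
    _ = _ := by ring

open ArithmeticFunction in
/-- The sums `∑ χ(n) μ(n) / n` converge with rate `log ^ (-3)`. -/
lemma exists_abs_sum_chiReal_mul_moebius_div_sub_le : ∃ l : ℝ, ∃ C > 0, ∀ N, 2 ≤ N →
    |∑ n ∈ Finset.Ioc 0 N, chiReal n * (moebius n : ℝ) / n - l| ≤ C / Real.log N ^ 3 := by
  obtain ⟨C, hC, hU⟩ := exists_abs_sum_mul_one_sub_le 8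
  set a : ℕ → ℝ := fun n ↦ chiReal n * (moebius n : ℝ) * Real.log n ^ 8 with ha
  have hab : ∀ n, |a n| ≤ Real.log n ^ 8 := by
    intro n
    have h1 := abs_chiReal_le_one n
    have h2 : |(moebius n : ℝ)| ≤ 1 := by exact_mod_cast abs_moebius_le_one (n := n)
    rw [ha, abs_mul, abs_mul, abs_of_nonneg (by positivity : 0 ≤ Real.log n ^ 8)]
    exact mul_le_of_le_one_left (by positivity) (mul_le_one₀ h1 (abs_nonneg _) h2)
  obtain ⟨D, hD, hS⟩ := exists_abs_sum_le_mul_log_pow_four hC.le hab hU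
  set w : ℕ → ℝ := fun n ↦ 1 / (n * Real.log n ^ 8) with hw
  have hb : ∀ N n, 2 ≤ N → N ≤ n →
      |(∑ j ∈ Finset.Ioc 0 n, a j) * w (n + 1)| ≤ 2 * D / Real.log N ^ 3 := by
    intro N n hN hn
    have h0 : (2 : ℝ) ≤ n := by exact_mod_cast hN.trans hn
    have h1 := log_natCast_ge_half hN
    have h2 : Real.log N ≤ Real.log n :=
      Real.log_le_log (by exact_mod_cast (by omega : 0 < N)) (by exact_mod_cast hn)
    have h3 : Real.log n ≤ Real.log (n + 1 : ℕ) :=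
      Real.log_le_log (by positivity) (by exact_mod_cast n.le_succ)
    have hwp : 0 ≤ w (n + 1) := by simp only [hw]; positivity
    rw [abs_mul, abs_of_nonneg hwp]
    calc _ ≤ D * (n * Real.log n ^ 4) * (1 / (n * Real.log n ^ 8)) := by
          gcongr
          · exact hS n (hN.trans hn)
          · simp only [hw]
            gcongr
            · have : 0 < Real.log n := by linarith
              positivity
            · simp
      _ = D / (Real.log n * Real.log n ^ 3) := by
          have : 0 < Real.log n := by linarith
          field_simp
      _ ≤ D / (1 / 2 * Real.log N ^ 3) := by
          gcongr
          linarith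
      _ = _ := by ring
  have hcauchy : ∀ N M, 2 ≤ N → N ≤ M →
      |∑ n ∈ Finset.Ioc 0 M, chiReal n * (moebius n : ℝ) / n -
        ∑ n ∈ Finset.Ioc 0 N, chiReal n * (moebius n : ℝ) / n| ≤ (58 * D) / Real.log N ^ 3 := by
    intro N M hN hM
    rw [← Finset.sum_Ioc_consecutive _ (Nat.zero_le N) hM, add_sub_cancel_left]
    have e : ∑ n ∈ Finset.Ioc N M, chiReal n * (moebius n : ℝ) / n =
        ∑ n ∈ Finset.Ioc N M, a n * w n := by
      refine Finset.sum_congr rfl fun n hn ↦ ?_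
      rw [Finset.mem_Ioc] at hn
      have h1 := log_natCast_ge_half (n := n) (by omega)
      simp only [ha, hw]
      field_simp
    have htail : |∑ n ∈ Finset.Ioc N M, (∑ j ∈ Finset.Ioc 0 n, a j) * (w n - w (n + 1))| ≤
        9 * D * (6 / Real.log N ^ 3) := by
      refine (Finset.abs_sum_le_sum_abs _ _).trans ?_
      refine le_trans ?_ (mul_le_mul_of_nonneg_left (sum_one_div_mul_log_pow_four_le hN M)
        (by positivity))
      rw [Finset.mul_sum]
      refine Finset.sum_le_sum fun n hn ↦ ?_
      rw [Finset.mem_Ioc] at hn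
      have hn2 : 2 ≤ n := by omega
      have h0 : (2 : ℝ) ≤ n := by exact_mod_cast hn2
      have h1 := log_natCast_ge_half hn2
      have h3 : Real.log n ≤ Real.log (n + 1 : ℕ) :=
        Real.log_le_log (by positivity) (by exact_mod_cast n.le_succ)
      have hwa : 0 ≤ w n - w (n + 1) := by
        rw [sub_nonneg]
        simp only [hw]
        gcongr
        simp
      rw [abs_mul, abs_of_nonneg hwa]
      calc _ ≤ D * (n * Real.log n ^ 4) * (9 / (n ^ 2 * Real.log n ^ 8)) := by
            gcongr
            · exact hS n hn2
            · exact one_div_mul_log_pow_eight_sub_le hn2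
        _ = _ := by
            have : 0 < Real.log n := by linarith
            field_simp
    rw [e, sum_Ioc_mul_eq_sum_Ioc_mul_sub _ _ hM]
    refine (abs_add_le _ _).trans ?_
    have h1 := abs_sub ((∑ n ∈ Finset.Ioc 0 M, a n) * w (M + 1))
      ((∑ n ∈ Finset.Ioc 0 N, a n) * w (N + 1))
    have h2 := hb N M hN hM
    have h3 := hb N N hN le_rfl
    have e2 : 58 * D / Real.log N ^ 3 = 2 * D / Real.log N ^ 3 + 2 * D / Real.log N ^ 3 +
      9 * D * (6 / Real.log N ^ 3) := by ring
    linarith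
  obtain ⟨l, hl⟩ := exists_abs_sub_le_of_cauchy hcauchy
    (tendsto_const_div_log_pow (58 * D) (by norm_num))
  exact ⟨l, 58 * D, by positivity, hl⟩

lemma chiReal_eq_ite (n : ℕ) :
    chiReal n = if n % 2 = 0 then 0 else if n % 4 = 1 then 1 else -1 := by
  rw [chiReal, ZMod.χ₄_nat_eq_if_mod_four]
  split_ifs <;> simp

lemma sum_chiReal_eq_ite (n : ℕ) :
    ∑ j ∈ Finset.Ioc 0 n, chiReal j = if n % 4 = 1 ∨ n % 4 = 2 then 1 else 0 := by
  induction n with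
  | zero => simp
  | succ n ih =>
    rw [Finset.sum_Ioc_succ_top (Nat.zero_le n), ih, chiReal_eq_ite]
    have := Nat.mod_lt n (show 0 < 4 by norm_num)
    split_ifs <;> first | omega | norm_num

lemma abs_sum_chiReal_le_one (n : ℕ) : |∑ j ∈ Finset.Ioc 0 n, chiReal j| ≤ 1 := by
  rw [sum_chiReal_eq_ite]
  split_ifs <;> norm_num

/-- The sums `∑ χ(n) log n / n` converge with rate `log ^ (-2)`. -/
lemma exists_abs_sum_chiReal_mul_log_div_sub_le : ∃ l : ℝ, ∃ C > 0, ∀ N, 2 ≤ N →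
    |∑ n ∈ Finset.Ioc 0 N, chiReal n * Real.log n / n - l| ≤ C / Real.log N ^ 2 := by
  set w : ℕ → ℝ := fun n ↦ Real.log n / n with hw
  have hanti : ∀ n m, 3 ≤ n → n ≤ m → w m ≤ w n := by
    intro n m hn hm
    have h3 : (3 : ℝ) ≤ n := by exact_mod_cast hn
    have hnm : (n : ℝ) ≤ m := by exact_mod_cast hm
    have := Real.exp_one_lt_d9
    exact Real.log_div_self_antitoneOn (by simp; linarith) (by simp; linarith) hnm
  have hw0 : ∀ n, 0 ≤ w n := fun n ↦ div_nonneg (Real.log_natCast_nonneg n) (Nat.cast_nonneg n)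
  have hwb : ∀ N, 2 ≤ N → w (N + 1) ≤ 27 / Real.log N ^ 2 := by
    intro N hN
    have h0 : (2 : ℝ) ≤ N := by exact_mod_cast hN
    have h1 := log_natCast_ge_half hN
    have h2 : Real.log N ≤ Real.log (N + 1 : ℕ) :=
      Real.log_le_log (by positivity) (by exact_mod_cast N.le_succ)
    rw [le_div_iff₀ (by positivity)]
    have h3 := log_pow_le_mul_self (x := (N + 1 : ℕ)) (k := 3) (by push_cast; linarith) (by norm_num)
    simp only [hw]
    calc _ ≤ Real.log (N + 1 : ℕ) / (N + 1 : ℕ) * Real.log (N + 1 : ℕ) ^ 2 := by gcongr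
      _ = Real.log (N + 1 : ℕ) ^ 3 / (N + 1 : ℕ) := by ring
      _ ≤ 27 := by
        rw [div_le_iff₀ (by positivity)]
        norm_num at h3 ⊢
        exact h3
  have hcauchy : ∀ N M, 2 ≤ N → N ≤ M →
      |∑ n ∈ Finset.Ioc 0 M, chiReal n * Real.log n / n -
        ∑ n ∈ Finset.Ioc 0 N, chiReal n * Real.log n / n| ≤ 81 / Real.log N ^ 2 := by
    intro N M hN hM
    rw [← Finset.sum_Ioc_consecutive _ (Nat.zero_le N) hM, add_sub_cancel_left]
    simp_rw [mul_div_assoc]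
    rw [sum_Ioc_mul_eq_sum_Ioc_mul_sub chiReal w hM]
    have htel : ∑ n ∈ Finset.Ioc N M, (w n - w (n + 1)) = w (N + 1) - w (M + 1) := by
      clear hanti hwb
      induction M, hM using Nat.le_induction with
      | base => simp
      | succ M hM ih => rw [Finset.sum_Ioc_succ_top hM, ih]; ring
    have htail : |∑ n ∈ Finset.Ioc N M, (∑ j ∈ Finset.Ioc 0 n, chiReal j) * (w n - w (n + 1))| ≤
        w (N + 1) - w (M + 1) := by
      rw [← htel]
      refine (Finset.abs_sum_le_sum_abs _ _).trans (Finset.sum_le_sum fun n hn ↦ ?_)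
      rw [Finset.mem_Ioc] at hn
      have := hanti n (n + 1) (by omega) (by omega)
      rw [abs_mul, abs_of_nonneg (sub_nonneg.2 this)]
      exact mul_le_of_le_one_left (sub_nonneg.2 this) (abs_sum_chiReal_le_one n)
    have hb : ∀ n, |(∑ j ∈ Finset.Ioc 0 n, chiReal j) * w (n + 1)| ≤ w (n + 1) := by
      intro n
      rw [abs_mul, abs_of_nonneg (hw0 _)]
      exact mul_le_of_le_one_left (hw0 _) (abs_sum_chiReal_le_one n)
    refine (abs_add_le _ _).trans ?_
    have h1 := abs_sub ((∑ n ∈ Finset.Ioc 0 M, chiReal n) * w (M + 1))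
      ((∑ n ∈ Finset.Ioc 0 N, chiReal n) * w (N + 1))
    have h2 := hb M
    have h3 := hb N
    have h4 := hwb N hN
    have h5 := hw0 (N + 1)
    have e : 81 / Real.log N ^ 2 = 3 * (27 / Real.log N ^ 2) := by ring
    linarith
  obtain ⟨l, hl⟩ := exists_abs_sub_le_of_cauchy hcauchy (tendsto_const_div_log_pow 81 two_ne_zero)
  exact ⟨l, 81, by norm_num, hl⟩

open ArithmeticFunction in
lemma sum_chiReal_mul_vonMangoldt_div_eq {N K : ℕ} (hK : K = Nat.sqrt N) :
    ∑ n ∈ Finset.Ioc 0 N, chiReal n * vonMangoldt n / n =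
      ∑ a ∈ Finset.Ioc 0 K, chiReal a * (moebius a : ℝ) / a *
        ∑ b ∈ Finset.Ioc 0 (N / a), chiReal b * Real.log b / b +
      ∑ b ∈ Finset.Ioc 0 K, chiReal b * Real.log b / b *
        (∑ a ∈ Finset.Ioc 0 (N / b), chiReal a * (moebius a : ℝ) / a -
          ∑ a ∈ Finset.Ioc 0 K, chiReal a * (moebius a : ℝ) / a) := by
  have hKN : K * K ≤ N := hK ▸ Nat.sqrt_le N
  have hNK : N < (K + 1) * (K + 1) := hK ▸ Nat.lt_succ_sqrt N
  set f : ℕ → ℝ := fun a ↦ chiReal a * (moebius a : ℝ) / a with hf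
  set g : ℕ → ℝ := fun b ↦ chiReal b * Real.log b / b with hg
  have hKle : K ≤ N := by nlinarith
  have h1 : ∑ n ∈ Finset.Ioc 0 N, chiReal n * vonMangoldt n / n =
      ∑ a ∈ Finset.Ioc 0 N, f a * ∑ b ∈ Finset.Ioc 0 (N / a), g b := by
    let F : ArithmeticFunction ℝ := ⟨f, by simp [hf]⟩
    let H : ArithmeticFunction ℝ := ⟨g, by simp [hg]⟩
    have hF : ∀ n, F n = f n := fun _ ↦ rfl
    have hH : ∀ n, H n = g n := fun _ ↦ rfl
    refine Eq.trans ?_ (sum_Ioc_mul_eq_sum_sum F H N)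
    refine Finset.sum_congr rfl fun n _ ↦ ?_
    rw [← moebius_mul_log_eq_vonMangoldt, mul_apply, mul_apply, Finset.mul_sum, Finset.sum_div]
    refine Finset.sum_congr rfl fun x hx ↦ ?_
    rw [← (Nat.mem_divisorsAntidiagonal.1 hx).1, chiReal_mul]
    simp only [hF, hH, hf, hg, intCoe_apply, log_apply]
    push_cast
    ring
  rw [h1, ← Finset.sum_Ioc_consecutive _ (Nat.zero_le K) hKle]
  congr 1
  simp_rw [Finset.mul_sum]
  rw [Finset.sum_comm' (t' := Finset.Ioc 0 K) (s' := fun b ↦ Finset.Ioc K (N / b))]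
  · refine Finset.sum_congr rfl fun b hb ↦ ?_
    rw [Finset.mem_Ioc] at hb
    have hKb : K ≤ N / b := by
      rw [Nat.le_div_iff_mul_le hb.1]; nlinarith
    rw [← Finset.sum_Ioc_consecutive _ (Nat.zero_le K) hKb, add_sub_cancel_left, Finset.mul_sum]
    exact Finset.sum_congr rfl fun a _ ↦ mul_comm _ _
  · intro a b
    simp only [Finset.mem_Ioc]
    constructor
    · rintro ⟨⟨h1, h2⟩, h3, h4⟩
      have h5 := (Nat.le_div_iff_mul_le (by omega)).1 h4
      refine ⟨⟨h1, (Nat.le_div_iff_mul_le h3).2 (by linarith)⟩, h3, ?_⟩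
      by_contra h
      nlinarith
    · rintro ⟨⟨h1, h2⟩, h3, h4⟩
      have h5 := (Nat.le_div_iff_mul_le h3).1 h2
      exact ⟨⟨h1, by nlinarith⟩, h3, (Nat.le_div_iff_mul_le (by omega)).2 (by linarith)⟩

lemma sum_one_div_le_one_add_log (K : ℕ) :
    ∑ a ∈ Finset.Ioc 0 K, 1 / (a : ℝ) ≤ 1 + Real.log K := by
  have h := harmonic_le_one_add_log K
  rw [harmonic_eq_sum_Icc] at h
  push_cast at h
  simp_rw [one_div]
  exact h

open ArithmeticFunction in
/-- The sums `∑ χ(n) Λ(n) / n` converge with rate `1 / log`. -/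
lemma exists_abs_sum_chiReal_mul_vonMangoldt_div_sub_le : ∃ l : ℝ, ∃ C > 0, ∀ N, 4 ≤ N →
    |∑ n ∈ Finset.Ioc 0 N, chiReal n * vonMangoldt n / n - l| ≤ C / Real.log N := by
  obtain ⟨l₁, C₁, hC₁, hm⟩ := exists_abs_sum_chiReal_mul_moebius_div_sub_le
  obtain ⟨l₂, C₂, hC₂, hg⟩ := exists_abs_sum_chiReal_mul_log_div_sub_le
  refine ⟨l₂ * l₁, 4 * (3 * C₂ + 4 * |l₂| * C₁ + 6 * C₁), by positivity, fun N hN ↦ ?_⟩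
  set K := Nat.sqrt N with hK
  rw [sum_chiReal_mul_vonMangoldt_div_eq hK]
  set m : ℕ → ℝ := fun M ↦ ∑ a ∈ Finset.Ioc 0 M, chiReal a * (moebius a : ℝ) / a with hmdef
  set G : ℕ → ℝ := fun M ↦ ∑ b ∈ Finset.Ioc 0 M, chiReal b * Real.log b / b with hGdef
  have hKN : K * K ≤ N := hK ▸ Nat.sqrt_le N
  have hNK : N < (K + 1) * (K + 1) := hK ▸ Nat.lt_succ_sqrt N
  have hK2 : 2 ≤ K := Nat.le_sqrt.2 hN
  have hK0 : (2 : ℝ) ≤ K := by exact_mod_cast hK2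
  have hL := log_natCast_ge_half hK2
  have hLN : Real.log N ≤ 4 * Real.log K := by
    rw [show 4 * Real.log K = Real.log ((K : ℝ) ^ 4) by simp]
    apply Real.log_le_log (by exact_mod_cast (by omega : 0 < N))
    have : (N : ℝ) ≤ (K + 1) * (K + 1) := by exact_mod_cast hNK.le
    refine this.trans ?_
    have h1 : (K : ℝ) + 1 ≤ K ^ 2 := by nlinarith
    calc ((K : ℝ) + 1) * (K + 1) ≤ K ^ 2 * K ^ 2 := by gcongr
      _ = _ := by ring
  have hlogN := log_natCast_ge_half (n := N) (by omega)
  have hdiv : ∀ a ∈ Finset.Ioc 0 K, K ≤ N / a := by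
    intro a ha
    rw [Finset.mem_Ioc] at ha
    rw [Nat.le_div_iff_mul_le ha.1]; nlinarith
  have hlogdiv : ∀ a ∈ Finset.Ioc 0 K, Real.log K ≤ Real.log (N / a : ℕ) := fun a ha ↦
    Real.log_le_log (by linarith) (by exact_mod_cast hdiv a ha)
  have hharm := sum_one_div_le_one_add_log K
  set L := Real.log K
  have hsplit : ∑ a ∈ Finset.Ioc 0 K, chiReal a * (moebius a : ℝ) / a * G (N / a) +
      ∑ b ∈ Finset.Ioc 0 K, chiReal b * Real.log b / b * (m (N / b) - m K) - l₂ * l₁ =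
      ∑ a ∈ Finset.Ioc 0 K, chiReal a * (moebius a : ℝ) / a * (G (N / a) - l₂) +
      l₂ * (m K - l₁) +
      ∑ b ∈ Finset.Ioc 0 K, chiReal b * Real.log b / b * (m (N / b) - m K) := by
    have : ∑ a ∈ Finset.Ioc 0 K, chiReal a * (moebius a : ℝ) / a * (G (N / a) - l₂) =
        ∑ a ∈ Finset.Ioc 0 K, chiReal a * (moebius a : ℝ) / a * G (N / a) - m K * l₂ := by
      rw [hmdef, Finset.sum_mul, ← Finset.sum_sub_distrib]
      exact Finset.sum_congr rfl fun a _ ↦ by ring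
    rw [this]; ring
  have e1 : |∑ a ∈ Finset.Ioc 0 K, chiReal a * (moebius a : ℝ) / a * (G (N / a) - l₂)| ≤
      (1 + L) * (C₂ / L ^ 2) := by
    refine (Finset.abs_sum_le_sum_abs _ _).trans ?_
    refine le_trans ?_ (mul_le_mul_of_nonneg_right hharm (by positivity))
    rw [Finset.sum_mul]
    refine Finset.sum_le_sum fun a ha ↦ ?_
    have h1 : |chiReal a * (moebius a : ℝ) / a| ≤ 1 / (a : ℝ) := by
      rw [abs_div, Nat.abs_cast, abs_mul]
      have h1 := abs_chiReal_le_one a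
      have h2 : |(moebius a : ℝ)| ≤ 1 := by exact_mod_cast abs_moebius_le_one (n := a)
      gcongr
      exact mul_le_one₀ h1 (abs_nonneg _) h2
    have h2 : |G (N / a) - l₂| ≤ C₂ / L ^ 2 := by
      refine (hg (N / a) (hK2.trans (hdiv a ha))).trans ?_
      have := hlogdiv a ha
      gcongr
    rw [abs_mul]
    gcongr
  have e2 : |l₂ * (m K - l₁)| ≤ |l₂| * (C₁ / L ^ 3) := by
    rw [abs_mul]
    gcongr
    exact hm K hK2
  have e3 : |∑ b ∈ Finset.Ioc 0 K, chiReal b * Real.log b / b * (m (N / b) - m K)| ≤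
      (1 + L) * (L * (2 * C₁ / L ^ 3)) := by
    refine (Finset.abs_sum_le_sum_abs _ _).trans ?_
    refine le_trans ?_ (mul_le_mul_of_nonneg_right hharm (by positivity))
    rw [Finset.sum_mul]
    refine Finset.sum_le_sum fun b hb ↦ ?_
    have hb' := Finset.mem_Ioc.1 hb
    have h1 : |chiReal b * Real.log b / b| ≤ 1 / (b : ℝ) * L := by
      rw [abs_div, Nat.abs_cast, abs_mul, abs_of_nonneg (Real.log_natCast_nonneg b), one_div_mul_eq_div]
      gcongr
      refine (mul_le_of_le_one_left (Real.log_natCast_nonneg b) (abs_chiReal_le_one b)).trans ?_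
      exact Real.log_le_log (by exact_mod_cast hb'.1) (by exact_mod_cast hb'.2)
    have h2 : |m (N / b) - m K| ≤ 2 * C₁ / L ^ 3 := by
      have h3 : |m (N / b) - l₁| ≤ C₁ / L ^ 3 := by
        refine (hm (N / b) (hK2.trans (hdiv b hb))).trans ?_
        have := hlogdiv b hb
        gcongr
      have h4 := hm K hK2
      have h5 := abs_sub_le (m (N / b)) l₁ (m K)
      rw [abs_sub_comm l₁] at h5
      have : 2 * C₁ / L ^ 3 = C₁ / L ^ 3 + C₁ / L ^ 3 := by ring
      linarith
    rw [abs_mul, ← mul_assoc]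
    gcongr
  rw [hsplit]
  have h1L : 1 + L ≤ 3 * L := by linarith
  calc _ ≤ (1 + L) * (C₂ / L ^ 2) + |l₂| * (C₁ / L ^ 3) + (1 + L) * (L * (2 * C₁ / L ^ 3)) :=
        (abs_add_three _ _ _).trans (by linarith)
    _ ≤ (3 * L) * (C₂ / L ^ 2) + |l₂| * (C₁ / (1 / 4 * L)) +
        (3 * L) * (L * (2 * C₁ / L ^ 3)) := by
        gcongr
        nlinarith
    _ = (3 * C₂ + 4 * |l₂| * C₁ + 6 * C₁) / L := by field_simp; ring
    _ ≤ (3 * C₂ + 4 * |l₂| * C₁ + 6 * C₁) / (Real.log N / 4) := by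
        gcongr
        linarith
    _ = _ := by field_simp

open ArithmeticFunction in
lemma exists_sum_not_prime_vonMangoldt_le : ∃ C > 0, ∀ n : ℕ,
    ∑ j ∈ Finset.Ioc 0 n, (if j.Prime then 0 else vonMangoldt j) ≤ C * √n := by
  obtain ⟨C, hC⟩ := Chebyshev.psi_sub_theta_le_mul_sqrt
  refine ⟨|C| + 1, by positivity, fun n ↦ ?_⟩
  have h := hC n
  rw [Chebyshev.psi_sub_theta_eq_sum_not_prime, Nat.floor_natCast, Finset.sum_filter] at h
  simp_rw [ite_not] at h
  refine h.trans ?_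
  have := le_abs_self C
  gcongr
  linarith

open ArithmeticFunction in
lemma exists_sum_not_prime_vonMangoldt_div_le : ∃ C > 0, ∀ N M : ℕ, 2 ≤ N → N ≤ M →
    ∑ n ∈ Finset.Ioc N M, (if n.Prime then 0 else vonMangoldt n) / n ≤ C / Real.log N ^ 3 := by
  obtain ⟨C, hC, hQ⟩ := exists_sum_not_prime_vonMangoldt_le
  refine ⟨C * 4096 * 8, by positivity, fun N M hN hM ↦ ?_⟩
  set q : ℕ → ℝ := fun n ↦ if n.Prime then 0 else vonMangoldt n with hq
  have hq0 : ∀ n, 0 ≤ q n := fun n ↦ by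
    simp only [hq]; split_ifs
    exacts [le_rfl, vonMangoldt_nonneg]
  have hQ0 : ∀ n, 0 ≤ ∑ j ∈ Finset.Ioc 0 n, q j := fun n ↦ Finset.sum_nonneg fun j _ ↦ hq0 j
  have hsq : ∀ n : ℕ, 2 ≤ n → √n / n ^ 2 ≤ 4096 * (1 / (n * Real.log n ^ 4)) := by
    intro n hn
    have h0 : (2 : ℝ) ≤ n := by exact_mod_cast hn
    have h1 := log_natCast_ge_half hn
    have h2 := log_pow_le_mul_rpow (x := n) (k := 4) (by linarith) (by norm_num)
      (r := 1 / 2) (by norm_num)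
    rw [← Real.sqrt_eq_rpow] at h2
    norm_num at h2
    have h3 := Real.mul_self_sqrt (show (0 : ℝ) ≤ n by linarith)
    rw [mul_one_div, div_le_div_iff₀ (by positivity) (by positivity)]
    calc √n * (n * Real.log n ^ 4) ≤ √n * (n * (4096 * √n)) := by gcongr
      _ = 4096 * n * (√n * √n) := by ring
      _ = _ := by rw [h3]; ring
  have hlast : (∑ j ∈ Finset.Ioc 0 M, q j) * (1 / (M + 1 : ℕ)) ≤
      C * 4096 * (2 / Real.log N ^ 3) := by
    have h0 : (2 : ℝ) ≤ M := by exact_mod_cast hN.trans hM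
    have h1 := log_natCast_ge_half hN
    have h2 : Real.log N ≤ Real.log M :=
      Real.log_le_log (by exact_mod_cast (by omega : 0 < N)) (by exact_mod_cast hM)
    calc _ ≤ (C * √M) * (1 / M) := by
          gcongr
          · exact hQ M
          · simp
      _ = C * (M * (√M / M ^ 2)) := by field_simp
      _ ≤ C * (M * (4096 * (1 / (M * Real.log M ^ 4)))) := by
          gcongr
          exact hsq M (hN.trans hM)
      _ = C * 4096 * (1 / (Real.log M * Real.log M ^ 3)) := by
          have : 0 < Real.log M := by linarith
          field_simp
      _ ≤ C * 4096 * (1 / (1 / 2 * Real.log N ^ 3)) := by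
          gcongr
          linarith
      _ = _ := by ring
  have htail : ∑ n ∈ Finset.Ioc N M, (∑ j ∈ Finset.Ioc 0 n, q j) *
      ((1 / n : ℝ) - 1 / (n + 1 : ℕ)) ≤ C * 4096 * (6 / Real.log N ^ 3) := by
    refine le_trans ?_ (mul_le_mul_of_nonneg_left (sum_one_div_mul_log_pow_four_le hN M)
      (by positivity))
    rw [Finset.mul_sum]
    refine Finset.sum_le_sum fun n hn ↦ ?_
    rw [Finset.mem_Ioc] at hn
    have h0 : (2 : ℝ) ≤ n := by exact_mod_cast (by omega : 2 ≤ n)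
    have h1 : (1 / n : ℝ) - 1 / (n + 1 : ℕ) ≤ 1 / n ^ 2 := by
      rw [show (1 / n : ℝ) - 1 / (n + 1 : ℕ) = 1 / (n * (n + 1)) by push_cast; field_simp; ring]
      gcongr
      nlinarith
    calc _ ≤ (∑ j ∈ Finset.Ioc 0 n, q j) * (1 / n ^ 2) := by
          have := hQ0 n
          gcongr
      _ ≤ (C * √n) * (1 / n ^ 2) := by gcongr; exact hQ n
      _ = C * (√n / n ^ 2) := by ring
      _ ≤ C * (4096 * (1 / (n * Real.log n ^ 4))) := by gcongr; exact hsq n (by omega)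
      _ = _ := by ring
  have hab := sum_Ioc_mul_eq_sum_Ioc_mul_sub q (fun n ↦ 1 / n) hM
  have hfirst : 0 ≤ (∑ j ∈ Finset.Ioc 0 N, q j) * (1 / (N + 1 : ℕ)) :=
    mul_nonneg (hQ0 N) (by positivity)
  calc _ = ∑ n ∈ Finset.Ioc N M, q n * (1 / n) :=
        Finset.sum_congr rfl fun n _ ↦ div_eq_mul_one_div _ _
    _ ≤ C * 4096 * (2 / Real.log N ^ 3) + C * 4096 * (6 / Real.log N ^ 3) := by
        rw [hab]; linarith
    _ = _ := by ring

open ArithmeticFunction in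
lemma exists_abs_sum_prime_sub_le : ∃ l : ℝ, ∃ C > 0, ∀ N, 4 ≤ N →
    |∑ p ∈ (Finset.range (N + 1)).filter (fun p => p.Prime ∧ 2 < p),
      (if p % 4 = 1 then (1 : ℝ) else -1) * Real.log p / ((p : ℝ) - 1) - l| ≤ C / Real.log N := by
  obtain ⟨l₁, C₁, hC₁, h₁⟩ := exists_abs_sum_chiReal_mul_vonMangoldt_div_sub_le
  obtain ⟨C₂, hC₂, h₂⟩ := exists_sum_not_prime_vonMangoldt_div_le
  set t : ℕ → ℝ := fun p ↦ if p.Prime ∧ 2 < p then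
    (if p % 4 = 1 then (1 : ℝ) else -1) * Real.log p / ((p : ℝ) - 1) else 0 with ht
  set x : ℕ → ℝ := fun n ↦ chiReal n * vonMangoldt n / n with hx
  have hP : ∀ N : ℕ, ∑ p ∈ (Finset.range (N + 1)).filter (fun p => p.Prime ∧ 2 < p),
      (if p % 4 = 1 then (1 : ℝ) else -1) * Real.log p / ((p : ℝ) - 1) =
      ∑ n ∈ Finset.Ioc 0 N, (t n - x n) + ∑ n ∈ Finset.Ioc 0 N, x n := by
    intro N
    rw [← Finset.sum_add_distrib]
    simp_rw [sub_add_cancel, ht]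
    rw [← Finset.sum_filter]
    refine Finset.sum_congr ?_ fun _ _ ↦ rfl
    ext p
    simp only [Finset.mem_filter, Finset.mem_range, Finset.mem_Ioc]
    constructor
    · rintro ⟨h1, h2, h3⟩
      exact ⟨⟨by omega, by omega⟩, h2, h3⟩
    · rintro ⟨⟨-, h1⟩, h2, h3⟩
      exact ⟨by omega, h2, h3⟩
  have hd : ∀ n : ℕ, 2 ≤ n → |t n - x n| ≤ 6250 * (1 / (n * Real.log n ^ 4)) +
      (if n.Prime then 0 else vonMangoldt n) / n := by
    intro n hn
    have h0 : (2 : ℝ) ≤ n := by exact_mod_cast hn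
    have h1 := log_natCast_ge_half hn
    have hpos : 0 ≤ 6250 * (1 / (n * Real.log n ^ 4)) := by positivity
    by_cases hp : n.Prime
    · rcases hn.eq_or_lt with rfl | hn2
      · have : chiReal 2 = 0 := by rw [chiReal_eq_ite]; simp
        rw [if_pos hp, zero_div, add_zero]
        simpa [ht, hx, this] using hpos
      · have hodd : n % 2 = 1 := (hp.eq_two_or_odd).resolve_left (by omega)
        have hchi : (if n % 4 = 1 then (1 : ℝ) else -1) = chiReal n := by
          rw [chiReal_eq_ite, if_neg (c := n % 2 = 0) (by omega)]
        have hlog := log_pow_le_mul_self (x := n) (k := 5) (by linarith) (by norm_num)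
        norm_num at hlog
        simp only [ht, hx, if_pos (And.intro hp hn2), hchi, if_pos hp, vonMangoldt_apply_prime hp]
        have hn1 : (0 : ℝ) < n - 1 := by linarith
        rw [show chiReal n * Real.log n / ((n : ℝ) - 1) - chiReal n * Real.log n / n =
          chiReal n * (Real.log n / (n * (n - 1))) by field_simp; ring, abs_mul,
          abs_of_nonneg (by positivity : 0 ≤ Real.log n / (n * (n - 1))), zero_div, add_zero]
        refine (mul_le_of_le_one_left (by positivity) (abs_chiReal_le_one n)).trans ?_
        rw [mul_one_div, div_le_div_iff₀ (by positivity) (by positivity)]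
        calc Real.log n * ((n : ℝ) * Real.log n ^ 4) = (n : ℝ) * Real.log n ^ 5 := by ring
          _ ≤ (n : ℝ) * (3125 * n) := by gcongr
          _ ≤ _ := by nlinarith
    · simp only [ht, hx, hp, false_and, if_false, zero_sub, abs_neg]
      rw [abs_div, Nat.abs_cast, abs_mul, abs_of_nonneg vonMangoldt_nonneg]
      have : |chiReal n| * vonMangoldt n / n ≤ vonMangoldt n / n := by
        gcongr
        exact mul_le_of_le_one_left vonMangoldt_nonneg (abs_chiReal_le_one n)
      linarith
  have hcauchy : ∀ N M, 2 ≤ N → N ≤ M →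
      |∑ n ∈ Finset.Ioc 0 M, (t n - x n) - ∑ n ∈ Finset.Ioc 0 N, (t n - x n)| ≤
        (6250 * 6 + C₂) / Real.log N ^ 3 := by
    intro N M hN hM
    rw [← Finset.sum_Ioc_consecutive _ (Nat.zero_le N) hM, add_sub_cancel_left]
    calc _ ≤ ∑ n ∈ Finset.Ioc N M, (6250 * (1 / (n * Real.log n ^ 4)) +
          (if n.Prime then 0 else vonMangoldt n) / n) := by
          refine (Finset.abs_sum_le_sum_abs _ _).trans (Finset.sum_le_sum fun n hn ↦ ?_)
          exact hd n (by rw [Finset.mem_Ioc] at hn; omega)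
      _ ≤ 6250 * (6 / Real.log N ^ 3) + C₂ / Real.log N ^ 3 := by
          rw [Finset.sum_add_distrib, ← Finset.mul_sum]
          exact add_le_add (mul_le_mul_of_nonneg_left (sum_one_div_mul_log_pow_four_le hN M)
            (by norm_num)) (h₂ N M hN hM)
      _ = _ := by ring
  obtain ⟨l₂, hl₂⟩ := exists_abs_sub_le_of_cauchy hcauchy
    (tendsto_const_div_log_pow (6250 * 6 + C₂) three_ne_zero)
  refine ⟨l₂ + l₁, (6250 * 6 + C₂) * 4 + C₁, by positivity, fun N hN ↦ ?_⟩
  have hL := log_natCast_ge_half (n := N) (by omega)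
  rw [hP, add_sub_add_comm, add_div]
  refine (abs_add_le _ _).trans (add_le_add ((hl₂ N (by omega)).trans ?_) (h₁ N hN))
  rw [div_le_div_iff₀ (by positivity) (by positivity), mul_assoc]
  gcongr
  nlinarith [mul_nonneg (sub_nonneg.2 hL) (sub_nonneg.2 hL)]

theorem legendre_sum_convergence_rate (S : ℝ)
    (hS : Filter.Tendsto
      (fun N : ℕ => ∑ p ∈ (Finset.range (N + 1)).filter (fun p => p.Prime ∧ 2 < p),
        (if p % 4 = 1 then (1 : ℝ) else -1) * Real.log p / ((p : ℝ) - 1))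
      Filter.atTop (nhds S)) :
    ∃ C > 0, ∀ n : ℕ, 2 ≤ n →
      |(∑ p ∈ (Finset.range (2 * n + 1)).filter (fun p => p.Prime ∧ 2 < p),
          (if p % 4 = 1 then (1 : ℝ) else -1) * Real.log p / ((p : ℝ) - 1)) - S|
        ≤ C / Real.log n := by
  obtain ⟨l, C, hC, h⟩ := exists_abs_sum_prime_sub_le
  have hl : S = l := by
    refine tendsto_nhds_unique hS ?_
    rw [tendsto_iff_dist_tendsto_zero]
    refine squeeze_zero' (.of_forall fun _ ↦ dist_nonneg)
      (Filter.eventually_atTop.2 ⟨4, fun N hN ↦ (Real.dist_eq _ _).trans_le (h N hN)⟩) ?_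
    simpa using tendsto_const_div_log_pow C one_ne_zero
  subst hl
  refine ⟨C, hC, fun n hn ↦ (h (2 * n) (by omega)).trans ?_⟩
  have := log_natCast_ge_half hn
  gcongr
  omega
end

section
/- There exist a real constant C₁ and a constant C > 0 such that for all integers n ≥ 2, |Σ_{2 < p ≤ 2n, p prime, p ≡ 1 (mod 4)} log p/(p−1) − (1/2)·log n − C₁| ≤ C/(log n). -/
section

open Filter Topology Set MeasureTheory Complex DirichletCharacter Asymptotics
open scoped FourierTransform SchwartzMap ContDiff

/-- The partial sums of a periodic sequence are linear up to a bounded error. -/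
theorem Function.Periodic.exists_norm_sum_range_sub_le {f : ℕ → ℂ} {q : ℕ} [NeZero q]
    (hf : Function.Periodic f q) :
    ∃ ρ : ℂ, ∃ B : ℝ, ∀ n : ℕ, ‖∑ k ∈ Finset.range n, f k - ρ * n‖ ≤ B := by
  set S : ℕ → ℂ := fun n ↦ ∑ k ∈ Finset.range n, f k
  have hq : (q : ℂ) ≠ 0 := NeZero.ne _
  have hE : Function.Periodic (fun n : ℕ ↦ S n - S q / q * n) q := by
    intro n
    have : S (n + q) = S q + S n := by
      simp only [S]
      rw [add_comm, Finset.sum_range_add]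
      congr 1
      exact Finset.sum_congr rfl fun k _ ↦ by rw [add_comm]; exact hf k
    simp only [this]
    push_cast
    field_simp
    ring
  refine ⟨S q / q, ∑ i ∈ Finset.range q, ‖S i - S q / q * i‖, fun n ↦ ?_⟩
  have h := hE.map_mod_nat n
  change ‖S n - S q / q * n‖ ≤ _
  rw [← h]
  exact Finset.single_le_sum (f := fun i : ℕ ↦ ‖S i - S q / q * i‖) (fun _ _ ↦ norm_nonneg _)
    (Finset.mem_range.mpr (Nat.mod_lt n (NeZero.pos q)))

theorem measurable_sum_Icc_floor (f : ℕ → ℂ) :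
    Measurable (fun x : ℝ ↦ ∑ k ∈ Finset.Icc 1 ⌊x⌋₊, f k) :=
  (measurable_from_nat (f := fun n : ℕ ↦ ∑ k ∈ Finset.Icc 1 n, f k)).comp Nat.measurable_floor

/-- The Mellin transform of a bounded function supported on `(1, ∞)` is analytic and bounded in
left half-planes. -/
theorem mellin_indicator_Ioi_one_of_bounded {E : ℝ → ℂ} (hE : Measurable E) {B : ℝ}
    (hB : ∀ x, 1 < x → ‖E x‖ ≤ B) :
    (∀ s : ℂ, s.re < 0 → MellinConvergent ((Ioi 1).indicator E) s) ∧
    (∀ s : ℂ, s.re < 0 → DifferentiableAt ℂ (mellin ((Ioi 1).indicator E)) s) ∧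
      ∀ s : ℂ, s.re ≤ -(1 / 2) → ‖mellin ((Ioi 1).indicator E) s‖ ≤ 2 * B := by
  have hB0 : 0 ≤ B := (norm_nonneg _).trans (hB 2 one_lt_two)
  have hb : ∀ x, ‖(Ioi 1).indicator E x‖ ≤ B := fun x ↦ by
    by_cases hx : 1 < x
    · simpa [hx] using hB x hx
    · simpa [hx] using hB0
  have hm : AEStronglyMeasurable ((Ioi 1).indicator E) volume :=
    (hE.indicator measurableSet_Ioi).aestronglyMeasurable
  have hloc : LocallyIntegrableOn ((Ioi 1).indicator E) (Ioi 0) :=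
    ((locallyIntegrable_const B).mono hm (Eventually.of_forall fun x ↦
      (hb x).trans (le_abs_self B))).locallyIntegrableOn _
  have htop : (Ioi 1).indicator E =O[atTop] (fun x : ℝ ↦ x ^ (-0 : ℝ)) :=
    IsBigO.of_bound B (Eventually.of_forall fun x ↦ by simpa using hb x)
  have hbot (b : ℝ) : (Ioi 1).indicator E =O[𝓝[>] 0] (fun x : ℝ ↦ x ^ (-b)) := by
    refine IsBigO.of_bound 0 ?_
    filter_upwards [mem_nhdsWithin_of_mem_nhds (Iio_mem_nhds zero_lt_one)] with x hx
    simp [not_lt.mpr (le_of_lt (mem_Iio.mp hx))]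
  have hconv : ∀ s : ℂ, s.re < 0 → MellinConvergent ((Ioi 1).indicator E) s := fun s hs ↦
    mellinConvergent_of_isBigO_rpow hloc htop hs (hbot (s.re - 1)) (by linarith)
  refine ⟨hconv, fun s hs ↦ mellin_differentiableAt_of_isBigO_rpow hloc htop hs (hbot (s.re - 1))
    (by linarith), fun s hs ↦ ?_⟩
  have hs' : s.re - 1 < -1 := by linarith
  have h1 : mellin ((Ioi 1).indicator E) s = ∫ t in Ioi (1 : ℝ), (t : ℂ) ^ (s - 1) * E t := by
    rw [mellin, ← integral_indicator measurableSet_Ioi, ← integral_indicator measurableSet_Ioi]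
    congr 1
    ext t
    by_cases ht : 1 < t
    · simp [ht, zero_lt_one.trans ht]
    · simp [ht]
  rw [h1]
  refine (norm_integral_le_of_norm_le
    (g := fun t : ℝ ↦ t ^ (s.re - 1) * B)
      ((integrableOn_Ioi_rpow_of_lt hs' zero_lt_one).mul_const _)
    ?_).trans ?_
  · filter_upwards [ae_restrict_mem measurableSet_Ioi] with t ht
    rw [norm_mul, norm_cpow_eq_rpow_re_of_pos (zero_lt_one.trans ht)]
    simp only [sub_re, one_re]
    gcongr
    · exact Real.rpow_nonneg (zero_lt_one.trans ht).le _
    · exact hB t ht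
  · rw [integral_mul_const, integral_Ioi_rpow_of_lt hs' zero_lt_one]
    gcongr
    simp only [Real.one_rpow, sub_add_cancel]
    rw [neg_div, ← div_neg, div_le_iff₀ (by linarith)]
    linarith

/-- The function `(s - 1) L(χ, s)` is entire. -/
theorem DirichletCharacter.exists_differentiable_sub_one_mul_LFunction {q : ℕ} [NeZero q]
    (χ : DirichletCharacter ℂ q) :
    ∃ D : ℂ → ℂ, Differentiable ℂ D ∧ ∀ s ≠ 1, D s = (s - 1) * LFunction χ s := by
  by_cases hχ : χ = 1
  · subst hχ
    refine ⟨LFunctionTrivChar₁ q, differentiable_LFunctionTrivChar₁ q, fun s hs ↦ ?_⟩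
    simp [LFunctionTrivChar₁, Function.update_of_ne hs]
  · exact ⟨fun s ↦ (s - 1) * LFunction χ s,
      (differentiable_id.sub_const 1).mul (differentiable_LFunction hχ), fun s _ ↦ rfl⟩

/-- In the half-plane `0 < re s`, a Dirichlet `L`-function is the sum of a multiple of
`s / (s - 1)` and of `s * J s` with `J` bounded. -/
theorem DirichletCharacter.exists_LFunction_eq {q : ℕ} [NeZero q] (χ : DirichletCharacter ℂ q) :
    ∃ ρ : ℂ, ∃ B : ℝ, ∃ J : ℂ → ℂ, (∀ s, 0 < s.re → DifferentiableAt ℂ J s) ∧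
      (∀ s, 1 / 2 ≤ s.re → ‖J s‖ ≤ B) ∧
      ∀ s, 0 < s.re → s ≠ 1 → LFunction χ s = ρ * s / (s - 1) + s * J s := by
  obtain ⟨ρ, B, hB⟩ := Function.Periodic.exists_norm_sum_range_sub_le (q := q)
    (f := fun k ↦ χ (k + 1 : ℕ)) (fun k ↦ by simp)
  have hS : ∀ n : ℕ, ∑ k ∈ Finset.Icc 1 n, χ k = ∑ k ∈ Finset.range n, χ (k + 1 : ℕ) := fun n ↦ by
    rw [Finset.range_eq_Ico, Finset.sum_Ico_add' (fun k : ℕ ↦ χ k) 0 n 1]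
    rfl
  set E : ℝ → ℂ := fun x ↦ ∑ k ∈ Finset.Icc 1 ⌊x⌋₊, χ k - ρ * x with hEdef
  have hE : Measurable E := (measurable_sum_Icc_floor _).sub (by fun_prop)
  have hEB : ∀ x, 1 < x → ‖E x‖ ≤ B + ‖ρ‖ := fun x hx ↦ by
    have h0 : 0 ≤ x := by linarith
    have : E x = (∑ k ∈ Finset.range ⌊x⌋₊, χ (k + 1 : ℕ) - ρ * ⌊x⌋₊) +
        ρ * ((⌊x⌋₊ : ℝ) - x : ℝ) := by
      simp only [hEdef, hS]; push_cast; ring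
    rw [this]
    refine (norm_add_le _ _).trans (add_le_add (hB _) ?_)
    rw [norm_mul, norm_real, Real.norm_eq_abs]
    refine mul_le_of_le_one_right (norm_nonneg _) (abs_le.mpr ⟨?_, ?_⟩)
    · linarith [Nat.lt_floor_add_one x]
    · linarith [Nat.floor_le h0]
  obtain ⟨hconv, hdiff, hbound⟩ := mellin_indicator_Ioi_one_of_bounded hE hEB
  set J : ℂ → ℂ := fun s ↦ mellin ((Ioi 1).indicator E) (-s) with hJ
  have hJd : ∀ s : ℂ, 0 < s.re → DifferentiableAt ℂ J s := fun s hs ↦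
    (hdiff (-s) (by simpa using hs)).comp (f := fun s : ℂ ↦ -s) s
      differentiable_neg.differentiableAt
  refine ⟨ρ, 2 * (B + ‖ρ‖), J, hJd, fun s hs ↦ hbound _ (by simpa using by linarith), ?_⟩
  have hL : ∀ s : ℂ, 1 < s.re → LFunction χ s = ρ * s / (s - 1) + s * J s := by
    intro s hs
    have hO : (fun n : ℕ ↦ ∑ k ∈ Finset.Icc 1 n, ‖χ (k : ℕ)‖) =O[atTop]
        fun n : ℕ ↦ (n : ℝ) ^ (1 : ℝ) := by
      refine IsBigO.of_bound 1 (Eventually.of_forall fun n ↦ ?_)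
      rw [Real.norm_of_nonneg (by positivity)]
      refine (Finset.sum_le_sum fun k _ ↦ χ.norm_le_one (k : ℕ)).trans ?_
      simp
    rw [LFunction_eq_LSeries _ hs, LSeries_eq_mul_integral' _ zero_le_one hs hO]
    have hneg : -(s + 1) = -s - 1 := by ring
    have hs1 : (-s).re < -1 := by simpa using hs
    have h1 : J s = ∫ t in Ioi (1 : ℝ), E t * (t : ℂ) ^ (-(s + 1)) := by
      simp only [hJ]
      rw [mellin, ← integral_indicator measurableSet_Ioi, ← integral_indicator measurableSet_Ioi]
      congr 1
      ext t
      by_cases ht : 1 < t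
      · simp [ht, zero_lt_one.trans ht, mul_comm, hneg]
      · simp [ht]
    have hi : IntegrableOn (fun t : ℝ ↦ E t * (t : ℂ) ^ (-(s + 1))) (Ioi 1) := by
      have := hconv (-s) (by simp; linarith)
      refine ((this.mono_set (Ioi_subset_Ioi zero_le_one)).congr_fun (fun t ht ↦ ?_)
        measurableSet_Ioi)
      have ht : 1 < t := ht
      simp [ht, mul_comm, hneg]
    have hi2 := (integrableOn_Ioi_cpow_of_lt hs1 zero_lt_one).const_mul ρ
    have h2 : ∫ t in Ioi (1 : ℝ), (∑ k ∈ Finset.Icc 1 ⌊t⌋₊, χ k) * (t : ℂ) ^ (-(s + 1)) =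
        ∫ t in Ioi (1 : ℝ), (ρ * (t : ℂ) ^ (-s) + E t * (t : ℂ) ^ (-(s + 1))) := by
      refine setIntegral_congr_fun measurableSet_Ioi fun t ht ↦ ?_
      have ht0 : (t : ℂ) ≠ 0 := ofReal_ne_zero.mpr (zero_lt_one.trans ht).ne'
      have : (t : ℂ) ^ (-s) = t * (t : ℂ) ^ (-(s + 1)) := by
        rw [show -s = -(s + 1) + 1 by ring, cpow_add _ _ ht0, cpow_one, mul_comm]
      simp only [hEdef, this]
      ring
    rw [h2, integral_add hi2 hi, ← h1, integral_const_mul, integral_Ioi_cpow_of_lt hs1 zero_lt_one]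
    have : s - 1 ≠ 0 := fun h ↦ by
      have := congrArg re h
      simp at this; linarith
    have h' : -s + 1 ≠ 0 := fun h ↦ this (by linear_combination -h)
    have h'' : (-s + 1)⁻¹ = -(s - 1)⁻¹ := by rw [← inv_neg]; congr 1; ring
    simp only [ofReal_one, one_cpow, div_eq_mul_inv, h'']
    ring
  obtain ⟨D, hD, hDeq⟩ := χ.exists_differentiable_sub_one_mul_LFunction
  have hopen : IsOpen {s : ℂ | 0 < s.re} := isOpen_lt continuous_const continuous_re
  have key : EqOn D (fun s ↦ ρ * s + (s - 1) * (s * J s)) {s : ℂ | 0 < s.re} := by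
    refine AnalyticOnNhd.eqOn_of_preconnected_of_eventuallyEq (z₀ := 2)
      (hD.differentiableOn.analyticOnNhd hopen) (DifferentiableOn.analyticOnNhd ?_ hopen)
      (convex_halfSpace_re_gt 0).isPreconnected (by simp) ?_
    · intro s hs
      have := hJd s hs
      exact DifferentiableAt.differentiableWithinAt (by fun_prop)
    · have : {s : ℂ | 1 < s.re} ∈ 𝓝 (2 : ℂ) :=
        (isOpen_lt continuous_const continuous_re).mem_nhds (by simp)
      filter_upwards [this] with s hs
      have hs1 : s ≠ 1 := fun h ↦ by simp [h] at hs
      have hs1' : s - 1 ≠ 0 := sub_ne_zero.mpr hs1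
      rw [hDeq s hs1, hL s hs]
      field_simp
  intro s hs hs1
  have hs1' : s - 1 ≠ 0 := sub_ne_zero.mpr hs1
  have h := key hs
  simp only [hDeq s hs1] at h
  field_simp
  linear_combination h

theorem norm_div_sub_one_le (s : ℂ) {r : ℝ} (hr : 0 < r) (hs : r ≤ ‖s - 1‖) :
    ‖s / (s - 1)‖ ≤ 1 + r⁻¹ := by
  have h0 : s - 1 ≠ 0 := norm_pos_iff.mp (hr.trans_le hs)
  rw [show s / (s - 1) = 1 + (s - 1)⁻¹ by field_simp; ring]
  refine (norm_add_le _ _).trans ?_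
  rw [norm_one, norm_inv]
  gcongr

/-- A convexity bound: close to the line `re s = 1`, a function that is `O(|s|)` on
`1 / 2 ≤ re s` and bounded on `re s = 65 / 64` is `O(|im s| ^ (1 / 16))`. -/
theorem exists_norm_le_rpow_of_norm_le_mul {F : ℂ → ℂ}
    (hF : ∀ s, 0 < s.re → DifferentiableAt ℂ F s) {B K : ℝ}
    (hB : ∀ s, 1 / 2 ≤ s.re → ‖F s‖ ≤ B * ‖s‖) (hK : ∀ s : ℂ, s.re = 65 / 64 → ‖F s‖ ≤ K) :
    ∃ C : ℝ, ∀ s : ℂ, |s.re - 1| ≤ 1 / 64 → 1 ≤ |s.im| → ‖F s‖ ≤ C * |s.im| ^ (1 / 16 : ℝ) := by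
  set B' := max B 1
  set K' := max K 1
  have hB'1 : 1 ≤ B' := le_max_right _ _
  have hK'1 : 1 ≤ K' := le_max_right _ _
  refine ⟨(4 * B' * Real.exp 4) ^ (1 / 16 : ℝ) * (K' * Real.exp 4), fun s hs hT ↦ ?_⟩
  obtain ⟨hs1, hs2⟩ := abs_le.mp hs
  set T := s.im
  set h : ℂ → ℂ := fun z ↦ F z * cexp ((z - T * I) ^ 2) with hh
  have hexp (z : ℂ) : ‖cexp ((z - T * I) ^ 2)‖ = Real.exp (z.re ^ 2 - (z.im - T) ^ 2) := by
    rw [norm_exp]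
    congr 1
    simp [pow_two]
  have hexp4 (z : ℂ) (h1 : 1 / 2 ≤ z.re) (h2 : z.re ≤ 65 / 64) :
      Real.exp (z.re ^ 2 - (z.im - T) ^ 2) ≤ Real.exp 4 * Real.exp (-(z.im - T) ^ 2) := by
    rw [← Real.exp_add]
    gcongr
    nlinarith
  have hbound (z : ℂ) (h1 : 1 / 2 ≤ z.re) (h2 : z.re ≤ 65 / 64) :
      ‖h z‖ ≤ 4 * B' * Real.exp 4 * |T| := by
    have hz : ‖z‖ ≤ 2 + |T| + |z.im - T| := by
      refine (norm_le_abs_re_add_abs_im z).trans ?_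
      have := abs_add_le T (z.im - T)
      rw [add_sub_cancel] at this
      rw [abs_of_nonneg (by linarith : 0 ≤ z.re)]
      linarith
    have hy : (2 + |T| + |z.im - T|) * Real.exp (-(z.im - T) ^ 2) ≤ 4 * |T| := by
      rw [Real.exp_neg, ← div_eq_mul_inv, div_le_iff₀ (Real.exp_pos _)]
      have h3 := Real.add_one_le_exp ((z.im - T) ^ 2)
      have h4 : |z.im - T| ≤ (z.im - T) ^ 2 + 1 := by
        rw [← sq_abs]; nlinarith [sq_nonneg (|z.im - T| - 1), abs_nonneg (z.im - T)]
      nlinarith [abs_nonneg (z.im - T), sq_nonneg (z.im - T)]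
    rw [hh, norm_mul, hexp]
    calc ‖F z‖ * Real.exp (z.re ^ 2 - (z.im - T) ^ 2)
        ≤ (B' * (2 + |T| + |z.im - T|)) * (Real.exp 4 * Real.exp (-(z.im - T) ^ 2)) := by
          gcongr
          · exact (hB z h1).trans (by gcongr; exact le_max_left _ _)
          · exact hexp4 z h1 h2
      _ = B' * Real.exp 4 * ((2 + |T| + |z.im - T|) * Real.exp (-(z.im - T) ^ 2)) := by ring
      _ ≤ B' * Real.exp 4 * (4 * |T|) := by gcongr
      _ = _ := by ring
  have hd : Differentiable ℂ (fun z : ℂ ↦ cexp ((z - T * I) ^ 2)) := by fun_prop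
  have hdiff : DifferentiableOn ℂ h {z : ℂ | 0 < z.re} := fun z hz ↦
    ((hF z hz).mul (hd z)).differentiableWithinAt
  have hlu : (1 / 2 : ℝ) < 65 / 64 := by norm_num
  have hsub : HadamardThreeLines.verticalClosedStrip (1 / 2) (65 / 64) ⊆ {z : ℂ | 0 < z.re} :=
    fun z hz ↦ lt_of_lt_of_le (by norm_num) hz.1
  have h3 := HadamardThreeLines.norm_le_interp_of_mem_verticalClosedStrip' (f := h) (z := s)
    (a := 4 * B' * Real.exp 4 * |T|) (b := K' * Real.exp 4) hlu
    ⟨by linarith, by linarith⟩ ?_ ?_ ?_ ?_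
  · have hθ0 : 0 ≤ 1 - (s.re - 1 / 2) / (65 / 64 - 1 / 2) := by
      rw [sub_nonneg, div_le_one (by norm_num)]; linarith
    have hθ1 : 1 - (s.re - 1 / 2) / (65 / 64 - 1 / 2) ≤ 1 / 16 := by
      rw [sub_le_comm, le_div_iff₀ (by norm_num)]; linarith
    have he : (1 : ℝ) ≤ Real.exp 4 := Real.one_le_exp (by norm_num)
    have hBe : 1 ≤ 4 * B' * Real.exp 4 := by nlinarith
    have hKe : 1 ≤ K' * Real.exp 4 := by nlinarith
    have hFs : ‖F s‖ ≤ ‖h s‖ := by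
      rw [hh, norm_mul, hexp]
      refine le_mul_of_one_le_right (norm_nonneg _) (Real.one_le_exp ?_)
      simp only [T, sub_self]
      nlinarith [sq_nonneg s.re]
    refine hFs.trans (h3.trans ?_)
    rw [mul_right_comm (_ ^ (1 / 16 : ℝ)) (K' * Real.exp 4),
      ← Real.mul_rpow (by positivity) (by positivity)]
    gcongr ?_ * ?_
    · exact Real.rpow_le_rpow_of_exponent_le (one_le_mul_of_one_le_of_one_le hBe hT) hθ1
    · refine (Real.rpow_le_rpow_of_exponent_le hKe
        (y := (s.re - 1 / 2) / (65 / 64 - 1 / 2)) (z := 1) ?_).trans_eq (Real.rpow_one _)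
      linarith
  · refine DifferentiableOn.diffContOnCl (hdiff.mono ?_)
    refine (closure_minimal ?_ ?_).trans hsub
    · exact fun z hz ↦ ⟨hz.1.le, hz.2.le⟩
    · exact isClosed_Icc.preimage continuous_re
  · exact ⟨_, by rintro _ ⟨z, hz, rfl⟩; exact hbound z hz.1 hz.2⟩
  · intro z hz
    have hz : z.re = 1 / 2 := hz
    exact hbound z hz.ge (by rw [hz]; norm_num)
  · intro z hz
    have hz : z.re = 65 / 64 := hz
    rw [hh, norm_mul, hexp]
    gcongr
    · exact (hK z hz).trans (le_max_left _ _)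
    · rw [hz]; nlinarith [sq_nonneg (z.im - T)]

/-- Close to the line `re s = 1`, a Dirichlet `L`-function is `O(|im s| ^ (1 / 16))`. -/
theorem DirichletCharacter.exists_norm_LFunction_le_rpow {q : ℕ} [NeZero q]
    (χ : DirichletCharacter ℂ q) :
    ∃ C : ℝ, ∀ s : ℂ, |s.re - 1| ≤ 1 / 64 → 1 ≤ |s.im| →
      ‖LFunction χ s‖ ≤ C * |s.im| ^ (1 / 16 : ℝ) := by
  obtain ⟨ρ, B, J, hJ, hB, hL⟩ := χ.exists_LFunction_eq
  have hex := exists_norm_le_rpow_of_norm_le_mul (F := fun s ↦ s * J s)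
    (K := ∑' n, ‖LSeries.term (fun n ↦ χ n) ((65 / 64 : ℝ) : ℂ) n‖ + ‖ρ‖ * 65) (B := B)
    (fun s hs ↦ differentiableAt_id.mul (hJ s hs)) ?_ ?_
  · obtain ⟨C, hC⟩ := hex
    refine ⟨‖ρ‖ * 2 + C, fun s hs hT ↦ ?_⟩
    have hT' : 1 ≤ ‖s - 1‖ := hT.trans (by simpa using abs_im_le_norm (s - 1))
    have h1 : s ≠ 1 := by rintro rfl; norm_num at hT'
    have hTp : 1 ≤ |s.im| ^ (1 / 16 : ℝ) := Real.one_le_rpow hT (by norm_num)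
    have h2 := norm_div_sub_one_le s one_pos hT'
    rw [hL s (by linarith [(abs_le.mp hs).1]) h1, add_mul, mul_div_assoc]
    refine (norm_add_le _ _).trans (add_le_add ?_ (hC s hs hT))
    rw [norm_mul]
    calc ‖ρ‖ * ‖s / (s - 1)‖ ≤ ‖ρ‖ * 2 := by gcongr; linarith
      _ ≤ _ := le_mul_of_one_le_right (by positivity) hTp
  · intro s hs
    rw [norm_mul, mul_comm]
    gcongr
    exact hB s hs
  · intro s hs
    have hs1 : 1 < s.re := by rw [hs]; norm_num
    have h1 : s ≠ 1 := by rintro rfl; norm_num at hs1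
    have h2 := norm_div_sub_one_le s (r := 1 / 64) (by norm_num) <| by
      refine le_trans ?_ (abs_re_le_norm (s - 1))
      simp only [sub_re, one_re, hs]
      norm_num [abs_of_pos]
    rw [show s * J s = LFunction χ s - ρ * (s / (s - 1)) by
      rw [hL s (by linarith) h1]; ring]
    refine (norm_sub_le _ _).trans (add_le_add ?_ ?_)
    · have hterm : ∀ n, ‖LSeries.term (fun n ↦ χ n) s n‖ =
          ‖LSeries.term (fun n ↦ χ n) ((65 / 64 : ℝ) : ℂ) n‖ := fun n ↦ by
        simp only [LSeries.norm_term_eq, hs, ofReal_re]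
      rw [LFunction_eq_LSeries χ hs1, LSeries]
      simp_rw [← hterm]
      exact norm_tsum_le_tsum_norm (χ.LSeriesSummable_of_one_lt_re hs1).norm
    · rw [norm_mul]
      gcongr
      linarith

/-- Close to the line `re s = 1`, the derivative of a Dirichlet `L`-function is
`O(|im s| ^ (1 / 16))`. -/
theorem DirichletCharacter.exists_norm_deriv_LFunction_le_rpow {q : ℕ} [NeZero q]
    (χ : DirichletCharacter ℂ q) :
    ∃ D : ℝ, 1 ≤ D ∧ ∀ s : ℂ, |s.re - 1| ≤ 1 / 128 → 2 ≤ |s.im| →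
      ‖deriv (LFunction χ) s‖ ≤ D * |s.im| ^ (1 / 16 : ℝ) := by
  obtain ⟨C, hC⟩ := χ.exists_norm_LFunction_le_rpow
  refine ⟨max C 1 * 2 * 128, by linarith [le_max_right C 1], fun s hs ht ↦ ?_⟩
  have hC1 : 0 < max C 1 := one_pos.trans_le (le_max_right _ _)
  have him : ∀ z ∈ Metric.closedBall s (1 / 128), |z.im - s.im| ≤ 1 / 128 := fun z hz ↦
    (abs_im_le_norm (z - s)).trans (mem_closedBall_iff_norm.mp hz)
  have hre : ∀ z ∈ Metric.closedBall s (1 / 128), |z.re - s.re| ≤ 1 / 128 := fun z hz ↦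
    (abs_re_le_norm (z - s)).trans (mem_closedBall_iff_norm.mp hz)
  have hlow : ∀ z ∈ Metric.closedBall s (1 / 128), 1 ≤ |z.im| := fun z hz ↦ by
    have := abs_sub_abs_le_abs_sub s.im z.im
    have := him z hz
    rw [abs_sub_comm] at this
    linarith
  have hd : DifferentiableOn ℂ (LFunction χ) (Metric.closedBall s (1 / 128)) := fun z hz ↦ by
    refine (differentiableAt_LFunction χ z (.inl ?_)).differentiableWithinAt
    rintro rfl
    have := hlow 1 hz
    norm_num at this
  have := norm_deriv_le_of_forall_mem_sphere_norm_le (c := s) (R := 1 / 128)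
    (C := max C 1 * (2 * |s.im| ^ (1 / 16 : ℝ))) (by norm_num)
    (hd.diffContOnCl_ball subset_rfl) fun z hz ↦ ?_
  · linarith
  · have hz := Metric.sphere_subset_closedBall hz
    refine (hC z ?_ (hlow z hz)).trans ?_
    · have := abs_sub_le z.re s.re 1
      have := hre z hz
      linarith
    · gcongr
      · exact le_max_left _ _
      · have h1 : |z.im| ≤ 2 * |s.im| := by
          have := abs_sub_abs_le_abs_sub z.im s.im
          have := him z hz
          linarith
        calc |z.im| ^ (1 / 16 : ℝ) ≤ (2 * |s.im|) ^ (1 / 16 : ℝ) := by gcongr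
          _ = 2 ^ (1 / 16 : ℝ) * |s.im| ^ (1 / 16 : ℝ) :=
            Real.mul_rpow (by norm_num) (abs_nonneg _)
          _ ≤ 2 * |s.im| ^ (1 / 16 : ℝ) := by
            gcongr
            exact Real.rpow_le_self_of_one_le (by norm_num) (by norm_num)

/-- A lower bound for a Dirichlet `L`-function to the right of the line `re s = 1`. -/
theorem DirichletCharacter.exists_le_norm_LFunction_pow_four {q : ℕ} [NeZero q]
    (χ : DirichletCharacter ℂ q) :
    ∃ c : ℝ, 0 < c ∧ c ≤ 1 ∧ ∀ s : ℂ, 1 < s.re → s.re ≤ 1 + 1 / 64 → 1 ≤ |s.im| →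
      c * (s.re - 1) ^ 3 / |s.im| ^ (1 / 16 : ℝ) ≤ ‖LFunction χ s‖ ^ 4 := by
  obtain ⟨C, hC⟩ := (χ ^ 2).exists_norm_LFunction_le_rpow
  obtain ⟨ρ, B, J, -, hB, hL⟩ := (1 : DirichletCharacter ℂ q).exists_LFunction_eq
  set M := (‖ρ‖ * 2 + 2 * max B 1) with hM
  set C' := max C 1
  have hC'1 : 1 ≤ C' := le_max_right _ _
  have hB1 : 1 ≤ max B 1 := le_max_right _ _
  have hM1 : 1 ≤ M := by have := norm_nonneg ρ; linarith
  refine ⟨(M ^ 3 * (C' * 2))⁻¹, by positivity, inv_le_one_of_one_le₀ ?_, fun s hs1 hs2 hT ↦ ?_⟩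
  · have := one_le_pow₀ hM1 (n := 3)
    nlinarith
  set x := s.re - 1 with hx
  have hx0 : 0 < x := by linarith
  have hs : s = 1 + x + I * s.im := by
    apply Complex.ext <;> simp [hx]
  have key := norm_LFunction_product_ge_one χ hx0 s.im
  rw [← hs, norm_mul, norm_mul, norm_pow, norm_pow] at key
  have h1 : ‖LFunctionTrivChar q (1 + x)‖ ≤ M / x := by
    rw [LFunctionTrivChar, hL _ (by simp; linarith) (by simpa using hx0.ne')]
    have hn : ‖(1 + x : ℂ)‖ ≤ 2 := by
      refine (norm_add_le _ _).trans ?_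
      rw [norm_one, norm_real, Real.norm_of_nonneg hx0.le]; linarith
    have hJ := (hB (1 + x) (by simp; linarith)).trans (le_max_left B 1)
    rw [add_sub_cancel_left, le_div_iff₀ hx0]
    have : ‖ρ * (1 + x : ℂ) / x‖ = ‖ρ‖ * ‖(1 + x : ℂ)‖ / x := by
      rw [norm_div, norm_mul, norm_real, Real.norm_of_nonneg hx0.le]
    calc _ ≤ (‖ρ‖ * 2 / x + 2 * max B 1) * x := by
          gcongr
          refine (norm_add_le _ _).trans ?_
          rw [this, norm_mul]
          gcongr
      _ = ‖ρ‖ * 2 + 2 * max B 1 * x := by field_simp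
      _ ≤ M := by rw [hM]; nlinarith
  have h2 : ‖LFunction (χ ^ 2) (1 + x + 2 * I * s.im)‖ ≤ C' * 2 * |s.im| ^ (1 / 16 : ℝ) := by
    have him : (1 + x + 2 * I * s.im : ℂ).im = 2 * s.im := by simp
    have hre : (1 + x + 2 * I * s.im : ℂ).re = s.re := by simp [hx]
    refine (hC _ ?_ ?_).trans ?_
    · rw [hre, abs_of_pos hx0]; linarith
    · rw [him, abs_mul, abs_two]; linarith
    · rw [him, abs_mul, abs_two, Real.mul_rpow (by norm_num) (abs_nonneg _), mul_assoc]
      gcongr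
      · exact le_max_left _ _
      · exact Real.rpow_le_self_of_one_le (by norm_num) (by norm_num)
  have hτ : 0 < |s.im| ^ (1 / 16 : ℝ) := by positivity
  have h3 : 1 ≤ (M / x) ^ 3 * ‖LFunction χ s‖ ^ 4 * (C' * 2 * |s.im| ^ (1 / 16 : ℝ)) :=
    key.trans (by gcongr)
  rw [div_le_iff₀ hτ, inv_mul_le_iff₀ (by positivity)]
  calc x ^ 3 = x ^ 3 * 1 := (mul_one _).symm
    _ ≤ x ^ 3 * ((M / x) ^ 3 * ‖LFunction χ s‖ ^ 4 * (C' * 2 * |s.im| ^ (1 / 16 : ℝ))) := by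
      gcongr
    _ = _ := by field_simp

/-- A zero-free region with a polynomial bound for the logarithmic derivative. -/
theorem DirichletCharacter.exists_norm_deriv_div_LFunction_le {q : ℕ} [NeZero q]
    (χ : DirichletCharacter ℂ q) :
    ∃ A : ℝ, 0 < A ∧ A ≤ 1 / 256 ∧ ∀ s : ℂ, 2 ≤ |s.im| →
      1 - A / (|s.im| ^ (1 / 16 : ℝ)) ^ 5 ≤ s.re → s.re ≤ 1 + 1 / 256 →
      LFunction χ s ≠ 0 ∧
        ‖deriv (LFunction χ) s / LFunction χ s‖ ≤ (|s.im| ^ (1 / 16 : ℝ)) ^ 5 / A := by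
  obtain ⟨D, hD1, hD⟩ := χ.exists_norm_deriv_LFunction_le_rpow
  obtain ⟨c, hc, hc1, hcL⟩ := χ.exists_le_norm_LFunction_pow_four
  set A := c / (256 * D ^ 4) with hA
  have hD4 : 1 ≤ D ^ 4 := one_le_pow₀ hD1
  have hA0 : 0 < A := by positivity
  have hAc : 256 * D ^ 4 * A = c := by rw [hA]; field_simp
  have hA1 : A ≤ 1 / 256 := by
    rw [hA, div_le_div_iff₀ (by positivity) (by positivity)]; nlinarith
  refine ⟨A, hA0, hA1, fun s ht hs1 hs2 ↦ ?_⟩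
  set τ := |s.im| ^ (1 / 16 : ℝ) with hτ
  have hτ1 : 1 ≤ τ := Real.one_le_rpow (by linarith) (by norm_num)
  have hτ0 : 0 < τ := by linarith
  set r := A / τ ^ 5 with hr
  have hr0 : 0 < r := by positivity
  have hr1 : r ≤ 1 / 256 := (div_le_self hA0.le (one_le_pow₀ hτ1)).trans hA1
  have hright : ∀ z : ℂ, z.im = s.im → 1 + r ≤ z.re → z.re ≤ 1 + 1 / 256 →
      4 * A * D / τ ^ 4 ≤ ‖LFunction χ z‖ := fun z hz h1 h2 ↦ by
    have := hcL z (by linarith) (by linarith) (by rw [hz]; linarith)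
    rw [hz, ← hτ] at this
    refine le_of_pow_le_pow_left₀ (n := 4) (by norm_num) (norm_nonneg _) (le_trans ?_ this)
    calc (4 * A * D / τ ^ 4) ^ 4 = (256 * D ^ 4 * A) * r ^ 3 / τ := by rw [hr]; field_simp; ring
      _ ≤ c * (z.re - 1) ^ 3 / τ := by rw [hAc]; gcongr; linarith
  have hlow : 2 * A * D / τ ^ 4 ≤ ‖LFunction χ s‖ := by
    rcases le_total (1 + r) s.re with h | h
    · refine le_trans ?_ (hright s rfl h hs2)
      gcongr; norm_num
    · set z : ℂ := ⟨1 + r, s.im⟩ with hz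
      have hz1 := hright z rfl le_rfl (by simp only [hz]; linarith)
      set K : Set ℂ := {w | |w.re - 1| ≤ r ∧ w.im = s.im}
      have hK : Convex ℝ K := by
        have : K = re ⁻¹' (Metric.closedBall 1 r) ∩ im ⁻¹' {s.im} := by
          ext w; simp [K, Real.dist_eq]
        rw [this]
        exact ((convex_closedBall _ _).linear_preimage reLm).inter
          ((convex_singleton _).linear_preimage imLm)
      have hmvt := hK.norm_image_sub_le_of_norm_deriv_le (𝕜 := ℂ) (f := LFunction χ) (C := D * τ)
        (x := s) (y := z) ?_ ?_ ?_ ?_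
      · have hzs : ‖z - s‖ ≤ 2 * r := by
          have : z - s = ((1 + r - s.re : ℝ) : ℂ) := by
            apply Complex.ext <;> simp [hz]
          rw [this, norm_real, Real.norm_of_nonneg (by linarith)]
          linarith
        have h3 : ‖LFunction χ z - LFunction χ s‖ ≤ 2 * A * D / τ ^ 4 :=
          calc _ ≤ D * τ * ‖z - s‖ := hmvt
            _ ≤ D * τ * (2 * r) := by gcongr
            _ = _ := by rw [hr]; field_simp
        have h4 := norm_sub_norm_le (LFunction χ z) (LFunction χ s)
        have h5 : 4 * A * D / τ ^ 4 = 2 * A * D / τ ^ 4 + 2 * A * D / τ ^ 4 := by ring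
        linarith
      · intro w hw
        refine differentiableAt_LFunction χ w (.inl ?_)
        rintro rfl
        have := hw.2
        norm_num [← this] at ht
      · intro w hw
        have := hD w (by linarith [hw.1]) (by rw [hw.2]; exact ht)
        rwa [hw.2] at this
      · exact ⟨abs_le.mpr ⟨by linarith, by linarith⟩, rfl⟩
      · exact ⟨by simp [hz, abs_of_pos hr0], rfl⟩
  have hpos : 0 < 2 * A * D / τ ^ 4 := by positivity
  refine ⟨norm_pos_iff.mp (hpos.trans_le hlow), ?_⟩
  have hsd := hD s (abs_le.mpr ⟨by linarith, by linarith⟩) ht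
  rw [norm_div]
  calc _ ≤ D * τ / (2 * A * D / τ ^ 4) := by gcongr
    _ = τ ^ 5 / A / 2 := by field_simp
    _ ≤ τ ^ 5 / A := half_le_self (by positivity)

open ArithmeticFunction.vonMangoldt in
theorem exists_norm_LFunctionResidueClassAux_le {q : ℕ} [NeZero q] (a : ZMod q) :
    ∃ A M : ℝ, 0 < A ∧ A ≤ 1 / 256 ∧ 0 < M ∧ ∀ s : ℂ, 2 ≤ |s.im| →
      1 - A / (|s.im| ^ (1 / 16 : ℝ)) ^ 5 ≤ s.re → s.re ≤ 1 + 1 / 256 →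
      (∀ χ : DirichletCharacter ℂ q, LFunction χ s ≠ 0) ∧
        ‖LFunctionResidueClassAux a s‖ ≤ M * (|s.im| ^ (1 / 16 : ℝ)) ^ 5 := by
  choose A' hA0 hA1 hA using fun χ : DirichletCharacter ℂ q ↦ χ.exists_norm_deriv_div_LFunction_le
  obtain ⟨χ₀, -, hχ₀⟩ := (Finset.univ (α := DirichletCharacter ℂ q)).exists_min_image A'
    Finset.univ_nonempty
  set N : ℝ := ((Fintype.card (DirichletCharacter ℂ q) : ℕ) : ℝ)
  set A := A' χ₀
  have hAp : 0 < A := hA0 χ₀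
  refine ⟨A, 1 + 1 / A + N * (1 / A), hAp, hA1 χ₀, by positivity, fun s ht hs1 hs2 ↦ ?_⟩
  set τ := |s.im| ^ (1 / 16 : ℝ) with hτ
  have hτ1 : 1 ≤ τ := Real.one_le_rpow (by linarith) (by norm_num)
  have hτ0 : 0 < τ := by linarith
  have hτ5 : 1 ≤ τ ^ 5 := one_le_pow₀ hτ1
  have key : ∀ χ : DirichletCharacter ℂ q, LFunction χ s ≠ 0 ∧
      ‖deriv (LFunction χ) s / LFunction χ s‖ ≤ τ ^ 5 / A := fun χ ↦ by
    have hle := hχ₀ χ (Finset.mem_univ _)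
    obtain ⟨h1, h2⟩ := hA χ s ht (le_trans (by gcongr) hs1) hs2
    exact ⟨h1, h2.trans (by gcongr)⟩
  refine ⟨fun χ ↦ (key χ).1, ?_⟩
  have hs0 : 1 ≤ ‖s - 1‖ := by
    refine le_trans ?_ (abs_im_le_norm (s - 1))
    rw [sub_im, one_im, sub_zero]; linarith
  have hs : s ≠ 1 := by rintro rfl; norm_num at hs0
  have htriv : ‖-deriv (LFunctionTrivChar₁ q) s / LFunctionTrivChar₁ q s‖ ≤ τ ^ 5 + τ ^ 5 / A := by
    rw [deriv_LFunctionTrivChar₁_apply_of_ne_one _ hs, LFunctionTrivChar₁,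
      Function.update_of_ne hs, neg_div, norm_neg]
    have h0 := (key 1).1
    have h1 : s - 1 ≠ 0 := sub_ne_zero.mpr hs
    have : ((s - 1) * deriv (LFunctionTrivChar q) s + LFunctionTrivChar q s) /
        ((s - 1) * LFunctionTrivChar q s) =
        1 / (s - 1) + deriv (LFunction (1 : DirichletCharacter ℂ q)) s /
          LFunction (1 : DirichletCharacter ℂ q) s := by
      rw [LFunctionTrivChar]; field_simp; ring
    rw [this]
    refine (norm_add_le _ _).trans (add_le_add (le_trans ?_ hτ5) (key 1).2)
    rw [norm_div, norm_one]
    exact div_le_one_of_le₀ hs0 (norm_nonneg _)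
  have hsum (S : Finset (DirichletCharacter ℂ q)) :
      ‖∑ χ ∈ S, χ a⁻¹ * deriv (LFunction χ) s / LFunction χ s‖ ≤ N * (τ ^ 5 / A) := by
    refine (norm_sum_le_of_le S (n := fun χ ↦ τ ^ 5 / A) fun χ _ ↦ ?_).trans ?_
    · rw [mul_div_assoc, norm_mul]
      exact (mul_le_of_le_one_left (norm_nonneg _) (χ.norm_le_one _)).trans (key χ).2
    · rw [Finset.sum_const, nsmul_eq_mul]
      gcongr
      exact Nat.cast_le.mpr (Finset.card_le_univ S)
  have hφ : ‖(q.totient : ℂ)⁻¹‖ ≤ 1 := by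
    rw [norm_inv, Complex.norm_natCast]
    exact inv_le_one_of_one_le₀ (by exact_mod_cast Nat.totient_pos.mpr (NeZero.pos q))
  rw [LFunctionResidueClassAux, norm_mul]
  refine (mul_le_of_le_one_left (norm_nonneg _) hφ).trans ((norm_sub_le _ _).trans ?_)
  calc _ ≤ τ ^ 5 + τ ^ 5 / A + N * (τ ^ 5 / A) := add_le_add htriv (hsum _)
    _ = _ := by ring

/-- A function that is holomorphic and of controlled growth in a neighbourhood of the closed
half-plane `1 ≤ re s` has a divided difference with bounded second derivative. -/
theorem exists_norm_deriv_deriv_dslope_le {H : ℂ → ℂ} {U : Set ℂ} (hU : IsOpen U)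
    (hUH : DifferentiableOn ℂ H U) (hU1 : {s : ℂ | 1 ≤ s.re} ⊆ U) {A M : ℝ} (hA : 0 < A)
    (hA1 : A ≤ 1 / 256) (hM : 0 < M)
    (hH : ∀ s : ℂ, 2 ≤ |s.im| → 1 - A / (|s.im| ^ (1 / 16 : ℝ)) ^ 5 ≤ s.re →
      s.re ≤ 1 + 1 / 256 → s ∈ U ∧ ‖H s‖ ≤ M * (|s.im| ^ (1 / 16 : ℝ)) ^ 5) :
    ∃ K : ℝ, ∀ s : ℂ, 1 ≤ s.re → s.re ≤ 1 + 1 / 512 → ‖deriv (deriv (dslope H 1)) s‖ ≤ K := by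
  have hQ : DifferentiableOn ℂ (dslope H 1) U :=
    (differentiableOn_dslope (hU.mem_nhds (hU1 (by simp)))).mpr hUH
  have hcont : ContinuousOn (deriv (deriv (dslope H 1))) U :=
    ((hQ.deriv hU).deriv hU).continuousOn
  have hcomp : IsCompact (Icc 1 (1 + 1 / 512) ×ℂ Icc (-4) 4) := isCompact_Icc.reProdIm isCompact_Icc
  obtain ⟨K, hK⟩ := hcomp.exists_bound_of_continuousOn (hcont.mono fun s hs ↦ hU1 hs.1.1)
  refine ⟨max K (64 * (2 * M + ‖H 1‖) / A ^ 2), fun s hs1 hs2 ↦ ?_⟩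
  rcases le_total |s.im| 4 with ht | ht
  · exact (hK s ⟨⟨hs1, hs2⟩, abs_le.mp ht⟩).trans (le_max_left _ _)
  refine le_trans ?_ (le_max_right _ _)
  set τ := |s.im| ^ (1 / 16 : ℝ) with hτ
  have hτ1 : 1 ≤ τ := Real.one_le_rpow (by linarith) (by norm_num)
  have hτ0 : 0 < τ := by linarith
  have hτ5 : 1 ≤ τ ^ 5 := one_le_pow₀ hτ1
  have hτ16 : τ ^ 16 = |s.im| := by
    rw [hτ, ← Real.rpow_mul_natCast (abs_nonneg _)]; norm_num
  set r := A / (4 * τ ^ 5) with hr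
  have hr0 : 0 < r := by positivity
  have hr1 : r ≤ 1 / 512 := by
    rw [hr, div_le_iff₀ (by positivity)]; linarith
  have hz : ∀ z ∈ Metric.closedBall s r, z ∈ U ∧
      ‖dslope H 1 z‖ ≤ 2 * (2 * M + ‖H 1‖) * τ ^ 5 / τ ^ 16 := fun z hz ↦ by
    rw [mem_closedBall_iff_norm] at hz
    have him := abs_le.mp ((abs_im_le_norm (z - s)).trans hz)
    have hre := abs_le.mp ((abs_re_le_norm (z - s)).trans hz)
    rw [sub_im] at him
    rw [sub_re] at hre
    have him1 : |z.im| ≤ 2 * |s.im| := by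
      have := abs_sub_abs_le_abs_sub z.im s.im
      have := abs_le.mpr him
      linarith
    have him2 : |s.im| / 2 ≤ |z.im| := by
      have := abs_sub_abs_le_abs_sub s.im z.im
      have := abs_le.mpr him
      rw [abs_sub_comm] at this
      linarith
    have hzτ : (|z.im| ^ (1 / 16 : ℝ)) ^ 5 ≤ 2 * τ ^ 5 := by
      calc (|z.im| ^ (1 / 16 : ℝ)) ^ 5 ≤ ((2 * |s.im|) ^ (1 / 16 : ℝ)) ^ 5 := by gcongr
        _ = (2 : ℝ) ^ (5 / 16 : ℝ) * τ ^ 5 := by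
          rw [Real.mul_rpow (by norm_num) (abs_nonneg _), mul_pow,
            ← Real.rpow_mul_natCast (by norm_num), ← hτ]
          norm_num
        _ ≤ 2 * τ ^ 5 := by
          gcongr
          exact Real.rpow_le_self_of_one_le (by norm_num) (by norm_num)
    have hz0 : 0 < |z.im| := by linarith
    obtain ⟨hzU, hzH⟩ := hH z (by linarith) (by
      have : r ≤ A / (|z.im| ^ (1 / 16 : ℝ)) ^ 5 := by
        rw [hr]; gcongr; linarith
      linarith) (by linarith)
    refine ⟨hzU, ?_⟩
    have hz1 : |z.im| ≤ ‖z - 1‖ := by simpa using abs_im_le_norm (z - 1)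
    have hne : z ≠ 1 := by
      rintro rfl
      simp at hz0
    rw [dslope_of_ne _ hne, slope_def_field, norm_div, hτ16,
      show 2 * (2 * M + ‖H 1‖) * τ ^ 5 / |s.im| = (2 * M + ‖H 1‖) * τ ^ 5 / (|s.im| / 2) by
        field_simp]
    gcongr
    · calc ‖H z - H 1‖ ≤ ‖H z‖ + ‖H 1‖ := norm_sub_le _ _
        _ ≤ M * (2 * τ ^ 5) + ‖H 1‖ * τ ^ 5 := by
          gcongr
          · exact hzH.trans (by gcongr)
          · exact le_mul_of_one_le_right (norm_nonneg _) hτ5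
        _ = _ := by ring
    · exact him2.trans hz1
  have := norm_iteratedDeriv_le_of_forall_mem_sphere_norm_le (n := 2) (c := s) (R := r)
    (f := dslope H 1) hr0
    ((hQ.mono fun z h ↦ (hz z h).1).diffContOnCl_ball subset_rfl)
    fun z h ↦ (hz z (Metric.sphere_subset_closedBall h)).2
  rw [iteratedDeriv_succ, iteratedDeriv_one] at this
  refine this.trans ?_
  have hτ' : 1 / τ ≤ 1 := (div_le_one hτ0).mpr hτ1
  calc _ = 64 * (2 * M + ‖H 1‖) / A ^ 2 * (1 / τ) := by
        rw [hr, Nat.factorial_two]; field_simp; ring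
    _ ≤ _ := mul_le_of_le_one_right (by positivity) hτ'

open ArithmeticFunction.vonMangoldt in
/-- The divided difference at `1` of the auxiliary function of a residue class has bounded second
derivative near the line `re s = 1`. -/
theorem exists_norm_deriv_deriv_dslope_LFunctionResidueClassAux_le {q : ℕ} [NeZero q]
    (a : ZMod q) :
    ∃ K : ℝ, ∀ s : ℂ, 1 ≤ s.re → s.re ≤ 1 + 1 / 512 →
      ‖deriv (deriv (dslope (LFunctionResidueClassAux a) 1)) s‖ ≤ K := by
  set U : Set ℂ := {s | LFunctionTrivChar₁ q s ≠ 0} ∩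
    ⋂ χ ∈ {χ : DirichletCharacter ℂ q | χ ≠ 1}, {s | LFunction χ s ≠ 0}
  have hU : IsOpen U := by
    refine (isOpen_ne_fun (differentiable_LFunctionTrivChar₁ q).continuous continuous_const).inter
      ((toFinite _).isOpen_biInter fun χ hχ ↦ ?_)
    exact isOpen_ne_fun (differentiable_LFunction hχ).continuous continuous_const
  have hmem : ∀ s : ℂ, s ≠ 1 → (∀ χ : DirichletCharacter ℂ q, LFunction χ s ≠ 0) → s ∈ U := by
    refine fun s hs h ↦ ⟨?_, mem_iInter₂.mpr fun χ _ ↦ h χ⟩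
    rw [mem_ofPred_eq, LFunctionTrivChar₁, Function.update_of_ne hs]
    exact mul_ne_zero (sub_ne_zero.mpr hs) (h 1)
  have hU1 : {s : ℂ | 1 ≤ s.re} ⊆ U := fun s hs ↦ by
    rcases eq_or_ne s 1 with rfl | h
    · exact ⟨LFunctionTrivChar₁_apply_one_ne_zero q, mem_iInter₂.mpr fun χ hχ ↦
        LFunction_ne_zero_of_one_le_re χ (.inl hχ) (by simp)⟩
    · exact hmem s h fun χ ↦ LFunction_ne_zero_of_one_le_re χ (.inr h) hs
  have hd : DifferentiableOn ℂ (LFunctionResidueClassAux a) U := by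
    intro s hs
    refine DifferentiableAt.differentiableWithinAt ?_
    have h1 := (differentiable_LFunctionTrivChar₁ q)
    have hs2 := mem_iInter₂.mp hs.2
    refine .const_mul (.sub ?_ (.fun_sum fun χ hχ ↦ ?_)) _
    · exact ((h1.contDiff (n := 2)).differentiable_deriv_two s).neg.div (h1 s) hs.1
    · have hχ : χ ≠ 1 := by simpa using hχ
      have h2 := differentiable_LFunction hχ
      exact (((h2.contDiff (n := 2)).differentiable_deriv_two s).const_mul _).div (h2 s) (hs2 χ hχ)
  obtain ⟨A, M, hA, hA1, hM, h⟩ := exists_norm_LFunctionResidueClassAux_le a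
  exact exists_norm_deriv_deriv_dslope_le hU hd hU1 hA hA1 hM fun s h1 h2 h3 ↦
    ⟨hmem s (by rintro rfl; norm_num at h1) (h s h1 h2 h3).1, (h s h1 h2 h3).2⟩

/-- The Mellin transform of a function of subpolynomial growth supported on `(1, ∞)` can be
differentiated under the integral sign in the left half-plane. -/
theorem mellin_indicator_Ioi_one_hasDerivAt {E : ℝ → ℂ} (hE : Measurable E)
    (hB : ∀ ε : ℝ, 0 < ε → ∃ B, ∀ x, 1 < x → ‖E x‖ ≤ B * x ^ ε) {s : ℂ} (hs : s.re < 0) :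
    MellinConvergent ((Ioi 1).indicator E) s ∧
      HasDerivAt (mellin ((Ioi 1).indicator E))
        (mellin ((Ioi 1).indicator fun x ↦ (Real.log x : ℂ) * E x) s) s := by
  obtain ⟨B, hB⟩ := hB (-s.re / 2) (by linarith)
  have hbound : ∀ x : ℝ, ‖(Ioi 1).indicator E x‖ ≤ |B| * |x| ^ (-s.re / 2) := fun x ↦ by
    by_cases hx : 1 < x
    · simp only [mem_Ioi, hx, indicator_of_mem, abs_of_pos (zero_lt_one.trans hx)]
      refine (hB x hx).trans ?_
      gcongr
      exact le_abs_self B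
    · rw [indicator_of_notMem (by simpa using hx), norm_zero]
      positivity
  have hm : AEStronglyMeasurable ((Ioi 1).indicator E) volume :=
    (hE.indicator measurableSet_Ioi).aestronglyMeasurable
  have hcont : Continuous fun x : ℝ ↦ |B| * |x| ^ (-s.re / 2) :=
    continuous_const.mul (continuous_abs.rpow_const fun _ ↦ .inr (by linarith))
  have hloc : LocallyIntegrableOn ((Ioi 1).indicator E) (Ioi 0) :=
    (hcont.locallyIntegrable.mono hm (Eventually.of_forall fun x ↦
      (hbound x).trans (le_abs_self _))).locallyIntegrableOn _
  have htop : (Ioi 1).indicator E =O[atTop] (fun x : ℝ ↦ x ^ (-(s.re / 2))) := by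
    refine IsBigO.of_bound |B| ?_
    filter_upwards [eventually_gt_atTop 0] with x hx
    rw [Real.norm_of_nonneg (by positivity), ← neg_div]
    exact (hbound x).trans_eq (by rw [abs_of_pos hx])
  have hbot : (Ioi 1).indicator E =O[𝓝[>] 0] (fun x : ℝ ↦ x ^ (-(s.re - 1))) := by
    refine IsBigO.of_bound 0 ?_
    filter_upwards [mem_nhdsWithin_of_mem_nhds (Iio_mem_nhds zero_lt_one)] with x hx
    simp [not_lt.mpr (le_of_lt (mem_Iio.mp hx))]
  refine ⟨mellinConvergent_of_isBigO_rpow hloc htop (by linarith) hbot (by linarith), ?_⟩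
  have hind : (Ioi 1).indicator (fun x ↦ (Real.log x : ℂ) * E x) =
      fun x ↦ Real.log x • (Ioi 1).indicator E x := by
    ext x
    by_cases hx : 1 < x <;> simp [hx]
  rw [hind]
  exact (mellin_hasDerivAt_of_isBigO_rpow hloc htop (by linarith) hbot (by linarith)).2

theorem exists_norm_log_mul_le {E : ℝ → ℂ}
    (hB : ∀ ε : ℝ, 0 < ε → ∃ B, ∀ x, 1 < x → ‖E x‖ ≤ B * x ^ ε) :
    ∀ ε : ℝ, 0 < ε → ∃ B, ∀ x, 1 < x → ‖(Real.log x : ℂ) * E x‖ ≤ B * x ^ ε := fun ε hε ↦ by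
  obtain ⟨B, hB⟩ := hB (ε / 2) (by linarith)
  refine ⟨B / (ε / 2), fun x hx ↦ ?_⟩
  have hx0 : 0 < x := zero_lt_one.trans hx
  rw [norm_mul, norm_real, Real.norm_of_nonneg (Real.log_nonneg hx.le)]
  calc Real.log x * ‖E x‖ ≤ x ^ (ε / 2) / (ε / 2) * (B * x ^ (ε / 2)) := by
        gcongr
        · exact Real.log_le_rpow_div hx0.le (by linarith)
        · exact hB x hx
    _ = B / (ε / 2) * (x ^ (ε / 2) * x ^ (ε / 2)) := by ring
    _ = _ := by rw [← Real.rpow_add hx0, add_halves]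

/-- Second derivative of a Mellin transform on the left half-plane. -/
theorem mellin_indicator_Ioi_one_log_mul_log_mul {E : ℝ → ℂ} (hE : Measurable E)
    (hB : ∀ ε : ℝ, 0 < ε → ∃ B, ∀ x, 1 < x → ‖E x‖ ≤ B * x ^ ε) {Q : ℂ → ℂ}
    (hQ : ∀ s : ℂ, s.re < 0 → mellin ((Ioi 1).indicator E) s = Q (1 - s)) {s : ℂ}
    (hs : s.re < 0) :
    MellinConvergent ((Ioi 1).indicator fun x ↦ (Real.log x : ℂ) * ((Real.log x : ℂ) * E x)) s ∧
      mellin ((Ioi 1).indicator fun x ↦ (Real.log x : ℂ) * ((Real.log x : ℂ) * E x)) s =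
        deriv (deriv Q) (1 - s) := by
  have hlog : Measurable fun x : ℝ ↦ (Real.log x : ℂ) :=
    measurable_ofReal.comp Real.measurable_log
  have hopen : IsOpen {s : ℂ | s.re < 0} := isOpen_lt continuous_re continuous_const
  have h1 : ∀ s : ℂ, s.re < 0 →
      mellin ((Ioi 1).indicator fun x ↦ (Real.log x : ℂ) * E x) s = -deriv Q (1 - s) := by
    intro s hs
    rw [← deriv_comp_const_sub, ← (mellin_indicator_Ioi_one_hasDerivAt hE hB hs).2.deriv]
    refine EventuallyEq.deriv_eq ?_
    filter_upwards [hopen.mem_nhds hs] with z hz using hQ z hz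
  have hB1 := exists_norm_log_mul_le hB
  have hB2 := exists_norm_log_mul_le hB1
  refine ⟨(mellin_indicator_Ioi_one_hasDerivAt
    (E := fun x ↦ (Real.log x : ℂ) * ((Real.log x : ℂ) * E x))
      (hlog.mul (hlog.mul hE)) hB2 hs).1, ?_⟩
  rw [← (mellin_indicator_Ioi_one_hasDerivAt (E := fun x ↦ (Real.log x : ℂ) * E x)
    (hlog.mul hE) hB1 hs).2.deriv]
  rw [← neg_neg (deriv (deriv Q) (1 - s)), ← deriv_comp_const_sub, ← deriv.fun_neg]
  refine EventuallyEq.deriv_eq ?_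
  filter_upwards [hopen.mem_nhds hs] with z hz using h1 z hz

theorem mellin_indicator_Ioi_one_one {s : ℂ} (hs : s.re < 0) :
    mellin ((Ioi (1 : ℝ)).indicator fun _ ↦ (1 : ℂ)) s = -1 / s := by
  have : mellin ((Ioi (1 : ℝ)).indicator fun _ ↦ (1 : ℂ)) s =
      ∫ t in Ioi (1 : ℝ), (t : ℂ) ^ (s - 1) := by
    rw [mellin, ← integral_indicator measurableSet_Ioi, ← integral_indicator measurableSet_Ioi]
    congr 1
    ext t
    by_cases ht : 1 < t
    · simp [ht, zero_lt_one.trans ht]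
    · simp [ht]
  rw [this, integral_Ioi_cpow_of_lt (by rw [sub_re, one_re]; linarith) one_pos]
  simp

theorem mellin_indicator_Ioi_one_log {s : ℂ} (hs : s.re < 0) :
    mellin ((Ioi (1 : ℝ)).indicator fun x ↦ (Real.log x : ℂ)) s = 1 / s ^ 2 := by
  have h := (mellin_indicator_Ioi_one_hasDerivAt (E := fun _ ↦ 1) measurable_const
    (fun ε hε ↦ ⟨1, fun x hx ↦ by simpa using Real.one_le_rpow hx.le hε.le⟩) hs).2
  have h : HasDerivAt (mellin ((Ioi (1 : ℝ)).indicator fun _ ↦ (1 : ℂ)))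
      (mellin ((Ioi (1 : ℝ)).indicator fun x ↦ (Real.log x : ℂ)) s) s := by
    simpa only [mul_one] using h
  have hs0 : s ≠ 0 := by rintro rfl; simp at hs
  have hopen : IsOpen {s : ℂ | s.re < 0} := isOpen_lt continuous_re continuous_const
  refine h.unique (HasDerivAt.congr_of_eventuallyEq (f := fun s ↦ -1 / s) ?_ ?_)
  · exact ((hasDerivAt_const s (-1 : ℂ)).div (hasDerivAt_id s) hs0).congr_deriv (by simp)
  · filter_upwards [hopen.mem_nhds hs] with z hz using mellin_indicator_Ioi_one_one hz

/-- Mellin transform of the remainder in an asymptotic formula for partial sums. -/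
theorem mellin_sum_sub_log_sub_const {f : ℕ → ℝ} (hf : ∀ n, 0 ≤ f n)
    (hsum : ∀ ε : ℝ, 0 < ε → ∃ B, ∀ x : ℝ, 1 < x → ∑ k ∈ Finset.Icc 1 ⌊x⌋₊, f k ≤ B * x ^ ε)
    {κ c : ℝ} {Q : ℂ → ℂ}
    (hQ : ∀ s : ℂ, 0 < s.re → LSeries (fun n ↦ (f n : ℂ)) s = κ / s + c + s * Q (1 + s)) {s : ℂ}
    (hs : s.re < 0) :
    mellin ((Ioi 1).indicator fun x ↦
      ((∑ k ∈ Finset.Icc 1 ⌊x⌋₊, f k - κ * Real.log x - c : ℝ) : ℂ)) s = Q (1 - s) := by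
  have hO : ∀ r : ℝ, 0 < r → (fun n ↦ ∑ k ∈ Finset.Icc 1 n, f k) =O[atTop] fun n ↦ (n : ℝ) ^ r := by
    intro r hr
    obtain ⟨B, hB⟩ := hsum r hr
    refine IsBigO.of_bound B ?_
    filter_upwards [eventually_gt_atTop 1] with n hn
    rw [Real.norm_of_nonneg (Finset.sum_nonneg fun _ _ ↦ hf _),
      Real.norm_of_nonneg (by positivity)]
    simpa using hB n (by exact_mod_cast hn)
  have h1 := LSeries_eq_mul_integral_of_nonneg f (r := -s.re / 2) (s := -s) (by linarith)
    (by rw [neg_re]; linarith) (hO _ (by linarith)) hf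
  have hm : mellin ((Ioi 1).indicator fun x ↦ ∑ k ∈ Finset.Icc 1 ⌊x⌋₊, (f k : ℂ)) s =
      ∫ t in Ioi (1 : ℝ), (∑ k ∈ Finset.Icc 1 ⌊t⌋₊, (f k : ℂ)) * t ^ (-(-s + 1)) := by
    rw [mellin, ← integral_indicator measurableSet_Ioi, ← integral_indicator measurableSet_Ioi]
    congr 1
    ext t
    by_cases ht : 1 < t
    · simp only [mem_Ioi, zero_lt_one.trans ht, indicator_of_mem, ht, smul_eq_mul]
      rw [mul_comm, show -(-s + 1) = s - 1 by ring]
    · simp [ht]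
  rw [← hm, hQ _ (by simpa using hs)] at h1
  have hS := (mellin_indicator_Ioi_one_hasDerivAt (E := fun x ↦
    ∑ k ∈ Finset.Icc 1 ⌊x⌋₊, (f k : ℂ)) (measurable_sum_Icc_floor _) (fun ε hε ↦ by
      obtain ⟨B, hB⟩ := hsum ε hε
      refine ⟨B, fun x hx ↦ ?_⟩
      rw [← ofReal_sum, norm_real, Real.norm_of_nonneg (Finset.sum_nonneg fun _ _ ↦ hf _)]
      exact hB x hx) hs).1
  have h1' : ∀ ε : ℝ, 0 < ε → ∃ B, ∀ x : ℝ, 1 < x → ‖(1 : ℂ)‖ ≤ B * x ^ ε := fun ε hε ↦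
    ⟨1, fun x hx ↦ by simpa using Real.one_le_rpow hx.le hε.le⟩
  have hone := (mellin_indicator_Ioi_one_hasDerivAt (E := fun _ ↦ 1) measurable_const h1' hs).1
  have hlog := (mellin_indicator_Ioi_one_hasDerivAt (E := fun x ↦ (Real.log x : ℂ) * 1)
    ((measurable_ofReal.comp Real.measurable_log).mul_const _) (exists_norm_log_mul_le h1') hs).1
  simp only [mul_one] at hlog
  have hsplit : ((Ioi 1).indicator fun x ↦
      ((∑ k ∈ Finset.Icc 1 ⌊x⌋₊, f k - κ * Real.log x - c : ℝ) : ℂ)) = fun x ↦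
      ((Ioi 1).indicator (fun x ↦ ∑ k ∈ Finset.Icc 1 ⌊x⌋₊, (f k : ℂ)) x -
        (κ : ℂ) • (Ioi 1).indicator (fun x ↦ (Real.log x : ℂ)) x) -
        (c : ℂ) • (Ioi (1 : ℝ)).indicator (fun _ ↦ (1 : ℂ)) x := by
    ext x
    by_cases hx : 1 < x <;> simp [hx]
  have h2 := (hasMellin_sub hS (hlog.const_smul (κ : ℂ)))
  have h3 := (hasMellin_sub h2.1 (hone.const_smul (c : ℂ))).2
  have hs0 : s ≠ 0 := by rintro rfl; simp at hs
  rw [hsplit, h3, h2.2, mellin_const_smul, mellin_const_smul, mellin_indicator_Ioi_one_one hs,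
    mellin_indicator_Ioi_one_log hs, smul_eq_mul, smul_eq_mul]
  rw [← sub_eq_add_neg] at h1
  field_simp at h1 ⊢
  linear_combination h1

/-- A bound on the Fourier transform of `g` controls the integrals of `g` against all translates and
dilates of the Fourier transform of an integrable function. -/
theorem norm_integral_mul_fourier_comp_le {g ψ : ℝ → ℂ} (hg : Integrable g) (hψ : Integrable ψ)
    {K : ℝ} (hK : ∀ ξ, ‖𝓕 g ξ‖ ≤ K) {δ : ℝ} (hδ : 0 < δ) (y : ℝ) :
    ‖∫ u, g u * 𝓕 ψ ((u - y) / δ)‖ ≤ K * ∫ ξ, ‖ψ ξ‖ := by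
  set Ψ : ℝ → ℂ := fun ξ ↦ δ * cexp (2 * Real.pi * ξ * y * I) * ψ (δ * ξ) with hΨ
  have hexp : ∀ x : ℝ, ‖cexp (2 * Real.pi * x * y * I)‖ = 1 := fun x ↦ by
    rw [show (2 * Real.pi * x * y * I : ℂ) = ((2 * Real.pi * x * y : ℝ) : ℂ) * I by push_cast; rfl]
    exact norm_exp_ofReal_mul_I _
  have hnorm : ∀ ξ, ‖Ψ ξ‖ = δ * ‖ψ (δ * ξ)‖ := fun ξ ↦ by
    rw [hΨ, norm_mul, norm_mul, hexp, mul_one, norm_real, Real.norm_of_nonneg hδ.le]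
  have hcomp : Integrable fun ξ ↦ ψ (δ * ξ) := hψ.comp_mul_left' hδ.ne'
  have hΨi : Integrable Ψ := by
    refine hcomp.bdd_mul (c := δ) (Continuous.aestronglyMeasurable (by fun_prop)) ?_
    refine Eventually.of_forall fun ξ ↦ ?_
    rw [norm_mul, hexp, mul_one, norm_real, Real.norm_of_nonneg hδ.le]
  have hF : ∀ u, 𝓕 Ψ u = 𝓕 ψ ((u - y) / δ) := fun u ↦ by
    rw [Real.fourier_real_eq_integral_exp_smul, Real.fourier_real_eq_integral_exp_smul]
    have := Measure.integral_comp_mul_left (fun η : ℝ ↦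
      cexp (↑(-2 * Real.pi * η * ((u - y) / δ)) * I) • ψ η) δ
    have hδ0 : (δ : ℂ) ≠ 0 := ofReal_ne_zero.mpr hδ.ne'
    calc _ = ∫ ξ : ℝ, δ • (cexp (↑(-2 * Real.pi * (δ * ξ) * ((u - y) / δ)) * I) • ψ (δ * ξ)) := by
          congr 1
          ext ξ
          simp only [hΨ, smul_eq_mul, real_smul]
          have hadd : cexp (↑(-2 * Real.pi * (δ * ξ) * ((u - y) / δ)) * I) =
              cexp (↑(-2 * Real.pi * ξ * u) * I) * cexp (2 * Real.pi * ξ * y * I) := by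
            rw [← Complex.exp_add]
            congr 1
            push_cast
            field_simp
            ring
          rw [hadd]
          ring
      _ = _ := by
          rw [integral_smul, this, smul_smul, abs_of_pos (inv_pos.mpr hδ),
            mul_inv_cancel₀ hδ.ne', one_smul]
  have hflip : ∫ ξ, 𝓕 g ξ * Ψ ξ = ∫ u, g u * 𝓕 Ψ u := by
    simpa using! VectorFourier.integral_fourierIntegral_smul_eq_flip (L := innerₗ ℝ)
      Real.continuous_fourierChar continuous_inner hg hΨi
  simp_rw [← hF]
  rw [← hflip, ← integral_const_mul]
  calc ‖∫ ξ, 𝓕 g ξ * Ψ ξ‖ ≤ ∫ ξ, K * ‖Ψ ξ‖ := by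
        refine norm_integral_le_of_norm_le (hΨi.norm.const_mul K) (Eventually.of_forall fun ξ ↦ ?_)
        rw [norm_mul]
        gcongr
        exact hK ξ
    _ = ∫ ξ, K * ‖ψ ξ‖ := by
        rw [integral_const_mul, integral_const_mul]
        congr 1
        simp_rw [hnorm]
        rw [integral_const_mul, Measure.integral_comp_mul_left (fun ξ ↦ ‖ψ ξ‖), smul_eq_mul,
          abs_of_pos (inv_pos.mpr hδ), mul_inv_cancel_left₀ hδ.ne']

theorem MellinConvergent.integrable_exp_smul {F : ℝ → ℂ} {s : ℂ} (h : MellinConvergent F s) :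
    Integrable fun u : ℝ ↦ Real.exp (-s.re * u) • F (Real.exp (-u)) := by
  have himg : (fun u : ℝ ↦ Real.exp (-u)) '' univ = Ioi 0 := by
    rw [show (fun u : ℝ ↦ Real.exp (-u)) = Real.exp ∘ Neg.neg from rfl, image_comp,
      image_univ_of_surjective neg_surjective, image_univ, Real.range_exp]
  have hder : ∀ u ∈ (univ : Set ℝ),
      HasDerivWithinAt (fun u : ℝ ↦ Real.exp (-u)) (-Real.exp (-u)) univ u := fun u _ ↦ by
    simpa using ((hasDerivAt_neg u).exp).hasDerivWithinAt (s := univ)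
  have hinj : InjOn (fun u : ℝ ↦ Real.exp (-u)) univ :=
    (Real.exp_injective.comp neg_injective).injOn
  have h1 := h
  rw [MellinConvergent, ← himg,
    integrableOn_image_iff_integrableOn_abs_deriv_smul MeasurableSet.univ hder hinj,
    integrableOn_univ] at h1
  have h2 := h1.bdd_mul (c := 1) (f := fun u : ℝ ↦ cexp (s.im * u * I))
    (Continuous.aestronglyMeasurable (by fun_prop)) (Eventually.of_forall fun u ↦ by
      rw [← ofReal_mul, norm_exp_ofReal_mul_I])
  refine h2.congr (Eventually.of_forall fun u ↦ ?_)
  have h3 : ((Real.exp (-u) : ℝ) : ℂ) ^ (s - 1) = cexp (-u * (s - 1)) := by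
    rw [cpow_def_of_ne_zero (ofReal_ne_zero.mpr (Real.exp_ne_zero _)), ← ofReal_log
      (Real.exp_pos _).le, Real.log_exp, ofReal_neg]
  simp only [abs_neg, abs_of_pos (Real.exp_pos _), h3, smul_eq_mul, real_smul]
  rw [ofReal_exp, ofReal_exp, ← mul_assoc, ← mul_assoc, ← Complex.exp_add, ← Complex.exp_add]
  congr 2
  push_cast
  linear_combination (u : ℂ) * re_add_im s

/-- A smooth cut-off function at scale one. -/
theorem exists_fourier_eq_bump : ∃ (φ : ℝ → ℝ) (ψ : ℝ → ℂ), Integrable ψ ∧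
    (∀ u, 𝓕 ψ u = φ u) ∧ Continuous φ ∧ (∀ u, 0 ≤ φ u) ∧ (∀ u, φ u ≤ 1) ∧
    (∀ u, 1 ≤ |u| → φ u = 0) ∧ ∀ u, |u| ≤ 1 / 2 → φ u = 1 := by
  let φ : ContDiffBump (0 : ℝ) := ⟨1 / 2, 1, by norm_num, by norm_num⟩
  have hc : HasCompactSupport fun u : ℝ ↦ (φ u : ℂ) :=
    φ.hasCompactSupport.comp_left (g := fun x : ℝ ↦ (x : ℂ)) ofReal_zero
  have hd : ContDiff ℝ ∞ fun u : ℝ ↦ (φ u : ℂ) := ofRealCLM.contDiff.comp φ.contDiff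
  let ψ : 𝓢(ℝ, ℂ) := 𝓕⁻ (hc.toSchwartzMap hd)
  refine ⟨φ, ψ, ψ.integrable, fun u ↦ ?_, φ.continuous,
    fun u ↦ φ.nonneg, fun u ↦ φ.le_one, fun u hu ↦ ?_, fun u hu ↦ ?_⟩
  · rw [← SchwartzMap.fourier_coe, FourierTransform.fourier_fourierInv_eq]
    rfl
  · exact φ.zero_of_le_dist (by simpa [Real.dist_eq] using hu)
  · exact φ.one_of_mem_closedBall (by simpa [Real.dist_eq, φ] using hu)

/-- A lower bound on a short window, extracted from a smoothed average over this window. -/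
theorem le_div_of_integral_bump_le {h φ : ℝ → ℝ} (hφ0 : ∀ u, 0 ≤ φ u)
    (hφs : ∀ u, 1 ≤ |u| → φ u = 0) (hφ1 : ∀ u, |u| ≤ 1 / 2 → φ u = 1) {v y m K : ℝ} (hv : 4 ≤ v)
    (hy : |y + v| ≤ 1 / v) (hm : ∀ u, |u - y| ≤ 1 / v → m ≤ h u)
    (hi : Integrable fun u ↦ Real.exp (1 / v * u) * (Iio 0).indicator (fun u ↦ u ^ 2 * h u) u *
      φ ((u - y) / (1 / v)))
    (hK : ∫ u, Real.exp (1 / v * u) * (Iio 0).indicator (fun u ↦ u ^ 2 * h u) u *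
      φ ((u - y) / (1 / v)) ≤ K) : m ≤ 4 * Real.exp 2 * |K| / v := by
  rcases le_or_gt m 0 with hm0 | hm0
  · exact hm0.trans (by positivity)
  have hv0 : 0 < v := by linarith
  have hδ0 : 0 < 1 / v := by positivity
  have hδv : 1 / v * v = 1 := by field_simp
  set δ := 1 / v with hδ
  have hδ1 : δ ≤ 1 / 4 := by rw [hδ]; gcongr
  have hyv := abs_le.mp hy
  have hwin : ∀ u, |u - y| ≤ δ → u ≤ -v / 2 ∧ -2 * v ≤ u := fun u hu ↦ by
    have := abs_le.mp hu
    constructor <;> linarith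
  set k : ℝ := Real.exp (-2) * (v / 2) ^ 2 * m
  have hk : k * δ ≤ K := by
    have h1 : ∫ u, (Icc (y - δ / 2) (y + δ / 2)).indicator (fun _ ↦ k) u = k * δ := by
      rw [integral_indicator measurableSet_Icc, setIntegral_const, Real.volume_real_Icc_of_le
        (by linarith), smul_eq_mul]
      ring
    rw [← h1]
    refine (integral_mono_ae ?_ hi (Eventually.of_forall fun u ↦ ?_)).trans hK
    · exact (integrable_indicator_iff measurableSet_Icc).mpr (integrableOn_const (by simp))
    by_cases hu : |u - y| ≤ δ
    · obtain ⟨hu1, hu2⟩ := hwin u hu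
      have hu0 : u < 0 := by linarith
      have hhu := hm u hu
      have hpos : 0 ≤ h u := hm0.le.trans hhu
      simp only [mem_Iio, hu0, indicator_of_mem]
      by_cases hu' : u ∈ Icc (y - δ / 2) (y + δ / 2)
      · have : φ ((u - y) / δ) = 1 := by
          refine hφ1 _ ?_
          rw [abs_div, abs_of_pos hδ0, div_le_iff₀ hδ0, abs_le]
          constructor <;> linarith [hu'.1, hu'.2]
        rw [indicator_of_mem hu', this, mul_one, ← mul_assoc]
        dsimp only [k]
        have he : -2 ≤ δ * u := by nlinarith
        have hsq : (v / 2) ^ 2 ≤ u ^ 2 := by nlinarith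
        gcongr
      · rw [indicator_of_notMem hu']
        have := hφ0 ((u - y) / δ)
        positivity
    · have h2 : φ ((u - y) / δ) = 0 := by
        refine hφs _ ?_
        rw [abs_div, abs_of_pos hδ0, one_le_div hδ0]
        exact (not_le.mp hu).le
      beta_reduce
      rw [h2, mul_zero, indicator_of_notMem]
      intro hu'
      refine hu (abs_le.mpr ?_)
      constructor <;> linarith [hu'.1, hu'.2]
  rw [le_div_iff₀ hv0]
  have h2 : k * δ = Real.exp (-2) * (m * v) / 4 := by
    simp only [k, hδ]
    field_simp
    norm_num
  rw [h2, Real.exp_neg] at hk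
  have h3 : (Real.exp 2)⁻¹ * (m * v) / 4 ≤ |K| := hk.trans (le_abs_self K)
  rw [div_le_iff₀ (by norm_num), inv_mul_le_iff₀ (Real.exp_pos 2)] at h3
  linarith

/-- **A Tauberian theorem with remainder.** If the Dirichlet series of a nonnegative sequence is
`κ / s + c + s * Q (1 + s)` with the second derivative of `Q` bounded near the line `re s = 1`,
then the partial sums at `x` are `κ log x + c + O(1 / log x)`. -/
theorem exists_abs_sum_sub_log_sub_le {f : ℕ → ℝ} (hf : ∀ n, 0 ≤ f n)
    (hsum : ∀ ε : ℝ, 0 < ε → ∃ B, ∀ x : ℝ, 1 < x → ∑ k ∈ Finset.Icc 1 ⌊x⌋₊, f k ≤ B * x ^ ε)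
    {κ c : ℝ} (hκ : 0 ≤ κ) {Q : ℂ → ℂ}
    (hQ : ∀ s : ℂ, 0 < s.re → LSeries (fun n ↦ (f n : ℂ)) s = κ / s + c + s * Q (1 + s))
    {K η : ℝ} (hη : 0 < η)
    (hK : ∀ s : ℂ, 1 ≤ s.re → s.re ≤ 1 + η → ‖deriv (deriv Q) s‖ ≤ K) :
    ∃ C, ∀ᶠ x in atTop,
      |∑ k ∈ Finset.Icc 1 ⌊x⌋₊, f k - κ * Real.log x - c| ≤ C / Real.log x := by
  obtain ⟨φ, ψ, hψ, hφψ, hφc, hφ0, hφle, hφs, hφ1⟩ := exists_fourier_eq_bump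
  set S : ℝ → ℝ := fun x ↦ ∑ k ∈ Finset.Icc 1 ⌊x⌋₊, f k with hS
  set R : ℝ → ℝ := fun x ↦ S x - κ * Real.log x - c with hR
  have hSm : Measurable S :=
    (measurable_from_nat (f := fun n : ℕ ↦ ∑ k ∈ Finset.Icc 1 n, f k)).comp Nat.measurable_floor
  have hSmono : Monotone S := fun x y hxy ↦
    Finset.sum_le_sum_of_subset_of_nonneg (Finset.Icc_subset_Icc_right (Nat.floor_mono hxy))
      fun _ _ _ ↦ hf _
  have hRm : Measurable fun x ↦ (R x : ℂ) :=
    measurable_ofReal.comp ((hSm.sub (Real.measurable_log.const_mul κ)).sub_const c)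
  have hRB : ∀ ε : ℝ, 0 < ε → ∃ B, ∀ x, 1 < x → ‖(R x : ℂ)‖ ≤ B * x ^ ε := fun ε hε ↦ by
    obtain ⟨B, hB⟩ := hsum ε hε
    refine ⟨B + κ / ε + |c|, fun x hx ↦ ?_⟩
    have hx0 : 0 < x := zero_lt_one.trans hx
    have hS0 : 0 ≤ S x := Finset.sum_nonneg fun _ _ ↦ hf _
    have hlog := Real.log_nonneg hx.le
    have hl := Real.log_le_rpow_div hx0.le hε
    have hone := Real.one_le_rpow hx.le hε.le
    rw [norm_real, Real.norm_eq_abs]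
    calc |S x - κ * Real.log x - c| ≤ |S x| + |κ * Real.log x| + |c| :=
          (abs_sub _ _).trans (by gcongr; exact abs_sub _ _)
      _ = S x + κ * Real.log x + |c| := by
          rw [abs_of_nonneg hS0, abs_of_nonneg (by positivity)]
      _ ≤ B * x ^ ε + κ * (x ^ ε / ε) + |c| * x ^ ε := by
          gcongr
          · exact hB x hx
          · exact le_mul_of_one_le_right (abs_nonneg c) hone
      _ = _ := by ring
  have hmellin := fun s hs ↦ mellin_indicator_Ioi_one_log_mul_log_mul hRm hRB (s := s)
    (fun s hs ↦ mellin_sum_sub_log_sub_const hf hsum hQ hs) hs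
  set F := (Ioi 1).indicator fun x ↦ (Real.log x : ℂ) * ((Real.log x : ℂ) * (R x : ℂ)) with hF
  set K1 := K * ∫ ξ, ‖ψ ξ‖
  have hsmooth : ∀ v, 4 ≤ v → 1 / v ≤ η → ∀ y,
      Integrable (fun u ↦ Real.exp (1 / v * u) *
        (Iio 0).indicator (fun u ↦ u ^ 2 * R (Real.exp (-u))) u * φ ((u - y) / (1 / v))) ∧
      |∫ u, Real.exp (1 / v * u) *
        (Iio 0).indicator (fun u ↦ u ^ 2 * R (Real.exp (-u))) u * φ ((u - y) / (1 / v))| ≤ K1 := by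
    intro v hv hvη y
    have hv0 : 0 < 1 / v := by positivity
    have hg := (hmellin (-(1 / v : ℝ)) (by rw [neg_re, ofReal_re]; linarith)).1.integrable_exp_smul
    rw [neg_re, ofReal_re, neg_neg] at hg
    have hgF : ∀ ξ, ‖𝓕 (fun u : ℝ ↦ Real.exp (1 / v * u) • F (Real.exp (-u))) ξ‖ ≤ K := fun ξ ↦ by
      set s : ℂ := ⟨-(1 / v), 2 * Real.pi * ξ⟩ with hs
      have h1 := mellin_eq_fourier F (s := s)
      have h2 : s.im / (2 * Real.pi) = ξ := by simp only [hs]; field_simp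
      rw [h2, show -s.re = 1 / v by simp only [hs, neg_neg]] at h1
      rw [← h1, (hmellin s (by simp only [hs]; linarith)).2]
      refine hK _ ?_ ?_ <;> simp only [sub_re, one_re, hs] <;> linarith
    have hb := norm_integral_mul_fourier_comp_le hg hψ hgF hv0 y
    have hbi : Integrable fun u : ℝ ↦ Real.exp (1 / v * u) • F (Real.exp (-u)) *
        𝓕 ψ ((u - y) / (1 / v)) := by
      simp_rw [hφψ]
      refine hg.mul_bdd (c := 1) (Continuous.aestronglyMeasurable (by fun_prop))
        (Eventually.of_forall fun u ↦ ?_)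
      rw [norm_real, Real.norm_of_nonneg (hφ0 _)]
      exact hφle _
    have heq : ∀ u : ℝ, Real.exp (1 / v * u) • F (Real.exp (-u)) * 𝓕 ψ ((u - y) / (1 / v)) =
        ((Real.exp (1 / v * u) * (Iio 0).indicator (fun u ↦ u ^ 2 * R (Real.exp (-u))) u *
          φ ((u - y) / (1 / v)) : ℝ) : ℂ) := fun u ↦ by
      rw [hφψ, hF]
      by_cases hu : u < 0
      · have : 1 < Real.exp (-u) := by simpa using hu
        simp only [mem_Ioi, this, indicator_of_mem, mem_Iio, hu, Real.log_exp, real_smul]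
        push_cast
        ring
      · have : ¬ 1 < Real.exp (-u) := by simpa using hu
        simp [this, hu]
    simp_rw [heq] at hb hbi
    rw [integral_complex_ofReal, norm_real, Real.norm_eq_abs] at hb
    exact ⟨hbi.re, hb⟩
  refine ⟨2 * κ + 4 * Real.exp 2 * |K1|, ?_⟩
  filter_upwards [Real.tendsto_log_atTop.eventually_ge_atTop (max 4 (1 / η)),
    eventually_gt_atTop 0] with x hx hx0
  set v := Real.log x with hv
  have hv4 : 4 ≤ v := (le_max_left _ _).trans hx
  have hv0 : 0 < v := by linarith
  have hvη : 1 / v ≤ η := by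
    rw [div_le_comm₀ hv0 hη]
    exact (le_max_right _ _).trans hx
  have hxv : x = Real.exp v := (Real.exp_log hx0).symm
  have hRx : R x = S x - κ * v - c := rfl
  have hRu : ∀ u, R (Real.exp (-u)) = S (Real.exp (-u)) + κ * u - c := fun u ↦ by
    simp only [hR, Real.log_exp]; ring
  have hδ0 : 0 < 1 / v := by positivity
  have hbd : (2 * κ + 4 * Real.exp 2 * |K1|) / v = 2 * κ * (1 / v) + 4 * Real.exp 2 * |K1| / v := by
    ring
  rw [← hRx, hbd, abs_le]
  constructor
  · obtain ⟨hi, hb⟩ := hsmooth v hv4 hvη (-v + 1 / v)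
    have key := le_div_of_integral_bump_le (h := fun u ↦ -R (Real.exp (-u))) (v := v)
      (y := -v + 1 / v) (m := -R x - 2 * κ * (1 / v)) (K := K1) hφ0 hφs hφ1 hv4
      (by rw [neg_add_eq_sub, sub_add_cancel, abs_of_pos hδ0]) ?_ ?_ ?_
    · linarith
    · intro u hu
      have hu := abs_le.mp hu
      have hSu : S (Real.exp (-u)) ≤ S x := by
        rw [hxv]; exact hSmono (Real.exp_le_exp.mpr (by linarith))
      rw [hRu, hRx]
      nlinarith [mul_le_mul_of_nonneg_left (show u ≤ -v + 2 * (1 / v) by linarith) hκ]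
    · refine hi.neg.congr (Eventually.of_forall fun u ↦ ?_)
      by_cases hu : u < 0 <;> simp [hu]
    · rw [← abs_neg, ← integral_neg] at hb
      refine (le_abs_self _).trans ((le_of_eq ?_).trans hb)
      congr 2
      ext u
      by_cases hu : u < 0 <;> simp [hu]
  · obtain ⟨hi, hb⟩ := hsmooth v hv4 hvη (-v - 1 / v)
    have key := le_div_of_integral_bump_le (h := fun u ↦ R (Real.exp (-u))) (v := v)
      (y := -v - 1 / v) (m := R x - 2 * κ * (1 / v)) (K := K1) hφ0 hφs hφ1 hv4
      (by rw [show -v - 1 / v + v = -(1 / v) by ring, abs_neg, abs_of_pos hδ0]) ?_ hi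
      ((le_abs_self _).trans hb)
    · linarith
    · intro u hu
      have hu := abs_le.mp hu
      have hSu : S x ≤ S (Real.exp (-u)) := by
        rw [hxv]; exact hSmono (Real.exp_le_exp.mpr (by linarith))
      rw [hRu, hRx]
      nlinarith [mul_le_mul_of_nonneg_left (show -v - 2 * (1 / v) ≤ u by linarith) hκ]

/-- If `∑ |d n| log n` converges, the series `∑ d n` converges at rate `O(1 / log N)`. -/
theorem exists_abs_sum_range_sub_le_div_log {d : ℕ → ℝ} (hd : Summable fun n ↦ |d n| * Real.log n) :
    ∃ C₁ C : ℝ, ∀ N : ℕ, 2 ≤ N →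
      |∑ n ∈ Finset.range (N + 1), d n - C₁| ≤ C / Real.log N := by
  have hlog : ∀ n : ℕ, 0 ≤ Real.log n := Real.log_natCast_nonneg
  have hs : Summable d := by
    refine Summable.of_norm_bounded_eventually_nat hd ?_
    filter_upwards [eventually_ge_atTop 3] with n hn
    have h3 : (3 : ℝ) ≤ n := by exact_mod_cast hn
    have : 1 ≤ Real.log n := by
      rw [Real.le_log_iff_exp_le (by linarith)]
      exact (Real.exp_one_lt_d9.le.trans (by norm_num)).trans h3
    exact le_mul_of_one_le_right (abs_nonneg _) this
  refine ⟨∑' n, d n, ∑' n, |d n| * Real.log n, fun N hN ↦ ?_⟩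
  have hN1 : (1 : ℝ) < N := by exact_mod_cast hN
  have hpos : 0 < Real.log N := Real.log_pos hN1
  have hshift := (summable_nat_add_iff (N + 1)).mpr hd
  rw [abs_sub_comm, ← hs.sum_add_tsum_nat_add (N + 1), add_sub_cancel_left, le_div_iff₀ hpos]
  have hle : ∀ n, ‖d (n + (N + 1))‖ ≤
      |d (n + (N + 1))| * Real.log ((n + (N + 1) : ℕ) : ℝ) / Real.log N := fun n ↦ by
    rw [le_div_iff₀ hpos, Real.norm_eq_abs]
    gcongr
    omega
  have h1 := tsum_of_norm_bounded (hshift.div_const (Real.log N)).hasSum hle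
  rw [tsum_div_const, le_div_iff₀ hpos, Real.norm_eq_abs] at h1
  refine h1.trans ?_
  rw [← hd.sum_add_tsum_nat_add (N + 1)]
  exact le_add_of_nonneg_left (Finset.sum_nonneg fun n _ ↦ mul_nonneg (abs_nonneg _) (hlog n))

/-- The proper prime powers contribute a convergent series to `∑ Λ n log n / n`. -/
theorem summable_vonMangoldt_non_primes_mul_log_div :
    Summable fun n : ℕ ↦
      (if n.Prime then 0 else ArithmeticFunction.vonMangoldt n) * Real.log n / n := by
  set g : ℕ → ℝ := fun n ↦ if n.Prime then 0 else ArithmeticFunction.vonMangoldt n with hg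
  have hg0 : ∀ n, 0 ≤ g n := fun n ↦ by
    simp only [hg]; split_ifs; exacts [le_rfl, ArithmeticFunction.vonMangoldt_nonneg]
  obtain ⟨C, hC⟩ := Chebyshev.psi_sub_theta_le_mul_sqrt
  have hsum : ∀ N : ℕ, ∑ n ∈ Finset.Icc 1 N, g n = Chebyshev.psi N - Chebyshev.theta N := fun N ↦ by
    rw [Chebyshev.psi, Chebyshev.theta, Nat.floor_natCast, Finset.sum_filter,
      ← Finset.sum_sub_distrib, ← Finset.Icc_add_one_left_eq_Ioc, zero_add]
    refine Finset.sum_congr rfl fun n _ ↦ ?_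
    simp only [hg]
    split_ifs with hn
    · rw [ArithmeticFunction.vonMangoldt_apply_prime hn, sub_self]
    · rw [sub_zero]
  have hO : (fun N : ℕ ↦ ∑ n ∈ Finset.Icc 1 N, g n) =O[atTop] fun N ↦ (N : ℝ) ^ (1 / 2 : ℝ) := by
    refine IsBigO.of_bound C (Eventually.of_forall fun N ↦ ?_)
    rw [Real.norm_of_nonneg (Finset.sum_nonneg fun n _ ↦ hg0 n),
      Real.norm_of_nonneg (by positivity),
      ← Real.sqrt_eq_rpow, hsum]
    exact hC _
  have hL := (LSeriesSummable_of_sum_norm_bigO_and_nonneg hO hg0 (by norm_num)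
    (s := (3 / 4 : ℝ)) (by rw [ofReal_re]; norm_num)).norm
  refine Summable.of_nonneg_of_le (fun n ↦ ?_) (fun n ↦ ?_) (hL.mul_left 4)
  · have := hg0 n
    have := Real.log_natCast_nonneg n
    positivity
  rcases n.eq_zero_or_pos with rfl | hn
  · simp
  have hn0 : (0 : ℝ) < n := by exact_mod_cast hn
  rw [LSeries.norm_term_eq, if_neg hn.ne', ofReal_re, norm_real, Real.norm_of_nonneg (hg0 n)]
  have hl := Real.log_le_rpow_div hn0.le (show (0 : ℝ) < 1 / 4 by norm_num)
  have hsplit : (n : ℝ) = (n : ℝ) ^ (1 / 4 : ℝ) * (n : ℝ) ^ (3 / 4 : ℝ) := by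
    rw [← Real.rpow_add hn0]; norm_num
  calc g n * Real.log n / n ≤ g n * ((n : ℝ) ^ (1 / 4 : ℝ) / (1 / 4)) / n := by
        have := hg0 n
        gcongr
    _ = g n * ((n : ℝ) ^ (1 / 4 : ℝ) / (1 / 4)) /
          ((n : ℝ) ^ (1 / 4 : ℝ) * (n : ℝ) ^ (3 / 4 : ℝ)) := by
        rw [← hsplit]
    _ = 4 * (g n / (n : ℝ) ^ (3 / 4 : ℝ)) := by
        field_simp

theorem summable_log_sq_div_sq : Summable fun n : ℕ ↦ Real.log n ^ 2 / (n : ℝ) ^ 2 := by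
  refine Summable.of_nonneg_of_le (fun n ↦ by positivity) (fun n ↦ ?_)
    ((Real.summable_nat_rpow_inv (p := 3 / 2).mpr (by norm_num)).mul_left 16)
  rcases n.eq_zero_or_pos with rfl | hn
  · simp
  have hn0 : (0 : ℝ) < n := by exact_mod_cast hn
  have hl := Real.log_le_rpow_div hn0.le (show (0 : ℝ) < 1 / 4 by norm_num)
  have hl0 := Real.log_natCast_nonneg n
  have hsq : ((n : ℝ) ^ (1 / 4 : ℝ)) ^ 2 * (n : ℝ) ^ (3 / 2 : ℝ) = (n : ℝ) ^ 2 := by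
    rw [← Real.rpow_natCast, ← Real.rpow_mul hn0.le, ← Real.rpow_add hn0, ← Real.rpow_natCast]
    norm_num
  rw [div_le_iff₀ (by positivity), ← hsq]
  calc Real.log n ^ 2 ≤ ((n : ℝ) ^ (1 / 4 : ℝ) / (1 / 4)) ^ 2 := by gcongr
    _ = _ := by field_simp; norm_num

open ArithmeticFunction.vonMangoldt in
/-- **Mertens' first theorem in arithmetic progressions**, with a logarithmic saving. -/
theorem exists_abs_sum_residueClass_div_sub_log_sub_le {q : ℕ} [NeZero q] {a : ZMod q}
    (ha : IsUnit a) :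
    ∃ c C : ℝ, ∀ᶠ x : ℝ in atTop,
      |∑ k ∈ Finset.Icc 1 ⌊x⌋₊, residueClass a k / k - (q.totient : ℝ)⁻¹ * Real.log x - c| ≤
        C / Real.log x := by
  set H := LFunctionResidueClassAux a
  obtain ⟨K, hK⟩ := exists_norm_deriv_deriv_dslope_LFunctionResidueClassAux_le a
  have hreal : H 1 = ((H 1).re : ℂ) := by
    have hcont : Tendsto (fun x : ℝ ↦ H x) (𝓝[>] 1) (𝓝 (H 1)) := by
      refine (continuousOn_LFunctionResidueClassAux a 1 (by simp)).tendsto.comp ?_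
      refine tendsto_nhdsWithin_iff.mpr ⟨?_, ?_⟩
      · exact (continuous_ofReal.tendsto' 1 1 ofReal_one).mono_left nhdsWithin_le_nhds
      · filter_upwards [self_mem_nhdsWithin] with x hx
        simpa using (mem_Ioi.mp hx).le
    refine tendsto_nhds_unique hcont ?_
    refine ((continuous_ofReal.comp continuous_re).tendsto (H 1)).comp hcont |>.congr' ?_
    filter_upwards [self_mem_nhdsWithin] with x hx
    exact (LFunctionResidueClassAux_real ha hx).symm
  have hf : ∀ n : ℕ, 0 ≤ residueClass a n / n := fun n ↦
    div_nonneg (residueClass_nonneg a n) n.cast_nonneg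
  have hterm : ∀ s : ℂ, LSeries.term (fun n ↦ ((residueClass a n / n : ℝ) : ℂ)) s =
      LSeries.term (fun n ↦ (residueClass a n : ℂ)) (1 + s) := fun s ↦ by
    ext n
    rcases eq_or_ne n 0 with rfl | hn
    · simp
    · have hn' : (n : ℂ) ≠ 0 := by exact_mod_cast hn
      rw [LSeries.term_of_ne_zero hn, LSeries.term_of_ne_zero hn, cpow_add _ _ hn', cpow_one]
      push_cast
      rw [div_div]
  have hsumm : ∀ s : ℂ, 0 < s.re →
      LSeriesSummable (fun n ↦ ((residueClass a n / n : ℝ) : ℂ)) s := fun s hs ↦ by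
    rw [LSeriesSummable, hterm]
    refine LSeriesSummable_of_abscissaOfAbsConv_lt_re
      ((abscissaOfAbsConv_residueClass_le_one a).trans_lt ?_)
    rw [add_re, one_re]
    exact_mod_cast lt_add_of_pos_right 1 hs
  have hsum : ∀ ε : ℝ, 0 < ε → ∃ B, ∀ x : ℝ, 1 < x →
      ∑ k ∈ Finset.Icc 1 ⌊x⌋₊, residueClass a k / k ≤ B * x ^ ε := fun ε hε ↦ by
    have hs := (hsumm ε (by rwa [ofReal_re])).norm
    refine ⟨∑' n, ‖LSeries.term (fun n ↦ ((residueClass a n / n : ℝ) : ℂ)) ε n‖, fun x hx ↦ ?_⟩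
    have hx0 : 0 < x := by linarith
    refine le_trans ?_ (mul_le_mul_of_nonneg_right
      (hs.sum_le_tsum (Finset.Icc 1 ⌊x⌋₊) fun n _ ↦ norm_nonneg _) (by positivity))
    rw [Finset.sum_mul]
    refine Finset.sum_le_sum fun n hn ↦ ?_
    obtain ⟨hn1, hnx⟩ := Finset.mem_Icc.mp hn
    have hn0 : (0 : ℝ) < n := by exact_mod_cast hn1
    rw [LSeries.norm_term_eq, if_neg (by omega), ofReal_re, norm_real, Real.norm_of_nonneg (hf n),
      div_mul_eq_mul_div, le_div_iff₀ (by positivity)]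
    gcongr
    · exact hf n
    · exact (Nat.le_floor_iff hx0.le).mp hnx
  have hQ : ∀ s : ℂ, 0 < s.re → LSeries (fun n ↦ ((residueClass a n / n : ℝ) : ℂ)) s =
      ((q.totient : ℝ)⁻¹ : ℝ) / s + ((H 1).re : ℂ) + s * dslope H 1 (1 + s) := fun s hs ↦ by
    have h1 := eqOn_LFunctionResidueClassAux ha
      (show 1 + s ∈ {s : ℂ | 1 < s.re} by simpa using hs)
    have hs0 : s ≠ 0 := by rintro rfl; simp at hs
    rw [LSeries, hterm, ← hreal, dslope_of_ne _ (by simpa using hs0), slope_def_field,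
      add_sub_cancel_left, mul_div_cancel₀ _ hs0]
    change _ = _ + _ + (H (1 + s) - H 1)
    change H (1 + s) = _ at h1
    rw [h1]
    beta_reduce
    rw [add_sub_cancel_left]
    push_cast
    simp only [LSeries]
    ring
  obtain ⟨C, hC⟩ := exists_abs_sum_sub_log_sub_le hf hsum (by positivity) hQ
    (by norm_num : (0 : ℝ) < 1 / 512) hK
  exact ⟨(H 1).re, C, hC⟩

open ArithmeticFunction.vonMangoldt in
/-- Summing `log p / (p - 1)` over primes in the progression instead of `Λ n / n` over all
integers in the progression changes the sum by a rapidly convergent series. -/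
theorem summable_abs_log_div_sub_residueClass_div_mul_log :
    Summable fun n : ℕ ↦ |(if n.Prime ∧ 2 < n ∧ n % 4 = 1 then Real.log n / ((n : ℝ) - 1) else 0) -
      residueClass (1 : ZMod 4) n / n| * Real.log n := by
  refine Summable.of_nonneg_of_le (fun n ↦ ?_) (fun n ↦ ?_)
    (summable_vonMangoldt_non_primes_mul_log_div.add (summable_log_sq_div_sq.mul_left 2))
  · exact mul_nonneg (abs_nonneg _) (Real.log_natCast_nonneg n)
  have hmod : (n : ZMod 4) = 1 ↔ n % 4 = 1 := by
    have := ZMod.natCast_eq_natCast_iff' n 1 4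
    simpa using this
  have hlog := Real.log_natCast_nonneg n
  by_cases hp : n.Prime
  · have hp2 : (2 : ℝ) ≤ n := by exact_mod_cast hp.two_le
    by_cases hn : n % 4 = 1
    · have h2 : 2 < n := by have := hp.two_le; omega
      rw [if_pos ⟨hp, h2, hn⟩, if_pos hp, residueClass, Set.indicator_of_mem (by exact hmod.mpr hn),
        ArithmeticFunction.vonMangoldt_apply_prime hp, zero_mul, zero_div, zero_add]
      have hd : Real.log n / ((n : ℝ) - 1) - Real.log n / n = Real.log n / (((n : ℝ) - 1) * n) := by
        have : (n : ℝ) - 1 ≠ 0 := by linarith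
        field_simp
        ring
      have h1 : 0 < (n : ℝ) - 1 := by linarith
      rw [hd, abs_of_nonneg (by positivity), div_mul_eq_mul_div, ← mul_div_assoc,
        div_le_div_iff₀ (by positivity) (by positivity)]
      nlinarith [mul_nonneg (mul_nonneg hlog hlog)
        (show (0 : ℝ) ≤ 2 * ((n - 1) * n) - n ^ 2 by nlinarith)]
    · rw [if_neg (by tauto), residueClass, Set.indicator_of_notMem (by exact hmod.not.mpr hn),
        zero_div, sub_zero, abs_zero, zero_mul, if_pos hp]
      positivity
  · rw [if_neg (by tauto), if_neg hp, zero_sub, abs_neg, abs_of_nonneg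
      (div_nonneg (residueClass_nonneg _ n) n.cast_nonneg), div_mul_eq_mul_div]
    refine le_add_of_le_of_nonneg ?_ (by positivity)
    gcongr
    exact residueClass_le _ n

open ArithmeticFunction.vonMangoldt in
/-- The sum of `log p / (p - 1)` over the primes `p ≡ 1 mod 4` up to `2 n` is
`(1 / 2) log n + C₁ + O(1 / log n)`. -/
theorem exists_sum_log_div_sub_one_isBigO :
    ∃ C₁ : ℝ, (fun n : ℕ ↦
      (∑ p ∈ (Finset.range (2 * n + 1)).filter (fun p ↦ p.Prime ∧ 2 < p ∧ p % 4 = 1),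
        Real.log p / ((p : ℝ) - 1)) - 1 / 2 * Real.log n - C₁) =O[atTop]
      fun n : ℕ ↦ (Real.log n)⁻¹ := by
  obtain ⟨c, A, hA⟩ := exists_abs_sum_residueClass_div_sub_log_sub_le (isUnit_one (M := ZMod 4))
  obtain ⟨c', B, hB⟩ :=
    exists_abs_sum_range_sub_le_div_log summable_abs_log_div_sub_residueClass_div_mul_log
  refine ⟨c + c' + 1 / 2 * Real.log 2, ?_⟩
  refine IsBigO.of_bound (|A| + |B|) ?_
  have h2n : Tendsto (fun n : ℕ ↦ ((2 * n : ℕ) : ℝ)) atTop atTop :=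
    tendsto_natCast_atTop_atTop.comp (tendsto_id.const_mul_atTop' two_pos)
  filter_upwards [h2n.eventually hA, eventually_ge_atTop 2] with n hn hn2
  have hn1 : (1 : ℝ) < n := by exact_mod_cast hn2
  have hlog : 0 < Real.log n := Real.log_pos hn1
  have hle : Real.log n ≤ Real.log (2 * n : ℕ) :=
    Real.log_le_log (by linarith) (by push_cast; linarith)
  have hn' := hB (2 * n) (by omega)
  rw [Nat.floor_natCast, show Nat.totient 4 = 2 by decide, Nat.cast_ofNat] at hn
  rw [Finset.sum_sub_distrib, ← Finset.sum_filter] at hn'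
  have hIcc : ∑ k ∈ Finset.Icc 1 (2 * n), residueClass (1 : ZMod 4) k / (k : ℝ) =
      ∑ k ∈ Finset.range (2 * n + 1), residueClass (1 : ZMod 4) k / (k : ℝ) := by
    refine Finset.sum_subset (fun k hk ↦ ?_) fun k hk hk' ↦ ?_
    · simp only [Finset.mem_Icc, Finset.mem_range] at hk ⊢; omega
    · simp only [Finset.mem_Icc, Finset.mem_range] at hk hk'
      rw [show k = 0 by omega, Nat.cast_zero, div_zero]
  rw [hIcc] at hn
  have hA' : A / Real.log (2 * n : ℕ) ≤ |A| / Real.log n := by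
    gcongr
    exact le_abs_self A
  have hB' : B / Real.log (2 * n : ℕ) ≤ |B| / Real.log n := by
    gcongr
    exact le_abs_self B
  have hlog2 : Real.log (2 * n : ℕ) = Real.log 2 + Real.log n := by
    push_cast
    exact Real.log_mul two_ne_zero (by linarith)
  rw [norm_inv, Real.norm_of_nonneg hlog.le, Real.norm_eq_abs, ← div_eq_mul_inv, add_div]
  refine le_trans (le_of_eq ?_) ((abs_add_le _ _).trans
    (add_le_add (hn.trans hA') (hn'.trans hB')))
  rw [hlog2]
  congr 1
  ring

end

/-- There exist a real constant `C₁` and a constant `C > 0` such that for all `n ≥ 2`,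
`|Σ_{2 < p ≤ 2n, p ≡ 1 (mod 4)} log p/(p−1) − (1/2)·log n − C₁| ≤ C/log n`. -/
theorem sum_log_over_primes_one_mod_four :
    ∃ C₁ : ℝ, ∃ C > 0, ∀ n : ℕ, 2 ≤ n →
      |(∑ p ∈ (Finset.range (2 * n + 1)).filter (fun p => p.Prime ∧ 2 < p ∧ p % 4 = 1),
          Real.log p / ((p : ℝ) - 1))
        - (1 / 2) * Real.log n - C₁| ≤ C / Real.log n := by
  obtain ⟨C₁, hO⟩ := exists_sum_log_div_sub_one_isBigO
  obtain ⟨C, hC, hbound⟩ := Asymptotics.bound_of_isBigO_nat_atTop hO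
  refine ⟨C₁, C, hC, fun n hn ↦ ?_⟩
  have hlog : 0 < Real.log n := Real.log_pos (by exact_mod_cast hn)
  have := hbound (inv_pos.mpr hlog).ne'
  rwa [norm_inv, Real.norm_of_nonneg hlog.le, Real.norm_eq_abs, ← div_eq_mul_inv] at this
end
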